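/- arXiv:2105.02424 — 2 statements merged into one kernel-verified Lean document; each statement's English description precedes it below -/
import Mathlib

section
/- Assume the setting and hypotheses of the main theorem: N ≥ 2, 1 < p < ∞, Σ ⊆ ℝ^N an open convex cone with vertex at 0, Ω = B_R(0) a Wulff ball centered at 0, Γ₀ := Σ ∩ ∂Ω, Γ₁ := ∂Σ ∩ Ω; w : closure(Σ) → [0,∞) continuous, positively homogeneous of degree λ ≥ 0, locally Lipschitz in Σ, with w^{1/λ} concave in Σ when λ > 0, and D := N + λ; f : [0,∞) → ℝ nonnegative, measurable and bounded on compact sets; u nonnegative, Lipschitz on Σ∩Ω, continuously differentiable on (Σ∩Ω) ∪ Γ₀ ∪ (Γ₁∖{0}), u = 0 on Γ₀, and a weak solution of the mixed problem: ∫_{Σ∩Ω} w H(∇u)^{p−1} ⟨∇H(∇u), ∇φ⟩ dx = ∫_{Σ∩Ω} f(u) φ w dx for every φ ∈ C_c^∞(ℝ^N) vanishing in a neighborhood of the closure of Γ₀. Set M := sup_{Σ∩Ω} u, I(t) := ∫_{{u>t}} f(u) w dx, μ(t) := ∫_{{u>t}} w dx, and c := P_{w,H}(B;Σ) / w(Σ∩B)^{(D−1)/D},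 where B is the unit Wulff ball centered at 0. Then the following Hölder-isoperimetric-type inequality holds for almost every t ∈ (0,M): I(t)^{1/p} · ( ∫_{{x : u(x)=t, ∇u(x)≠0}} (w(x)/|∇u(x)|) dH^{N−1}(x) )^{(p−1)/p} ≥ c · μ(t)^{(D−1)/D}. -/
open MeasureTheory Set Metric
open scoped ENNReal NNReal RealInnerProductSpace Topology Classical

noncomputable section

/-- Divergence of a vector field on `ℝ^N`, computed coordinatewise. -/
def vdiv {N : ℕ} (σ : EuclideanSpace ℝ (Fin N) → EuclideanSpace ℝ (Fin N))
    (x : EuclideanSpace ℝ (Fin N)) : ℝ :=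
  ∑ i, fderiv ℝ σ x (EuclideanSpace.single i 1) i

/-- The dual norm `H₀(x) = sup_{ξ ≠ 0} ⟨x, ξ⟩ / H(ξ)`. -/
def dualNorm {N : ℕ} (H : EuclideanSpace ℝ (Fin N) → ℝ) (x : EuclideanSpace ℝ (Fin N)) : ℝ :=
  sSup ((fun ξ => ⟪x, ξ⟫ / H ξ) '' {ξ : EuclideanSpace ℝ (Fin N) | ξ ≠ 0})

/-- `H` is a norm on `ℝ^N`: convex, positive away from `0`, absolutely homogeneous. -/
structure IsAnisoNorm {N : ℕ} (H : EuclideanSpace ℝ (Fin N) → ℝ) : Prop where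
  conv : ConvexOn ℝ Set.univ H
  pos : ∀ ξ, ξ ≠ 0 → 0 < H ξ
  hom : ∀ (t : ℝ) (ξ : EuclideanSpace ℝ (Fin N)), H (t • ξ) = |t| * H ξ

/-- `H` is `C²` away from the origin and uniformly elliptic: the Hessian of
`ξ ↦ ½ H(ξ)²` is positive definite at every `ξ ≠ 0`. -/
def UniformlyElliptic {N : ℕ} (H : EuclideanSpace ℝ (Fin N) → ℝ) : Prop :=
  ContDiffOn ℝ 2 H {(0 : EuclideanSpace ℝ (Fin N))}ᶜ ∧
  ∀ ξ : EuclideanSpace ℝ (Fin N), ξ ≠ 0 → ∀ v : EuclideanSpace ℝ (Fin N), v ≠ 0 →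
    0 < ⟪fderiv ℝ (gradient (fun z => H z ^ 2 / 2)) ξ v, v⟫

/-- The anisotropic vector field `H(∇u)^{p-1} ∇H(∇u)`, understood to be `0`
at points where `∇u = 0`. -/
def aField {N : ℕ} (H : EuclideanSpace ℝ (Fin N) → ℝ) (p : ℝ)
    (u : EuclideanSpace ℝ (Fin N) → ℝ) (x : EuclideanSpace ℝ (Fin N)) :
    EuclideanSpace ℝ (Fin N) :=
  if gradient u x = 0 then 0 else H (gradient u x) ^ (p - 1) • gradient H (gradient u x)

/-- Weighted anisotropic perimeter of `E` relative to `S`: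
`sup { ∫_E div σ : σ ∈ C¹_c(S; ℝ^N), ρ(σ(x)) ≤ w(x) for all x }`, valued in `[0,∞]`. -/
def periW {N : ℕ} (ρ w : EuclideanSpace ℝ (Fin N) → ℝ)
    (E S : Set (EuclideanSpace ℝ (Fin N))) : ℝ≥0∞ :=
  ⨆ σ ∈ {σ : EuclideanSpace ℝ (Fin N) → EuclideanSpace ℝ (Fin N) |
      ContDiff ℝ 1 σ ∧ HasCompactSupport σ ∧ tsupport σ ⊆ S ∧ ∀ x, ρ (σ x) ≤ w x},
    ENNReal.ofReal (∫ x in E, vdiv σ x)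

/-- Open convex cone with vertex at the origin (the case `S = ℝ^N` is allowed). -/
def IsOpenConvexCone {N : ℕ} (S : Set (EuclideanSpace ℝ (Fin N))) : Prop :=
  IsOpen S ∧ Convex ℝ S ∧ ∀ x ∈ S, ∀ t : ℝ, 0 < t → t • x ∈ S

/-- The lineality space of `S`: directions along which `S` is translation invariant.
For a convex cone `Σ = ℝ^k × Σ̃` with `Σ̃` containing no lines this is `ℝ^k × {0}`. -/
def lineality {N : ℕ} (S : Set (EuclideanSpace ℝ (Fin N))) :
    Set (EuclideanSpace ℝ (Fin N)) :=
  {v | ∀ x ∈ S, ∀ t : ℝ, x + t • v ∈ S}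

lemma volume_add_le_of_add_mem {A B C : Set ℝ} (hA : MeasurableSet A) (hB : MeasurableSet B)
    (hAn : A.Nonempty) (hBn : B.Nonempty) (h : ∀ x ∈ A, ∀ y ∈ B, x + y ∈ C) :
    volume A + volume B ≤ volume C := by
  have key : ∀ K L : Set ℝ, K ⊆ A → L ⊆ B → IsCompact K → IsCompact L → K.Nonempty → L.Nonempty →
      volume K + volume L ≤ volume C := by
    intro K L hK hL cK cL nK nL
    obtain ⟨a, haK, ha⟩ := cK.exists_isGreatest nK
    obtain ⟨b, hbL, hb⟩ := cL.exists_isLeast nL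
    have h1 : volume ((fun x => x + b) '' K) = volume K := by
      rw [Set.image_add_right, measure_preimage_add_right]
    have h2 : volume ((fun x => a + x) '' L) = volume L := by
      rw [Set.image_add_left, measure_preimage_add]
    have hd : AEDisjoint volume ((fun x => x + b) '' K) ((fun x => a + x) '' L) := by
      refine measure_mono_null (t := {a + b}) ?_ (by simp)
      rintro _ ⟨⟨x, hx, rfl⟩, ⟨y, hy, hxy⟩⟩
      have := ha hx
      have := hb hy
      simp only [mem_singleton_iff] at *
      linarith
    rw [← h1, ← h2, ← measure_union₀ ((cL.image (by fun_prop)).measurableSet.nullMeasurableSet) hd]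
    refine measure_mono (union_subset ?_ ?_)
    · rintro _ ⟨x, hx, rfl⟩
      exact h x (hK hx) b (hL hbL)
    · rintro _ ⟨x, hx, rfl⟩
      exact h a (hK haK) x (hL hx)
  obtain ⟨a, ha⟩ := hAn
  obtain ⟨b, hb⟩ := hBn
  have key2 : ∀ K L : Set ℝ, K ⊆ A → L ⊆ B → IsCompact K → IsCompact L →
      volume K + volume L ≤ volume C := fun K L hK hL cK cL =>
    le_trans (add_le_add (measure_mono (subset_insert _ _)) (measure_mono (subset_insert _ _)))
      (key (insert a K) (insert b L) (insert_subset ha hK) (insert_subset hb hL)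
        (cK.insert a) (cL.insert b) (insert_nonempty _ _) (insert_nonempty _ _))
  rcases eq_or_ne (volume C) ⊤ with hC | hC
  · simp [hC]
  have step : ∀ L ⊆ B, IsCompact L → volume A + volume L ≤ volume C := by
    intro L hL cL
    have hLC : volume L ≤ volume C := by simpa using key2 ∅ L (empty_subset _) hL isCompact_empty cL
    refine _root_.add_le_of_le_tsub_right_of_le hLC ?_
    rw [hA.measure_eq_iSup_isCompact]
    exact iSup_le fun K => iSup_le fun hK => iSup_le fun cK =>
      ENNReal.le_sub_of_add_le_right cL.measure_lt_top.ne (key2 K L hK hL cK cL)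
  have hAC : volume A ≤ volume C := by simpa using step ∅ (empty_subset _) isCompact_empty
  rw [add_comm]
  refine _root_.add_le_of_le_tsub_right_of_le hAC ?_
  rw [hB.measure_eq_iSup_isCompact]
  exact iSup_le fun L => iSup_le fun hL => iSup_le fun cL =>
    ENNReal.le_sub_of_add_le_right (ne_top_of_le_ne_top hC hAC)
      (by rw [add_comm]; exact step L hL cL)

lemma lintegral_eq_lintegral_Ioo_meas_lt {F : ℝ → ℝ≥0∞} (hF : Measurable F) (h1 : ∀ x, F x ≤ 1) :
    ∫⁻ x, F x = ∫⁻ a in Ioo (0:ℝ) 1, volume {x | ENNReal.ofReal a < F x} := by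
  have hfin : ∀ x, F x ≠ ⊤ := fun x => ((h1 x).trans_lt ENNReal.one_lt_top).ne
  have e1 : ∫⁻ x, F x = ∫⁻ x, ENNReal.ofReal (F x).toReal := by
    simp only [ENNReal.ofReal_toReal (hfin _)]
  rw [e1, lintegral_eq_lintegral_meas_lt volume (Filter.Eventually.of_forall fun x => by simp)
    hF.ennreal_toReal.aemeasurable]
  rw [← Ioo_union_Ici_eq_Ioi (zero_lt_one' ℝ), lintegral_union measurableSet_Ici
    (by rw [Set.disjoint_left]; intro x hx hx'; exact absurd hx.2 (not_lt.2 hx'))]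
  have e2 : ∫⁻ t in Ici (1:ℝ), volume {a | t < (F a).toReal} = 0 := by
    rw [setLIntegral_congr_fun (g := 0) measurableSet_Ici]
    · simp
    · intro t ht
      have : {a | t < (F a).toReal} = ∅ := by
        ext x
        simp only [mem_ofPred_eq, mem_empty_iff_false, iff_false, not_lt]
        exact (ENNReal.toReal_mono ENNReal.one_ne_top (h1 x)).trans (by simpa using ht)
      simp [this]
  rw [e2, add_zero]
  refine setLIntegral_congr_fun measurableSet_Ioo fun t ht => ?_
  congr 1
  ext x
  exact (ENNReal.ofReal_lt_iff_lt_toReal ht.1.le (hfin x)).symm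

lemma ennreal_geom_mean_le {s : ℝ} (hs0 : 0 < s) (hs1 : s < 1) (a b : ℝ≥0∞) :
    a ^ (1 - s) * b ^ s ≤ ENNReal.ofReal (1 - s) * a + ENNReal.ofReal s * b := by
  rcases eq_or_ne a ⊤ with rfl | ha
  · rw [ENNReal.mul_top (by simpa using hs1)]
    simp
  rcases eq_or_ne b ⊤ with rfl | hb
  · rw [ENNReal.mul_top (by simpa using hs0)]
    simp
  lift a to ℝ≥0 using ha
  lift b to ℝ≥0 using hb
  rw [← ENNReal.coe_rpow_of_nonneg _ (by linarith), ← ENNReal.coe_rpow_of_nonneg _ hs0.le]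
  have := NNReal.geom_mean_le_arith_mean2_weighted (1 - s).toNNReal s.toNNReal a b
    (by rw [← Real.toNNReal_add (by linarith) hs0.le]; simp)
  rw [Real.coe_toNNReal _ (by linarith), Real.coe_toNNReal _ hs0.le] at this
  simp only [ENNReal.ofReal]
  exact_mod_cast this

/-- The Prékopa–Leindler inequality as a property of a measure on a real vector space. -/
def SatisfiesPrekopaLeindler {E : Type*} [AddCommGroup E] [Module ℝ E] [MeasurableSpace E]
    (μ : Measure E) : Prop :=
  ∀ s : ℝ, 0 < s → s < 1 → ∀ f g h : E → ℝ≥0∞, Measurable f → Measurable g → Measurable h →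
    (∀ x y, f x ^ (1 - s) * g y ^ s ≤ h ((1 - s) • x + s • y)) →
    (∫⁻ x, f x ∂μ) ^ (1 - s) * (∫⁻ x, g x ∂μ) ^ s ≤ ∫⁻ x, h x ∂μ

lemma prekopa_leindler_real_of_iSup_eq_one {s : ℝ} (hs0 : 0 < s) (hs1 : s < 1)
    {f g h : ℝ → ℝ≥0∞} (hf : Measurable f) (hg : Measurable g) (hh : Measurable h)
    (H : ∀ x y, f x ^ (1 - s) * g y ^ s ≤ h ((1 - s) • x + s • y))
    (hf1 : ⨆ x, f x = 1) (hg1 : ⨆ x, g x = 1) :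
    (∫⁻ x, f x) ^ (1 - s) * (∫⁻ x, g x) ^ s ≤ ∫⁻ x, h x := by
  have hs1' : 0 < 1 - s := by linarith
  refine (ennreal_geom_mean_le hs0 hs1 _ _).trans ?_
  have hfl : ∀ x, f x ≤ 1 := fun x => hf1 ▸ le_iSup f x
  have hgl : ∀ x, g x ≤ 1 := fun x => hg1 ▸ le_iSup g x
  calc ENNReal.ofReal (1 - s) * (∫⁻ x, f x) + ENNReal.ofReal s * ∫⁻ x, g x
      = ∫⁻ a in Ioo (0:ℝ) 1, (ENNReal.ofReal (1 - s) * volume {x | ENNReal.ofReal a < f x} +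
          ENNReal.ofReal s * volume {x | ENNReal.ofReal a < g x}) := by
        rw [lintegral_eq_lintegral_Ioo_meas_lt hf hfl, lintegral_eq_lintegral_Ioo_meas_lt hg hgl,
          lintegral_add_left', lintegral_const_mul', lintegral_const_mul'] <;> try simp
        refine AEMeasurable.const_mul (Antitone.measurable ?_).aemeasurable _
        intro a b hab
        exact measure_mono fun x hx => (ENNReal.ofReal_le_ofReal hab).trans_lt hx
    _ ≤ ∫⁻ a in Ioo (0:ℝ) 1, volume {x | ENNReal.ofReal a < min (h x) 1} := by
        refine setLIntegral_mono' measurableSet_Ioo fun a ha => ?_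
        have ha1 : ENNReal.ofReal a < 1 := by simpa using ha.2
        have e : ∀ (r : ℝ) (_ : 0 < r) (A : Set ℝ),
            ENNReal.ofReal r * volume A = volume ((fun x => r • x) '' A) := by
          intro r hr A
          have := Measure.addHaar_smul volume r A
          rw [Module.finrank_self, pow_one, abs_of_pos hr] at this
          rw [← this]; rfl
        rw [e _ hs1', e _ hs0]
        refine volume_add_le_of_add_mem ?_ ?_ ?_ ?_ ?_
        · exact (measurableSet_lt measurable_const hf).const_smul₀ (1 - s)
        · exact (measurableSet_lt measurable_const hg).const_smul₀ s
        · obtain ⟨x, hx⟩ := lt_iSup_iff.1 (hf1 ▸ ha1)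
          exact ⟨_, x, hx, rfl⟩
        · obtain ⟨x, hx⟩ := lt_iSup_iff.1 (hg1 ▸ ha1)
          exact ⟨_, x, hx, rfl⟩
        · rintro _ ⟨x, hx, rfl⟩ _ ⟨y, hy, rfl⟩
          refine lt_min (lt_of_lt_of_le ?_ (H x y)) ha1
          have e2 : ENNReal.ofReal a = ENNReal.ofReal a ^ (1 - s) * ENNReal.ofReal a ^ s := by
            rw [← ENNReal.rpow_add _ _ (by simpa using ha.1) ENNReal.ofReal_ne_top]
            simp
          rw [e2]
          exact ENNReal.mul_lt_mul (ENNReal.rpow_lt_rpow hx hs1') (ENNReal.rpow_lt_rpow hy hs0)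
    _ = ∫⁻ x, min (h x) 1 :=
        (lintegral_eq_lintegral_Ioo_meas_lt (hh.min measurable_const) fun x => min_le_right _ _).symm
    _ ≤ ∫⁻ x, h x := lintegral_mono fun x => min_le_left _ _

lemma prekopa_leindler_real_of_bounded {s : ℝ} (hs0 : 0 < s) (hs1 : s < 1)
    {f g h : ℝ → ℝ≥0∞} (hf : Measurable f) (hg : Measurable g) (hh : Measurable h)
    (H : ∀ x y, f x ^ (1 - s) * g y ^ s ≤ h ((1 - s) • x + s • y))
    (hf1 : ⨆ x, f x ≠ ⊤) (hg1 : ⨆ x, g x ≠ ⊤) :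
    (∫⁻ x, f x) ^ (1 - s) * (∫⁻ x, g x) ^ s ≤ ∫⁻ x, h x := by
  have hs1' : 0 < 1 - s := by linarith
  set F := ⨆ x, f x with hF
  set G := ⨆ x, g x with hG
  rcases eq_or_ne F 0 with h0 | hF0
  · have : ∀ x, f x = 0 := fun x => le_antisymm (h0 ▸ le_iSup f x) zero_le
    simp [this, ENNReal.zero_rpow_of_pos hs1']
  rcases eq_or_ne G 0 with h0 | hG0
  · have : ∀ x, g x = 0 := fun x => le_antisymm (h0 ▸ le_iSup g x) zero_le
    simp [this, ENNReal.zero_rpow_of_pos hs0]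
  set c := (F⁻¹) ^ (1 - s) * (G⁻¹) ^ s with hc
  have hFi : F⁻¹ ≠ 0 := by simpa using hf1
  have hGi : G⁻¹ ≠ 0 := by simpa using hg1
  have hFt : F⁻¹ ≠ ⊤ := by simpa using hF0
  have hGt : G⁻¹ ≠ ⊤ := by simpa using hG0
  have hc0 : c ≠ 0 := mul_ne_zero
    (by rw [Ne, ENNReal.rpow_eq_zero_iff]; simp [hFi, hFt])
    (by rw [Ne, ENNReal.rpow_eq_zero_iff]; simp [hGi, hGt])
  have hct : c ≠ ⊤ := ENNReal.mul_ne_top (ENNReal.rpow_ne_top_of_nonneg hs1'.le hFt)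
    (ENNReal.rpow_ne_top_of_nonneg hs0.le hGt)
  have key := prekopa_leindler_real_of_iSup_eq_one hs0 hs1 (f := fun x => F⁻¹ * f x)
    (g := fun x => G⁻¹ * g x) (h := fun x => c * h x) (hf.const_mul _) (hg.const_mul _)
    (hh.const_mul _) ?_ ?_ ?_
  · rw [lintegral_const_mul _ hf, lintegral_const_mul _ hg, lintegral_const_mul _ hh,
      ENNReal.mul_rpow_of_nonneg _ _ hs1'.le, ENNReal.mul_rpow_of_nonneg _ _ hs0.le,
      mul_mul_mul_comm, ← hc] at key
    exact (ENNReal.mul_le_mul_iff_right hc0 hct).1 key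
  · intro x y
    rw [ENNReal.mul_rpow_of_nonneg _ _ hs1'.le, ENNReal.mul_rpow_of_nonneg _ _ hs0.le,
      mul_mul_mul_comm, ← hc]
    gcongr
    exact H x y
  · rw [← ENNReal.mul_iSup, ← hF, ENNReal.inv_mul_cancel hF0 hf1]
  · rw [← ENNReal.mul_iSup, ← hG, ENNReal.inv_mul_cancel hG0 hg1]

lemma satisfiesPrekopaLeindler_real : SatisfiesPrekopaLeindler (volume : Measure ℝ) := by
  intro s hs0 hs1 f g h hf hg hh H
  have hs1' : 0 < 1 - s := by linarith
  have mono : ∀ f : ℝ → ℝ≥0∞, Measurable f →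
      Filter.Tendsto (fun n : ℕ => ∫⁻ x, min (f x) n) Filter.atTop (𝓝 (∫⁻ x, f x)) := by
    intro f hf
    refine lintegral_tendsto_of_tendsto_of_monotone (fun n => (hf.min measurable_const).aemeasurable)
      (Filter.Eventually.of_forall fun x => ?_) (Filter.Eventually.of_forall fun x => ?_)
    · intro a b hab
      dsimp only
      gcongr
    · have : Filter.Tendsto (fun n : ℕ => min (f x) (n : ℝ≥0∞)) Filter.atTop (𝓝 (min (f x) ⊤)) :=
        tendsto_const_nhds.min ENNReal.tendsto_nat_nhds_top
      simpa using this
  have hle : ∀ n : ℕ, (∫⁻ x, min (f x) n) ^ (1 - s) * (∫⁻ x, min (g x) n) ^ s ≤ ∫⁻ x, h x := by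
    intro n
    refine prekopa_leindler_real_of_bounded hs0 hs1 (hf.min measurable_const)
      (hg.min measurable_const) hh ?_ ?_ ?_
    · intro x y
      refine le_trans ?_ (H x y)
      gcongr <;> exact min_le_left _ _
    · exact ((iSup_le fun x => min_le_right _ _).trans_lt (ENNReal.natCast_lt_top n)).ne
    · exact ((iSup_le fun x => min_le_right _ _).trans_lt (ENNReal.natCast_lt_top n)).ne
  by_cases h0 : (∫⁻ x, f x) = 0 ∨ (∫⁻ x, g x) = 0
  · rcases h0 with h0 | h0 <;> rw [h0]
    · simp [ENNReal.zero_rpow_of_pos hs1']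
    · simp [ENNReal.zero_rpow_of_pos hs0]
  push Not at h0
  refine le_of_tendsto' (ENNReal.Tendsto.mul ((ENNReal.continuous_rpow_const.tendsto _).comp
    (mono f hf)) (Or.inl ?_) ((ENNReal.continuous_rpow_const.tendsto _).comp (mono g hg))
    (Or.inl ?_)) hle
  · rw [Ne, ENNReal.rpow_eq_zero_iff]; simp [h0.1, hs1'.not_gt]
  · rw [Ne, ENNReal.rpow_eq_zero_iff]; simp [h0.2, hs0.not_gt]

lemma SatisfiesPrekopaLeindler.prod {E F : Type*} [AddCommGroup E] [Module ℝ E] [MeasurableSpace E]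
    [AddCommGroup F] [Module ℝ F] [MeasurableSpace F] {μ : Measure E} {ν : Measure F}
    [SFinite μ] [SFinite ν]
    (hμ : SatisfiesPrekopaLeindler μ) (hν : SatisfiesPrekopaLeindler ν) :
    SatisfiesPrekopaLeindler (μ.prod ν) := by
  intro s hs0 hs1 f g h hf hg hh H
  rw [lintegral_prod _ hf.aemeasurable, lintegral_prod _ hg.aemeasurable,
    lintegral_prod _ hh.aemeasurable]
  refine hμ s hs0 hs1 _ _ _ hf.lintegral_prod_right' hg.lintegral_prod_right'
    hh.lintegral_prod_right' fun x y => ?_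
  refine hν s hs0 hs1 _ _ _ (hf.comp measurable_prodMk_left) (hg.comp measurable_prodMk_left)
    (hh.comp measurable_prodMk_left) fun a b => ?_
  exact H (x, a) (y, b)

lemma SatisfiesPrekopaLeindler.of_measurePreserving {E F : Type*} [AddCommGroup E] [Module ℝ E]
    [MeasurableSpace E] [AddCommGroup F] [Module ℝ F] [MeasurableSpace F] {μ : Measure E}
    {ν : Measure F} (hμ : SatisfiesPrekopaLeindler μ) (T : E → F) (hT : MeasurePreserving T μ ν)
    (hlin : ∀ (a b : ℝ) x y, T (a • x + b • y) = a • T x + b • T y) :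
    SatisfiesPrekopaLeindler ν := by
  intro s hs0 hs1 f g h hf hg hh H
  rw [← hT.lintegral_comp hf, ← hT.lintegral_comp hg, ← hT.lintegral_comp hh]
  refine hμ s hs0 hs1 _ _ _ (hf.comp hT.measurable) (hg.comp hT.measurable)
    (hh.comp hT.measurable) fun x y => ?_
  rw [hlin]
  exact H _ _

lemma satisfiesPrekopaLeindler_pi (n : ℕ) :
    SatisfiesPrekopaLeindler (volume : Measure (Fin n → ℝ)) := by
  induction n with
  | zero =>
    intro s hs0 hs1 f g h hf hg hh H
    simp only [lintegral_unique]
    have := H default default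
    rw [Subsingleton.elim ((1 - s) • (default : Fin 0 → ℝ) + s • default) default] at this
    have e : (volume : Measure (Fin 0 → ℝ)) univ = 1 := by simp [volume_pi]
    rw [e, mul_one, mul_one, mul_one]
    convert this
  | succ n ih =>
    refine (satisfiesPrekopaLeindler_real.prod ih).of_measurePreserving
      (MeasurableEquiv.piFinSuccAbove (fun _ => ℝ) 0).symm
      (volume_preserving_piFinSuccAbove (fun _ => ℝ) 0).symm ?_
    intro a b x y
    ext i
    refine Fin.cases ?_ (fun j => ?_) i <;>
      simp [MeasurableEquiv.piFinSuccAbove]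

lemma satisfiesPrekopaLeindler_euclideanSpace (n : ℕ) :
    SatisfiesPrekopaLeindler (volume : Measure (EuclideanSpace ℝ (Fin n))) :=
  (satisfiesPrekopaLeindler_pi n).of_measurePreserving (WithLp.toLp 2)
    (PiLp.volume_preserving_toLp (Fin n)) fun _ _ _ _ => rfl

/-- A nonnegative weight on an open convex cone, homogeneous of degree `lam` and log-concave. -/
structure IsConeWeight {N : ℕ} (S : Set (EuclideanSpace ℝ (Fin N))) (lam : ℝ)
    (w : EuclideanSpace ℝ (Fin N) → ℝ) : Prop where
  cone : IsOpenConvexCone S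
  cont : ContinuousOn w (closure S)
  nonneg : ∀ x ∈ closure S, 0 ≤ w x
  deg_nonneg : 0 ≤ lam
  hom : ∀ x ∈ closure S, ∀ t : ℝ, 0 < t → w (t • x) = t ^ lam * w x
  logconc : ∀ s : ℝ, 0 < s → s < 1 → ∀ x ∈ S, ∀ y ∈ S,
    w x ^ (1 - s) * w y ^ s ≤ w ((1 - s) • x + s • y)

lemma IsConeWeight.of_concave {N : ℕ} {S : Set (EuclideanSpace ℝ (Fin N))} {lam : ℝ}
    {w : EuclideanSpace ℝ (Fin N) → ℝ} (hS : IsOpenConvexCone S) (hlam : 0 ≤ lam)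
    (hwc : ContinuousOn w (closure S)) (hwnn : ∀ x ∈ closure S, 0 ≤ w x)
    (hwhom : ∀ x ∈ closure S, ∀ t : ℝ, 0 < t → w (t • x) = t ^ lam * w x)
    (hwconc : 0 < lam → ConcaveOn ℝ S (fun x => w x ^ (1 / lam))) :
    IsConeWeight S lam w := by
  refine ⟨hS, hwc, hwnn, hlam, hwhom, fun s hs0 hs1 x hx y hy => ?_⟩
  have hx0 := hwnn x (subset_closure hx)
  have hy0 := hwnn y (subset_closure hy)
  have hs1' : 0 < 1 - s := by linarith
  have hz : (1 - s) • x + s • y ∈ S := hS.2.1 hx hy hs1'.le hs0.le (by ring)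
  rcases hlam.eq_or_lt with rfl | hl
  · have hconst : ∀ x ∈ S, w x = w 0 := by
      intro x hx
      have hlim : Filter.Tendsto (fun t : ℝ => t • x) (𝓝[>] 0) (𝓝[closure S] 0) := by
        refine tendsto_nhdsWithin_iff.2 ⟨?_, ?_⟩
        · have : Filter.Tendsto (fun t : ℝ => t • x) (𝓝 0) (𝓝 ((0:ℝ) • x)) :=
            (continuous_id.smul continuous_const).tendsto 0
          rw [zero_smul] at this
          exact this.mono_left nhdsWithin_le_nhds
        · filter_upwards [self_mem_nhdsWithin] with t ht
          exact subset_closure (hS.2.2 x hx t ht)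
      have h0 : (0 : EuclideanSpace ℝ (Fin N)) ∈ closure S :=
        mem_closure_iff_nhdsWithin_neBot.2 (by
          have h1 : Filter.Tendsto (fun t : ℝ => t • x) (𝓝[>] 0) (𝓝[S] 0) := by
            refine tendsto_nhdsWithin_iff.2 ⟨hlim.mono_right nhdsWithin_le_nhds, ?_⟩
            filter_upwards [self_mem_nhdsWithin] with t ht
            exact hS.2.2 x hx t ht
          exact h1.neBot)
      have h2 : Filter.Tendsto (fun t : ℝ => w (t • x)) (𝓝[>] 0) (𝓝 (w 0)) :=
        (hwc 0 h0).tendsto.comp hlim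
      refine tendsto_nhds_unique (tendsto_const_nhds.congr' ?_) h2
      filter_upwards [self_mem_nhdsWithin] with t ht
      rw [hwhom x (subset_closure hx) t ht, Real.rpow_zero, one_mul]
    have h0 : 0 ≤ w 0 := hconst x hx ▸ hx0
    rw [hconst x hx, hconst y hy, hconst _ hz]
    rw [← Real.rpow_add' h0 (by simp)]
    simp
  · have hc := (hwconc hl).2 hx hy hs1'.le hs0.le (by ring)
    simp only [smul_eq_mul] at hc
    have ha : 0 ≤ w x ^ (1 / lam) := Real.rpow_nonneg hx0 _
    have hb : 0 ≤ w y ^ (1 / lam) := Real.rpow_nonneg hy0 _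
    have hg := (Real.geom_mean_le_arith_mean2_weighted hs1'.le hs0.le ha hb (by ring)).trans hc
    have hp := Real.rpow_le_rpow (by positivity) hg hl.le
    rw [← Real.rpow_mul (hwnn _ (subset_closure hz)), one_div_mul_cancel hl.ne', Real.rpow_one,
      Real.mul_rpow (by positivity) (by positivity), ← Real.rpow_mul ha, ← Real.rpow_mul hb,
      ← Real.rpow_mul hx0, ← Real.rpow_mul hy0] at hp
    have e1 : ∀ r : ℝ, 1 / lam * (r * lam) = r := fun r => by field_simp
    rwa [e1, e1] at hp

/-- The measure with density `w` on `S`. -/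
def coneMeasure {N : ℕ} (S : Set (EuclideanSpace ℝ (Fin N)))
    (w : EuclideanSpace ℝ (Fin N) → ℝ) : Measure (EuclideanSpace ℝ (Fin N)) :=
  volume.withDensity (S.indicator fun x => ENNReal.ofReal (w x))

namespace IsConeWeight

variable {N : ℕ} {S : Set (EuclideanSpace ℝ (Fin N))} {lam : ℝ}
    {w : EuclideanSpace ℝ (Fin N) → ℝ}

lemma measurableSet (h : IsConeWeight S lam w) : MeasurableSet S := h.cone.1.measurableSet

lemma smul_mem_iff (h : IsConeWeight S lam w) {r : ℝ} (hr : 0 < r)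
    {x : EuclideanSpace ℝ (Fin N)} : r • x ∈ S ↔ x ∈ S := by
  refine ⟨fun hx => ?_, fun hx => h.cone.2.2 x hx r hr⟩
  have := h.cone.2.2 _ hx r⁻¹ (inv_pos.2 hr)
  rwa [smul_smul, inv_mul_cancel₀ hr.ne', one_smul] at this

lemma measurable_density (h : IsConeWeight S lam w) :
    Measurable (S.indicator fun x => ENNReal.ofReal (w x)) := by
  have : Measurable (S.piecewise (fun x => ENNReal.ofReal (w x)) 0) := by
    refine ContinuousOn.measurable_piecewise ?_ continuousOn_const h.measurableSet
    exact ENNReal.continuous_ofReal.comp_continuousOn (h.cont.mono subset_closure)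
  rwa [Set.piecewise_eq_indicator] at this

lemma coneMeasure_smul (h : IsConeWeight S lam w) {r : ℝ} (hr : 0 < r)
    {A : Set (EuclideanSpace ℝ (Fin N))} (hA : MeasurableSet A) :
    coneMeasure S w ((fun x => r • x) '' A) =
      ENNReal.ofReal (r ^ ((N : ℝ) + lam)) * coneMeasure S w A := by
  have hinj : Function.Injective fun x : EuclideanSpace ℝ (Fin N) => r • x :=
    smul_right_injective _ hr.ne'
  have hmA : MeasurableSet ((fun x => r • x) '' A) := hA.const_smul₀ r
  rw [coneMeasure, withDensity_apply _ hmA, withDensity_apply _ hA,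
    lintegral_image_eq_lintegral_abs_det_fderiv_mul volume hA
      (f := fun x => r • x) (f' := fun _ => r • ContinuousLinearMap.id ℝ _)
      (fun x _ => ((hasFDerivAt_id x).const_smul r).hasFDerivWithinAt) hinj.injOn,
    ← lintegral_const_mul _ h.measurable_density]
  congr 1
  ext x
  have hdet : (r • ContinuousLinearMap.id ℝ (EuclideanSpace ℝ (Fin N))).det = r ^ N := by
    simp [ContinuousLinearMap.det]
  rw [hdet, abs_of_pos (by positivity)]
  by_cases hx : x ∈ S
  · rw [indicator_of_mem hx, indicator_of_mem ((h.smul_mem_iff hr).2 hx),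
      h.hom x (subset_closure hx) r hr, ← ENNReal.ofReal_mul (by positivity),
      ← ENNReal.ofReal_mul (by positivity), ← mul_assoc, Real.rpow_add hr, Real.rpow_natCast]
  · rw [indicator_of_notMem hx, indicator_of_notMem (fun h' => hx ((h.smul_mem_iff hr).1 h'))]
    simp

/-- Brunn–Minkowski inequality for the weighted measure of a cone. -/
lemma brunnMinkowski (h : IsConeWeight S lam w)
    {A B C : Set (EuclideanSpace ℝ (Fin N))} (hA : MeasurableSet A) (hB : MeasurableSet B)
    (hC : MeasurableSet C) (hAS : A ⊆ S) (hBS : B ⊆ S) (hABC : ∀ x ∈ A, ∀ y ∈ B, x + y ∈ C)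
    {a b : ℝ} (ha : 0 < a) (hb : 0 < b)
    (hAa : coneMeasure S w A = ENNReal.ofReal (a ^ ((N : ℝ) + lam)))
    (hBb : coneMeasure S w B = ENNReal.ofReal (b ^ ((N : ℝ) + lam))) :
    ENNReal.ofReal ((a + b) ^ ((N : ℝ) + lam)) ≤ coneMeasure S w C := by
  set D := (N : ℝ) + lam with hD
  set W := S.indicator fun x => ENNReal.ofReal (w x) with hW
  have hWm : Measurable W := h.measurable_density
  set A' := (fun x : EuclideanSpace ℝ (Fin N) => a⁻¹ • x) '' A with hA'
  set B' := (fun x : EuclideanSpace ℝ (Fin N) => b⁻¹ • x) '' B with hB'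
  set C' := (fun x : EuclideanSpace ℝ (Fin N) => (a + b)⁻¹ • x) '' C with hC'
  have hab : 0 < a + b := by positivity
  have mA' : MeasurableSet A' := hA.const_smul₀ _
  have mB' : MeasurableSet B' := hB.const_smul₀ _
  have mC' : MeasurableSet C' := hC.const_smul₀ _
  have eA : ∫⁻ x, A'.indicator W x = 1 := by
    rw [lintegral_indicator mA', ← withDensity_apply _ mA']
    refine (h.coneMeasure_smul (inv_pos.2 ha) hA).trans ?_
    rw [hAa, ← ENNReal.ofReal_mul (by positivity), ← Real.mul_rpow (by positivity) ha.le,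
      inv_mul_cancel₀ ha.ne', Real.one_rpow, ENNReal.ofReal_one]
  have eB : ∫⁻ x, B'.indicator W x = 1 := by
    rw [lintegral_indicator mB', ← withDensity_apply _ mB']
    refine (h.coneMeasure_smul (inv_pos.2 hb) hB).trans ?_
    rw [hBb, ← ENNReal.ofReal_mul (by positivity), ← Real.mul_rpow (by positivity) hb.le,
      inv_mul_cancel₀ hb.ne', Real.one_rpow, ENNReal.ofReal_one]
  have eC : ∫⁻ x, C'.indicator W x =
      ENNReal.ofReal ((a + b)⁻¹ ^ D) * coneMeasure S w C := by
    rw [lintegral_indicator mC', ← withDensity_apply _ mC']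
    exact h.coneMeasure_smul (inv_pos.2 hab) hC
  set s := b / (a + b) with hs
  have hs0 : 0 < s := by positivity
  have hs1 : s < 1 := by rw [hs, div_lt_one hab]; linarith
  have hs' : 1 - s = a / (a + b) := by rw [hs]; field_simp; ring
  have hs1' : 0 < 1 - s := by linarith
  have key := satisfiesPrekopaLeindler_euclideanSpace N s hs0 hs1 (A'.indicator W) (B'.indicator W)
    (C'.indicator W) (hWm.indicator mA') (hWm.indicator mB') (hWm.indicator mC') ?_
  · rw [eA, eB, eC, ENNReal.one_rpow, ENNReal.one_rpow, one_mul] at key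
    calc ENNReal.ofReal ((a + b) ^ D)
        ≤ ENNReal.ofReal ((a + b) ^ D) * (ENNReal.ofReal ((a + b)⁻¹ ^ D) * coneMeasure S w C) :=
          le_mul_of_one_le_right' key
      _ = coneMeasure S w C := by
          rw [← mul_assoc, ← ENNReal.ofReal_mul (by positivity),
            ← Real.mul_rpow hab.le (by positivity), mul_inv_cancel₀ hab.ne', Real.one_rpow,
            ENNReal.ofReal_one, one_mul]
  · intro x y
    by_cases hx : x ∈ A'
    swap
    · simp [indicator_of_notMem hx, ENNReal.zero_rpow_of_pos hs1']
    by_cases hy : y ∈ B'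
    swap
    · simp [indicator_of_notMem hy, ENNReal.zero_rpow_of_pos hs0]
    have hxS : x ∈ S := by
      obtain ⟨p, hp, rfl⟩ := hx
      exact h.cone.2.2 p (hAS hp) _ (inv_pos.2 ha)
    have hyS : y ∈ S := by
      obtain ⟨p, hp, rfl⟩ := hy
      exact h.cone.2.2 p (hBS hp) _ (inv_pos.2 hb)
    have hz : (1 - s) • x + s • y ∈ C' := by
      obtain ⟨p, hp, rfl⟩ := hx
      obtain ⟨q, hq, rfl⟩ := hy
      refine ⟨p + q, hABC p hp q hq, ?_⟩
      simp only [smul_smul, smul_add]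
      congr 2
      · rw [hs']; field_simp
      · rw [hs]; field_simp
    have hzS : (1 - s) • x + s • y ∈ S := h.cone.2.1 hxS hyS hs1'.le hs0.le (by ring)
    rw [indicator_of_mem hx, indicator_of_mem hy, indicator_of_mem hz, hW, indicator_of_mem hxS,
      indicator_of_mem hyS, indicator_of_mem hzS,
      ENNReal.ofReal_rpow_of_nonneg (h.nonneg x (subset_closure hxS)) hs1'.le,
      ENNReal.ofReal_rpow_of_nonneg (h.nonneg y (subset_closure hyS)) hs0.le,
      ← ENNReal.ofReal_mul (Real.rpow_nonneg (h.nonneg x (subset_closure hxS)) _)]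
    exact ENNReal.ofReal_le_ofReal (h.logconc s hs0 hs1 x hxS y hyS)

end IsConeWeight

namespace IsAnisoNorm

variable {N : ℕ} {H : EuclideanSpace ℝ (Fin N) → ℝ}

lemma map_zero (hH : IsAnisoNorm H) : H 0 = 0 := by
  simpa using hH.hom 0 0

lemma map_neg (hH : IsAnisoNorm H) (x : EuclideanSpace ℝ (Fin N)) : H (-x) = H x := by
  simpa using hH.hom (-1) x

lemma nonneg (hH : IsAnisoNorm H) (x : EuclideanSpace ℝ (Fin N)) : 0 ≤ H x := by
  rcases eq_or_ne x 0 with rfl | hx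
  · exact hH.map_zero.ge
  · exact (hH.pos x hx).le

lemma add_le (hH : IsAnisoNorm H) (x y : EuclideanSpace ℝ (Fin N)) : H (x + y) ≤ H x + H y := by
  have h := hH.conv.2 (mem_univ ((2:ℝ) • x)) (mem_univ ((2:ℝ) • y)) (by norm_num : (0:ℝ) ≤ 1 / 2)
    (by norm_num : (0:ℝ) ≤ 1 / 2) (by norm_num)
  rw [smul_smul, smul_smul, hH.hom, hH.hom] at h
  norm_num at h
  linarith

lemma exists_le_norm (hH : IsAnisoNorm H) : ∃ C : ℝ≥0, ∀ x, H x ≤ C * ‖x‖ := by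
  refine ⟨∑ i, (H (EuclideanSpace.single i 1)).toNNReal, fun x => ?_⟩
  have hx : x = ∑ i, x i • EuclideanSpace.single i (1:ℝ) := by
    ext j
    simp [Finset.sum_apply, Pi.single_apply]
  have hsum : ∀ (s : Finset (Fin N)),
      H (∑ i ∈ s, x i • EuclideanSpace.single i (1:ℝ)) ≤
        ∑ i ∈ s, |x i| * H (EuclideanSpace.single i 1) := by
    intro s
    induction s using Finset.induction_on with
    | empty => simp [hH.map_zero]
    | insert a s ha ih =>
      rw [Finset.sum_insert ha, Finset.sum_insert ha]
      refine (hH.add_le _ _).trans (add_le_add ?_ ih)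
      rw [hH.hom]
  have h1 := hsum Finset.univ
  rw [← hx] at h1
  refine h1.trans ?_
  rw [NNReal.coe_sum, Finset.sum_mul]
  refine Finset.sum_le_sum fun i _ => ?_
  rw [Real.coe_toNNReal _ (hH.nonneg _), mul_comm]
  refine mul_le_mul_of_nonneg_left ?_ (hH.nonneg _)
  simpa using PiLp.norm_apply_le x i

lemma abs_sub_le (hH : IsAnisoNorm H) (x y : EuclideanSpace ℝ (Fin N)) :
    |H x - H y| ≤ H (x - y) := by
  have h1 := hH.add_le (x - y) y
  have h2 := hH.add_le (y - x) x
  rw [sub_add_cancel] at h1 h2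
  rw [← hH.map_neg (y - x), neg_sub] at h2
  exact abs_sub_le_iff.2 ⟨by linarith, by linarith⟩

lemma exists_lipschitz (hH : IsAnisoNorm H) : ∃ C : ℝ≥0, LipschitzWith C H := by
  obtain ⟨C, hC⟩ := hH.exists_le_norm
  refine ⟨C, LipschitzWith.of_dist_le_mul fun x y => ?_⟩
  rw [Real.dist_eq, dist_eq_norm]
  exact (hH.abs_sub_le x y).trans (hC _)

lemma continuous (hH : IsAnisoNorm H) : Continuous H := by
  obtain ⟨C, hC⟩ := hH.exists_lipschitz
  exact hC.continuous

lemma exists_norm_le (hH : IsAnisoNorm H) : ∃ c : ℝ, 0 < c ∧ ∀ x, c * ‖x‖ ≤ H x := by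
  rcases (sphere (0 : EuclideanSpace ℝ (Fin N)) 1).eq_empty_or_nonempty with he | hne
  · refine ⟨1, one_pos, fun x => ?_⟩
    have : x = 0 := by
      by_contra hx
      have : ‖x‖⁻¹ • x ∈ sphere (0 : EuclideanSpace ℝ (Fin N)) 1 := by
        simp [norm_smul, hx]
      simp [he] at this
    simp [this, hH.map_zero]
  · obtain ⟨z, hz, hmin⟩ := (isCompact_sphere (0 : EuclideanSpace ℝ (Fin N)) 1).exists_isMinOn hne
      hH.continuous.continuousOn
    have hz0 : z ≠ 0 := by
      rintro rfl
      simp at hz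
    refine ⟨H z, hH.pos z hz0, fun x => ?_⟩
    rcases eq_or_ne x 0 with rfl | hx
    · simp [hH.map_zero]
    have hxn : 0 < ‖x‖ := norm_pos_iff.2 hx
    have : H z ≤ H (‖x‖⁻¹ • x) := hmin (by simp [norm_smul, hx])
    rw [hH.hom, abs_of_pos (inv_pos.2 hxn)] at this
    calc H z * ‖x‖ ≤ ‖x‖⁻¹ * H x * ‖x‖ := by gcongr
      _ = H x := by field_simp

lemma bddAbove_dual (hH : IsAnisoNorm H) (x : EuclideanSpace ℝ (Fin N)) :
    BddAbove ((fun ξ => ⟪x, ξ⟫ / H ξ) '' {ξ : EuclideanSpace ℝ (Fin N) | ξ ≠ 0}) := by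
  obtain ⟨c, hc, hcH⟩ := hH.exists_norm_le
  refine ⟨‖x‖ / c, ?_⟩
  rintro _ ⟨ξ, hξ, rfl⟩
  have hξ' : 0 < ‖ξ‖ := norm_pos_iff.2 hξ
  calc ⟪x, ξ⟫ / H ξ ≤ (‖x‖ * ‖ξ‖) / H ξ := by
        have := hH.pos ξ hξ
        gcongr
        exact real_inner_le_norm x ξ
    _ ≤ (‖x‖ * ‖ξ‖) / (c * ‖ξ‖) := by
        gcongr
        exact hcH ξ
    _ = ‖x‖ / c := by field_simp

lemma inner_le (hH : IsAnisoNorm H) (x ξ : EuclideanSpace ℝ (Fin N)) :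
    ⟪x, ξ⟫ ≤ dualNorm H x * H ξ := by
  rcases eq_or_ne ξ 0 with rfl | hξ
  · simp [hH.map_zero]
  · rw [← div_le_iff₀ (hH.pos ξ hξ)]
    exact le_csSup (hH.bddAbove_dual x) ⟨ξ, hξ, rfl⟩

lemma dualNorm_le (hH : IsAnisoNorm H) (hN : 0 < N) {x : EuclideanSpace ℝ (Fin N)} {a : ℝ}
    (h : ∀ ξ, ⟪x, ξ⟫ ≤ a * H ξ) : dualNorm H x ≤ a := by
  refine csSup_le ?_ ?_
  · exact ⟨_, EuclideanSpace.single ⟨0, hN⟩ (1:ℝ), by simp, rfl⟩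
  · rintro _ ⟨ξ, hξ, rfl⟩
    exact (div_le_iff₀ (hH.pos ξ hξ)).2 (h ξ)

/-- The dual of a norm is a norm. -/
lemma dual (hH : IsAnisoNorm H) (hN : 0 < N) : IsAnisoNorm (dualNorm H) := by
  have hadd : ∀ x y, dualNorm H (x + y) ≤ dualNorm H x + dualNorm H y := fun x y =>
    hH.dualNorm_le hN fun ξ => by
      rw [inner_add_left, add_mul]
      exact add_le_add (hH.inner_le x ξ) (hH.inner_le y ξ)
  have hle : ∀ (t : ℝ) x, dualNorm H (t • x) ≤ |t| * dualNorm H x := fun t x =>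
    hH.dualNorm_le hN fun ξ => by
      have := hH.inner_le x (t • ξ)
      rw [hH.hom, inner_smul_right] at this
      rw [inner_smul_left]
      simp only [conj_trivial]
      linarith
  have hpos : ∀ x, x ≠ 0 → 0 < dualNorm H x := fun x hx => by
    have := hH.inner_le x x
    have h1 : 0 < ⟪x, x⟫ := real_inner_self_pos.2 hx
    exact pos_of_mul_pos_left (h1.trans_le this) (hH.nonneg x)
  have hom : ∀ (t : ℝ) x, dualNorm H (t • x) = |t| * dualNorm H x := fun t x => by
    refine (hle t x).antisymm ?_
    rcases eq_or_ne t 0 with rfl | ht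
    · have h1 : dualNorm H (0 : EuclideanSpace ℝ (Fin N)) = 0 := by
        refine le_antisymm (by simpa using hle 0 0) ?_
        by_contra! hlt
        have h2 := hH.inner_le 0 (EuclideanSpace.single ⟨0, hN⟩ (1:ℝ))
        rw [inner_zero_left] at h2
        have h3 := hH.pos (EuclideanSpace.single ⟨0, hN⟩ (1:ℝ)) (by simp)
        nlinarith
      simp [h1]
    · have h1 := hle t⁻¹ (t • x)
      rw [smul_smul, inv_mul_cancel₀ ht, one_smul, abs_inv] at h1
      have : 0 < |t| := abs_pos.2 ht
      calc |t| * dualNorm H x ≤ |t| * (|t|⁻¹ * dualNorm H (t • x)) := by gcongr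
        _ = dualNorm H (t • x) := by field_simp
  refine ⟨⟨convex_univ, fun x _ y _ a b ha hb _ => ?_⟩, hpos, hom⟩
  refine (hadd _ _).trans ?_
  rw [hom, hom, abs_of_nonneg ha, abs_of_nonneg hb]
  rfl

lemma isOpen_ball (hH : IsAnisoNorm H) (r : ℝ) : IsOpen {x | H x < r} :=
  isOpen_lt hH.continuous continuous_const

lemma isBounded_ball (hH : IsAnisoNorm H) (r : ℝ) : Bornology.IsBounded {x | H x < r} := by
  obtain ⟨c, hc, hcH⟩ := hH.exists_norm_le
  refine (isBounded_iff_forall_norm_le).2 ⟨r / c, fun x hx => ?_⟩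
  rw [le_div_iff₀ hc, mul_comm]
  exact (hcH x).trans (le_of_lt hx)

end IsAnisoNorm

namespace IsConeWeight

variable {N : ℕ} {S : Set (EuclideanSpace ℝ (Fin N))} {lam : ℝ}
    {w : EuclideanSpace ℝ (Fin N) → ℝ}

lemma exists_bound (h : IsConeWeight S lam w) {A : Set (EuclideanSpace ℝ (Fin N))}
    (hA : Bornology.IsBounded A) : ∃ C : ℝ, 0 ≤ C ∧ ∀ x ∈ S ∩ A, w x ≤ C := by
  have hc : IsCompact (closure S ∩ closure A) :=
    hA.isCompact_closure.inter_left isClosed_closure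
  obtain ⟨C, hC⟩ := hc.exists_bound_of_continuousOn (h.cont.mono inter_subset_left)
  refine ⟨max C 0, le_max_right _ _, fun x hx => ?_⟩
  exact ((Real.le_norm_self _).trans (hC x ⟨subset_closure hx.1, subset_closure hx.2⟩)).trans
    (le_max_left _ _)

lemma coneMeasure_apply (h : IsConeWeight S lam w) {A : Set (EuclideanSpace ℝ (Fin N))}
    (hA : MeasurableSet A) :
    coneMeasure S w A = ∫⁻ x in S ∩ A, ENNReal.ofReal (w x) := by
  rw [coneMeasure, withDensity_apply _ hA, setLIntegral_indicator h.measurableSet]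

lemma lintegral_coneMeasure (h : IsConeWeight S lam w) {A : Set (EuclideanSpace ℝ (Fin N))}
    (hA : MeasurableSet A) (g : EuclideanSpace ℝ (Fin N) → ℝ≥0∞) :
    ∫⁻ x in A, g x ∂coneMeasure S w = ∫⁻ x in S ∩ A, ENNReal.ofReal (w x) * g x := by
  rw [coneMeasure, restrict_withDensity hA, lintegral_withDensity_eq_lintegral_mul_non_measurable _
    h.measurable_density, ← setLIntegral_indicator h.measurableSet]
  · refine lintegral_congr fun x => ?_
    by_cases hx : x ∈ S <;> simp [hx]
  · refine Filter.Eventually.of_forall fun x => ?_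
    by_cases hx : x ∈ S <;> simp [hx]

lemma coneMeasure_lt_top (h : IsConeWeight S lam w) {A : Set (EuclideanSpace ℝ (Fin N))}
    (hA : Bornology.IsBounded A) : coneMeasure S w A < ⊤ := by
  obtain ⟨r, hr⟩ := hA.subset_closedBall 0
  refine (measure_mono hr).trans_lt ?_
  obtain ⟨C, -, hC⟩ := h.exists_bound (isBounded_closedBall (x := (0:EuclideanSpace ℝ (Fin N))) (r := r))
  rw [h.coneMeasure_apply isClosed_closedBall.measurableSet]
  refine (setLIntegral_mono' (h.measurableSet.inter isClosed_closedBall.measurableSet)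
    (fun x hx => ENNReal.ofReal_le_ofReal (hC x hx))).trans_lt ?_
  rw [setLIntegral_const]
  exact ENNReal.mul_lt_top ENNReal.ofReal_lt_top
    ((measure_mono inter_subset_right).trans_lt measure_closedBall_lt_top)

lemma integrableOn (h : IsConeWeight S lam w) {A : Set (EuclideanSpace ℝ (Fin N))}
    (hA : Bornology.IsBounded A) (hAm : MeasurableSet A) :
    IntegrableOn w (S ∩ A) := by
  obtain ⟨C, -, hC⟩ := h.exists_bound hA
  have : IsFiniteMeasure (volume.restrict (S ∩ A)) :=
    ⟨by simpa using (measure_mono inter_subset_right).trans_lt hA.measure_lt_top⟩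
  refine (integrable_const C).mono' (((h.cont.mono subset_closure).mono
    inter_subset_left).aestronglyMeasurable (h.measurableSet.inter hAm)) ?_
  filter_upwards [ae_restrict_mem (h.measurableSet.inter hAm)] with x hx
  rw [Real.norm_of_nonneg (h.nonneg x (subset_closure hx.1))]
  exact hC x hx

lemma integral_eq (h : IsConeWeight S lam w) {A : Set (EuclideanSpace ℝ (Fin N))}
    (hAm : MeasurableSet A) :
    ∫ x in S ∩ A, w x = (coneMeasure S w A).toReal := by
  rw [h.coneMeasure_apply hAm, integral_eq_lintegral_of_nonneg_ae]
  · filter_upwards [ae_restrict_mem (h.measurableSet.inter hAm)] with x hx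
    exact h.nonneg x (subset_closure hx.1)
  · exact ((h.cont.mono subset_closure).mono inter_subset_left).aestronglyMeasurable
      (h.measurableSet.inter hAm)

lemma coneMeasure_ball (h : IsConeWeight S lam w) {K : EuclideanSpace ℝ (Fin N) → ℝ}
    (hK : IsAnisoNorm K) {r : ℝ} (hr : 0 < r) :
    coneMeasure S w {x | K x < r} =
      ENNReal.ofReal (r ^ ((N : ℝ) + lam)) * coneMeasure S w {x | K x < 1} := by
  rw [← h.coneMeasure_smul hr (hK.isOpen_ball 1).measurableSet]
  congr 1
  ext x
  simp only [mem_ofPred_eq, mem_image]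
  constructor
  · intro hx
    refine ⟨r⁻¹ • x, ?_, by rw [smul_smul, mul_inv_cancel₀ hr.ne', one_smul]⟩
    rw [hK.hom, abs_of_pos (inv_pos.2 hr), inv_mul_lt_iff₀ hr, mul_one]
    exact hx
  · rintro ⟨y, hy, rfl⟩
    rw [hK.hom, abs_of_pos hr]
    nlinarith

end IsConeWeight

/-- The cutoff equal to `1` where `K ≤ 1 - ε` and to `0` where `K ≥ 1`. -/
def radialCutoff {N : ℕ} (K : EuclideanSpace ℝ (Fin N) → ℝ) (ε : ℝ)
    (x : EuclideanSpace ℝ (Fin N)) : ℝ := max 0 (min 1 ((1 - K x) / ε))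

lemma abs_radialCutoff_sub_le {N : ℕ} {K : EuclideanSpace ℝ (Fin N) → ℝ} (hK : IsAnisoNorm K)
    {ε : ℝ} (hε : 0 < ε) (x y : EuclideanSpace ℝ (Fin N)) :
    |radialCutoff K ε x - radialCutoff K ε y| ≤ K (x - y) / ε := by
  refine (abs_max_sub_max_le_max _ _ _ _).trans (max_le ?_ ?_)
  · simpa using div_nonneg (hK.nonneg _) hε.le
  refine (abs_min_sub_min_le_max _ _ _ _).trans (max_le ?_ ?_)
  · simpa using div_nonneg (hK.nonneg _) hε.le
  rw [← sub_div, abs_div, abs_of_pos hε, sub_sub_sub_cancel_left, abs_sub_comm]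
  gcongr
  exact hK.abs_sub_le x y

lemma radialCutoff_lipschitz {N : ℕ} {K : EuclideanSpace ℝ (Fin N) → ℝ} (hK : IsAnisoNorm K)
    {ε : ℝ} (hε : 0 < ε) : ∃ C : ℝ≥0, LipschitzWith C (radialCutoff K ε) := by
  obtain ⟨C, hC⟩ := hK.exists_le_norm
  refine ⟨C / ε.toNNReal, LipschitzWith.of_dist_le_mul fun x y => ?_⟩
  rw [Real.dist_eq, dist_eq_norm]
  refine (abs_radialCutoff_sub_le hK hε x y).trans ?_
  rw [NNReal.coe_div, Real.coe_toNNReal _ hε.le, div_mul_eq_mul_div]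
  gcongr
  exact hC _

lemma norm_fderiv_radialCutoff_apply_le {N : ℕ} {K : EuclideanSpace ℝ (Fin N) → ℝ}
    (hK : IsAnisoNorm K) {ε : ℝ} (hε : 0 < ε) {x : EuclideanSpace ℝ (Fin N)}
    (hx : DifferentiableAt ℝ (radialCutoff K ε) x) (v : EuclideanSpace ℝ (Fin N)) :
    |fderiv ℝ (radialCutoff K ε) x v| ≤
      ({y | 1 - ε ≤ K y} ∩ {y | K y < 1}).indicator (fun _ => K v / ε) x := by
  have h0 : 0 ≤ K v / ε := div_nonneg (hK.nonneg v) hε.le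
  by_cases h1 : 1 ≤ K x
  · have : IsLocalMin (radialCutoff K ε) x := by
      refine Filter.Eventually.of_forall fun y => ?_
      have : radialCutoff K ε x = 0 := by
        rw [radialCutoff, max_eq_left]
        exact (min_le_right _ _).trans (div_nonpos_of_nonpos_of_nonneg (by linarith) hε.le)
      rw [this]
      exact le_max_left _ _
    rw [this.fderiv_eq_zero]
    simpa using indicator_nonneg (fun _ _ => h0) x
  by_cases h2 : K x < 1 - ε
  · have : IsLocalMax (radialCutoff K ε) x := by
      refine Filter.Eventually.of_forall fun y => ?_
      have : radialCutoff K ε x = 1 := by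
        rw [radialCutoff, min_eq_left, max_eq_right zero_le_one]
        rw [le_div_iff₀ hε]; linarith
      rw [this]
      exact max_le zero_le_one (min_le_left _ _)
    rw [this.fderiv_eq_zero]
    simpa using indicator_nonneg (fun _ _ => h0) x
  rw [indicator_of_mem (show x ∈ {y | 1 - ε ≤ K y} ∩ {y | K y < 1} from
    ⟨not_lt.1 h2, not_le.1 h1⟩)]
  have hd : HasDerivAt (fun t : ℝ => radialCutoff K ε (x + t • v))
      (fderiv ℝ (radialCutoff K ε) x v) 0 := hx.hasFDerivAt.hasLineDerivAt v
  have := norm_deriv_le_of_lip' (f := fun t : ℝ => radialCutoff K ε (x + t • v)) (x₀ := 0) h0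
    (Filter.Eventually.of_forall fun t => by
      refine (abs_radialCutoff_sub_le hK hε _ _).trans ?_
      rw [add_sub_add_left_eq_sub, ← sub_smul, hK.hom, Real.norm_eq_abs]
      apply le_of_eq; ring)
  rwa [hd.deriv] at this

lemma integral_mul_vdiv_eq {N : ℕ} {f : EuclideanSpace ℝ (Fin N) → ℝ} {C : ℝ≥0}
    (hf : LipschitzWith C f) {σ : EuclideanSpace ℝ (Fin N) → EuclideanSpace ℝ (Fin N)}
    (hσ : ContDiff ℝ 1 σ) (hσc : HasCompactSupport σ) :
    ∫ x, f x * vdiv σ x = -∫ x, fderiv ℝ f x (σ x) := by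
  set e : Fin N → EuclideanSpace ℝ (Fin N) := fun i => EuclideanSpace.single i 1
  have hg : ∀ i, ContDiff ℝ 1 fun x => σ x i := fun i => by fun_prop
  have hgc : ∀ i, HasCompactSupport fun x => σ x i := fun i =>
    hσc.comp_left (g := fun y : EuclideanSpace ℝ (Fin N) => y i) rfl
  have hgl : ∀ i x v, lineDeriv ℝ (fun x => σ x i) x v = fderiv ℝ σ x v i := by
    intro i x v
    have h1 := (hσ.differentiable one_ne_zero x).hasFDerivAt
    have h2 := (EuclideanSpace.proj (𝕜 := ℝ) i : EuclideanSpace ℝ (Fin N) →L[ℝ] ℝ).hasFDerivAt.comp x h1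
    exact (h2.hasLineDerivAt v).lineDeriv
  have hint1 : ∀ i, Integrable fun x => f x * fderiv ℝ σ x (e i) i := by
    intro i
    refine Continuous.integrable_of_hasCompactSupport ?_ ?_
    · have := hσ.continuous_fderiv one_ne_zero
      have hc := hf.continuous
      fun_prop
    · have : HasCompactSupport fun x => fderiv ℝ σ x (e i) i :=
        (hσc.fderiv ℝ).comp_left (g := fun A : EuclideanSpace ℝ (Fin N) →L[ℝ]
          EuclideanSpace ℝ (Fin N) => A (e i) i) (by simp)
      exact this.mul_left
  have hint2 : ∀ i, Integrable fun x => lineDeriv ℝ f x (e i) * σ x i := by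
    intro i
    have h1 : Integrable (fun x => σ x i) :=
      (hg i).continuous.integrable_of_hasCompactSupport (hgc i)
    exact h1.bdd_mul (c := C * ‖e i‖) (aestronglyMeasurable_lineDeriv hf.continuous _)
      (Filter.Eventually.of_forall fun x => norm_lineDeriv_le_of_lipschitz ℝ hf)
  have hparts : ∀ i, ∫ x, f x * fderiv ℝ σ x (e i) i = -∫ x, lineDeriv ℝ f x (e i) * σ x i := by
    intro i
    obtain ⟨C', hC'⟩ := (hg i).lipschitzWith_of_hasCompactSupport (hgc i) one_ne_zero
    rw [hf.integral_lineDeriv_mul_eq hC' (hgc i), ← integral_neg]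
    refine integral_congr_ae (Filter.Eventually.of_forall fun x => ?_)
    simp only [hgl, map_neg, PiLp.neg_apply]
    ring
  calc ∫ x, f x * vdiv σ x = ∑ i, ∫ x, f x * fderiv ℝ σ x (e i) i := by
        rw [← integral_finsetSum _ fun i _ => hint1 i]
        simp only [vdiv, Finset.mul_sum, e]
    _ = -∫ x, ∑ i, lineDeriv ℝ f x (e i) * σ x i := by
        rw [integral_finsetSum _ fun i _ => hint2 i, ← Finset.sum_neg_distrib]
        exact Finset.sum_congr rfl fun i _ => hparts i
    _ = -∫ x, fderiv ℝ f x (σ x) := by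
        congr 1
        refine integral_congr_ae ?_
        filter_upwards [hf.ae_differentiableAt] with x hx
        have hs : σ x = ∑ i, σ x i • e i := by
          ext j
          simp [e, Finset.sum_apply, Pi.single_apply]
        conv_rhs => rw [hs, map_sum]
        refine Finset.sum_congr rfl fun i _ => ?_
        rw [hx.lineDeriv_eq_fderiv, map_smul, smul_eq_mul, mul_comm]

lemma tendsto_radialCutoff {N : ℕ} (K : EuclideanSpace ℝ (Fin N) → ℝ)
    (x : EuclideanSpace ℝ (Fin N)) :
    Filter.Tendsto (fun n : ℕ => radialCutoff K (1 / ((n : ℝ) + 2)) x) Filter.atTop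
      (𝓝 ({y | K y < 1}.indicator (fun _ => (1 : ℝ)) x)) := by
  by_cases hx : K x < 1
  · rw [indicator_of_mem (show x ∈ {y | K y < 1} from hx)]
    refine tendsto_const_nhds.congr' ?_
    have h : Filter.Tendsto (fun n : ℕ => ((n : ℝ) + 2) * (1 - K x)) Filter.atTop Filter.atTop :=
      (Filter.tendsto_atTop_add_const_right _ _ tendsto_natCast_atTop_atTop).atTop_mul_const
        (sub_pos.2 hx)
    filter_upwards [h.eventually_ge_atTop 1] with n hn
    rw [radialCutoff, div_div_eq_mul_div, div_one, mul_comm, min_eq_left hn,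
      max_eq_right zero_le_one]
  · rw [indicator_of_notMem (show x ∉ {y | K y < 1} from hx)]
    refine tendsto_const_nhds.congr fun n => ?_
    rw [radialCutoff, max_eq_left]
    exact (min_le_right _ _).trans (div_nonpos_of_nonpos_of_nonneg (by linarith) (by positivity))

lemma integral_vdiv_le {N : ℕ} (hN : 0 < N) {S : Set (EuclideanSpace ℝ (Fin N))} {lam : ℝ}
    {w : EuclideanSpace ℝ (Fin N) → ℝ} (h : IsConeWeight S lam w)
    {K : EuclideanSpace ℝ (Fin N) → ℝ} (hK : IsAnisoNorm K)
    {σ : EuclideanSpace ℝ (Fin N) → EuclideanSpace ℝ (Fin N)} (hσ : ContDiff ℝ 1 σ)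
    (hσc : HasCompactSupport σ) (hσS : tsupport σ ⊆ S) (hσw : ∀ x, K (σ x) ≤ w x) :
    ∫ x in {y | K y < 1}, vdiv σ x ≤
      ((N : ℝ) + lam) * (coneMeasure S w {y | K y < 1}).toReal := by
  set b := (coneMeasure S w {y | K y < 1}).toReal with hb
  have hDone : 1 ≤ (N : ℝ) + lam := by
    have : (1 : ℝ) ≤ N := by exact_mod_cast hN
    linarith [h.deg_nonneg]
  have hfin : ∀ r, coneMeasure S w {y | K y < r} < ⊤ := fun r =>
    h.coneMeasure_lt_top (hK.isBounded_ball r)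
  have key : ∀ n : ℕ, ∫ x, radialCutoff K (1 / ((n : ℝ) + 2)) x * vdiv σ x ≤
      ((N : ℝ) + lam) * b := by
    intro n
    set ε : ℝ := 1 / ((n : ℝ) + 2) with hε
    have hε0 : 0 < ε := by positivity
    have hε1 : ε < 1 := by
      rw [hε, div_lt_one (by positivity)]
      have : (0 : ℝ) ≤ n := n.cast_nonneg
      linarith
    obtain ⟨C, hC⟩ := radialCutoff_lipschitz hK hε0
    rw [integral_mul_vdiv_eq hC hσ hσc, ← integral_neg]
    set A : Set (EuclideanSpace ℝ (Fin N)) := {y | 1 - ε ≤ K y} ∩ {y | K y < 1} with hA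
    have hAm : MeasurableSet A :=
      (isClosed_le continuous_const hK.continuous).measurableSet.inter
        (hK.isOpen_ball 1).measurableSet
    have hAb : Bornology.IsBounded A := (hK.isBounded_ball 1).subset inter_subset_right
    have hA' : A = {y | K y < 1} \ {y | K y < 1 - ε} := by
      ext y
      simp [hA, and_comm]
    have hAmeas : (coneMeasure S w A).toReal = b - (1 - ε) ^ ((N : ℝ) + lam) * b := by
      have hsub : {y | K y < 1 - ε} ⊆ {y | K y < 1} := fun y hy =>
        lt_trans hy (by linarith : 1 - ε < 1)
      rw [hA', measure_sdiff hsub (hK.isOpen_ball _).measurableSet.nullMeasurableSet (hfin _).ne,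
        ENNReal.toReal_sub_of_le (measure_mono hsub) (hfin _).ne,
        h.coneMeasure_ball hK (sub_pos.2 hε1), ENNReal.toReal_mul, ENNReal.toReal_ofReal]
      exact Real.rpow_nonneg (by linarith) _
    have hInt : Integrable ((S ∩ A).indicator fun x => w x / ε) :=
      (integrable_indicator_iff (h.measurableSet.inter hAm)).2
        ((h.integrableOn hAb hAm).div_const ε)
    have hbound : ∀ᵐ x, ‖-fderiv ℝ (radialCutoff K ε) x (σ x)‖ ≤
        (S ∩ A).indicator (fun x => w x / ε) x := by
      filter_upwards [hC.ae_differentiableAt] with x hx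
      rw [norm_neg, Real.norm_eq_abs]
      by_cases hxS : x ∈ S
      · refine (norm_fderiv_radialCutoff_apply_le hK hε0 hx (σ x)).trans ?_
        by_cases hxA : x ∈ A
        · rw [indicator_of_mem hxA, indicator_of_mem (show x ∈ S ∩ A from ⟨hxS, hxA⟩)]
          gcongr
          exact hσw x
        · rw [indicator_of_notMem hxA, indicator_of_notMem (fun hh => hxA hh.2)]
      · have : σ x = 0 := by
          by_contra hne
          exact hxS (hσS (subset_tsupport _ hne))
        rw [this, map_zero, abs_zero, indicator_of_notMem (fun hh => hxS hh.1)]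
    refine (le_abs_self _).trans ((norm_integral_le_of_norm_le hInt hbound).trans ?_)
    rw [integral_indicator (h.measurableSet.inter hAm), integral_div, h.integral_eq hAm, hAmeas,
      div_le_iff₀ hε0]
    have hbern := one_add_mul_self_le_rpow_one_add (s := -ε) (by linarith) hDone
    have hb0 : 0 ≤ b := ENNReal.toReal_nonneg
    rw [← sub_eq_add_neg] at hbern
    nlinarith [mul_le_mul_of_nonneg_right hbern hb0]
  have hdivc : Continuous (vdiv σ) := by
    have := hσ.continuous_fderiv one_ne_zero
    unfold vdiv
    fun_prop
  have hdivs : HasCompactSupport (vdiv σ) :=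
    (hσc.fderiv ℝ).comp_left (g := fun A : EuclideanSpace ℝ (Fin N) →L[ℝ]
      EuclideanSpace ℝ (Fin N) => ∑ i, A (EuclideanSpace.single i 1) i) (by simp)
  rw [← integral_indicator (hK.isOpen_ball 1).measurableSet]
  refine le_of_tendsto (tendsto_integral_of_dominated_convergence (fun x => ‖vdiv σ x‖)
    (fun n => ?_) (hdivc.integrable_of_hasCompactSupport hdivs).norm (fun n => ?_) ?_)
    (Filter.Eventually.of_forall key)
  · have hn : (0 : ℝ) < 1 / ((n : ℝ) + 2) := by positivity
    obtain ⟨C, hC⟩ := radialCutoff_lipschitz hK hn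
    exact (hC.continuous.mul hdivc).aestronglyMeasurable
  · refine Filter.Eventually.of_forall fun x => ?_
    rw [norm_mul]
    refine mul_le_of_le_one_left (norm_nonneg _) ?_
    rw [radialCutoff, Real.norm_of_nonneg (le_max_left _ _)]
    exact max_le zero_le_one (min_le_left _ _)
  · refine Filter.Eventually.of_forall fun x => ?_
    have := (tendsto_radialCutoff K x).mul_const (vdiv σ x)
    by_cases hx : x ∈ {y | K y < 1}
    · simpa [indicator_of_mem hx] using this
    · simpa [indicator_of_notMem hx] using this

lemma periW_toReal_le {N : ℕ} (hN : 0 < N) {S : Set (EuclideanSpace ℝ (Fin N))} {lam : ℝ}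
    {w : EuclideanSpace ℝ (Fin N) → ℝ} (h : IsConeWeight S lam w)
    {K : EuclideanSpace ℝ (Fin N) → ℝ} (hK : IsAnisoNorm K) :
    (periW K w {y | K y < 1} S).toReal ≤
      ((N : ℝ) + lam) * (coneMeasure S w {y | K y < 1}).toReal := by
  have h0 : 0 ≤ ((N : ℝ) + lam) * (coneMeasure S w {y | K y < 1}).toReal :=
    mul_nonneg (add_nonneg N.cast_nonneg h.deg_nonneg) ENNReal.toReal_nonneg
  refine ENNReal.toReal_le_of_le_ofReal h0 (iSup₂_le fun σ hσ => ?_)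
  exact ENNReal.ofReal_le_ofReal (integral_vdiv_le hN h hK hσ.1 hσ.2.1 hσ.2.2.1 hσ.2.2.2)

namespace IsConeWeight

variable {N : ℕ} {S : Set (EuclideanSpace ℝ (Fin N))} {lam : ℝ}
    {w : EuclideanSpace ℝ (Fin N) → ℝ}

lemma coneMeasure_inter (h : IsConeWeight S lam w) {A : Set (EuclideanSpace ℝ (Fin N))}
    (hA : MeasurableSet A) : coneMeasure S w (S ∩ A) = coneMeasure S w A := by
  rw [h.coneMeasure_apply hA, h.coneMeasure_apply (h.measurableSet.inter hA), ← inter_assoc,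
    inter_self]

lemma isOpen_dilate (h : IsConeWeight S lam w) {A B : Set (EuclideanSpace ℝ (Fin N))}
    (hA : IsOpen A) (ε : ℝ) : IsOpen {x | ∃ y ∈ B, x - ε • y ∈ S ∩ A} := by
  have : {x | ∃ y ∈ B, x - ε • y ∈ S ∩ A} = ⋃ y ∈ B, (fun x => x - ε • y) ⁻¹' (S ∩ A) := by
    ext x
    simp only [mem_ofPred_eq, mem_iUnion, mem_preimage, exists_prop]
  rw [this]
  exact isOpen_biUnion fun y _ => (h.cone.1.inter hA).preimage (by fun_prop)

/-- The Brunn–Minkowski growth bound for the outer dilation of a set by a small convex body. -/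
lemma le_coneMeasure_dilate_sdiff (h : IsConeWeight S lam w)
    {K : EuclideanSpace ℝ (Fin N) → ℝ} (hK : IsAnisoNorm K)
    {A : Set (EuclideanSpace ℝ (Fin N))} (hA : IsOpen A) (hAfin : coneMeasure S w A < ⊤)
    {ε : ℝ} (hε : 0 < ε) {D : ℝ} (hD : D = (N : ℝ) + lam) (hD1 : 1 < D) :
    ENNReal.ofReal (ε * (D * (coneMeasure S w {y | K y < 1}).toReal ^ (1 / D)) *
        (coneMeasure S w A).toReal ^ ((D - 1) / D)) ≤
      coneMeasure S w ({x | ∃ y ∈ S ∩ {y | K y < 1}, x - ε • y ∈ S ∩ A} \ A) := by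
  have hD0 : 0 < D := by linarith
  have hBo := hK.isOpen_ball 1
  have hBfin := h.coneMeasure_lt_top (hK.isBounded_ball 1)
  set B := {y | K y < 1} with hB
  set α := (coneMeasure S w A).toReal with hα
  set β := (coneMeasure S w B).toReal with hβ
  have hα0 : 0 ≤ α := ENNReal.toReal_nonneg
  have hβ0 : 0 ≤ β := ENNReal.toReal_nonneg
  rcases hα0.eq_or_lt with h0 | hαp
  · rw [← h0, Real.zero_rpow (by have := sub_pos.2 hD1; positivity)]
    simp
  rcases hβ0.eq_or_lt with h0 | hβp
  · rw [← h0, Real.zero_rpow (by positivity)]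
    simp
  set C := {x | ∃ y ∈ S ∩ B, x - ε • y ∈ S ∩ A} with hC
  have hCo : IsOpen C := h.isOpen_dilate hA ε
  have hpow : ∀ x : ℝ, 0 ≤ x → (x ^ (1 / D)) ^ D = x := fun x hx => by
    rw [← Real.rpow_mul hx, one_div_mul_cancel hD0.ne', Real.rpow_one]
  have hBM : ENNReal.ofReal ((α ^ (1 / D) + ε * β ^ (1 / D)) ^ D) ≤ coneMeasure S w C := by
    subst hD
    refine h.brunnMinkowski (A := S ∩ A) (B := (fun x => ε • x) '' (S ∩ B))
      (h.measurableSet.inter hA.measurableSet) ?_ hCo.measurableSet inter_subset_left ?_ ?_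
      (by positivity) (by positivity) ?_ ?_
    · exact ((Homeomorph.smulOfNeZero ε hε.ne').isOpenMap _ (h.cone.1.inter hBo)).measurableSet
    · rintro _ ⟨y, hy, rfl⟩
      exact h.cone.2.2 y hy.1 ε hε
    · rintro x hx _ ⟨y, hy, rfl⟩
      exact ⟨y, hy, by simpa using hx⟩
    · rw [h.coneMeasure_inter hA.measurableSet, hpow α hα0, hα, ENNReal.ofReal_toReal hAfin.ne]
    · rw [h.coneMeasure_smul hε (h.measurableSet.inter hBo.measurableSet),
        h.coneMeasure_inter hBo.measurableSet, Real.mul_rpow hε.le (by positivity), hpow β hβ0,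
        ENNReal.ofReal_mul (by positivity), hβ, ENNReal.ofReal_toReal hBfin.ne]
  have hreal : α + ε * (D * β ^ (1 / D)) * α ^ ((D - 1) / D) ≤
      (α ^ (1 / D) + ε * β ^ (1 / D)) ^ D := by
    set a := α ^ (1 / D) with ha
    set b := β ^ (1 / D) with hb
    have hap : 0 < a := by positivity
    have hbp : 0 < b := by positivity
    have haD : a ^ D = α := hpow α hα0
    have haD1 : α ^ ((D - 1) / D) = a ^ D / a := by
      rw [haD, ha, sub_div, div_self hD0.ne', Real.rpow_sub hαp, Real.rpow_one]
    have hfac : a + ε * b = a * (1 + ε * b / a) := by field_simp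
    rw [haD1, hfac, Real.mul_rpow hap.le (by positivity)]
    have hbern := one_add_mul_self_le_rpow_one_add (s := ε * b / a)
      (by linarith [show 0 ≤ ε * b / a by positivity]) hD1.le
    calc α + ε * (D * b) * (a ^ D / a) = a ^ D * (1 + D * (ε * b / a)) := by
          rw [haD]; field_simp
      _ ≤ _ := by gcongr
  refine le_trans ?_ (le_measure_sdiff (μ := coneMeasure S w) (s₁ := C) (s₂ := A))
  refine ENNReal.le_sub_of_add_le_left hAfin.ne ?_
  rw [← ENNReal.ofReal_toReal hAfin.ne, ← ENNReal.ofReal_add ENNReal.toReal_nonneg (by positivity)]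
  exact (ENNReal.ofReal_le_ofReal hreal).trans hBM

lemma measurableSet_sweep (h : IsConeWeight S lam w) (B : Set (EuclideanSpace ℝ (Fin N)))
    {g : EuclideanSpace ℝ (Fin N) → ℝ} (hg : Continuous g) (ε : ℝ) :
    MeasurableSet {q : EuclideanSpace ℝ (Fin N) × ℝ | 0 < q.2 ∧
      (∃ y ∈ B, q.1 - ε • y ∈ S ∧ q.2 < g (q.1 - ε • y)) ∧ g q.1 ≤ q.2} := by
  refine (isOpen_lt continuous_const continuous_snd).measurableSet.inter
    (MeasurableSet.inter ?_ (isClosed_le (by fun_prop) continuous_snd).measurableSet)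
  have : {q : EuclideanSpace ℝ (Fin N) × ℝ | ∃ y ∈ B, q.1 - ε • y ∈ S ∧
      q.2 < g (q.1 - ε • y)} = ⋃ y ∈ B, ({q | q.1 - ε • y ∈ S} ∩
        {q | q.2 < g (q.1 - ε • y)}) := by
    ext q
    simp only [mem_ofPred_eq, mem_iUnion, mem_inter_iff, exists_prop]
  refine IsOpen.measurableSet ?_
  change IsOpen {q : EuclideanSpace ℝ (Fin N) × ℝ | _}
  rw [this]
  refine isOpen_biUnion fun y _ => IsOpen.inter ?_ ?_
  · exact h.cone.1.preimage (by fun_prop)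
  · exact isOpen_lt continuous_snd (by fun_prop)

lemma ae_mem_cone (h : IsConeWeight S lam w) : ∀ᵐ x ∂coneMeasure S w, x ∈ S := by
  rw [ae_iff]
  change coneMeasure S w Sᶜ = 0
  rw [h.coneMeasure_apply h.measurableSet.compl, inter_compl_self]
  simp

/-- The layer-cake form of the dilation bound at a fixed scale. -/
lemma lintegral_rpow_le_lintegral_volume (h : IsConeWeight S lam w)
    {K : EuclideanSpace ℝ (Fin N) → ℝ} (hK : IsAnisoNorm K) {D : ℝ} (hD : D = (N : ℝ) + lam)
    (hD1 : 1 < D) {g : EuclideanSpace ℝ (Fin N) → ℝ} (hg : Continuous g)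
    (hgfin : ∀ s, 0 < s → coneMeasure S w {x | s < g x} < ⊤) {ε : ℝ} (hε : 0 < ε) :
    ENNReal.ofReal (D * (coneMeasure S w {y | K y < 1}).toReal ^ (1 / D)) *
        ∫⁻ s in Ioi (0 : ℝ), ENNReal.ofReal
          ((coneMeasure S w {x | s < g x}).toReal ^ ((D - 1) / D)) ≤
      ∫⁻ x, volume {s : ℝ | 0 < s ∧ (∃ y ∈ S ∩ {y | K y < 1}, x - ε • y ∈ S ∧
        s < g (x - ε • y)) ∧ g x ≤ s} / ENNReal.ofReal ε ∂coneMeasure S w := by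
  set B := {y | K y < 1} with hB
  set κ := D * (coneMeasure S w B).toReal ^ (1 / D) with hκ
  have hκ0 : 0 ≤ κ := mul_nonneg (by linarith) (by positivity)
  have hε' : ENNReal.ofReal ε ≠ 0 := by simpa using hε
  set P : Set (EuclideanSpace ℝ (Fin N) × ℝ) := {q | 0 < q.2 ∧ (∃ y ∈ S ∩ B, q.1 - ε • y ∈ S ∧
    q.2 < g (q.1 - ε • y)) ∧ g q.1 ≤ q.2} with hP
  have hPm : MeasurableSet P := h.measurableSet_sweep _ hg ε
  have hprod : ∫⁻ x, volume (Prod.mk x ⁻¹' P) ∂coneMeasure S w =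
      ∫⁻ s, coneMeasure S w ((fun x => (x, s)) ⁻¹' P) := by
    have : SFinite (coneMeasure S w) := by unfold coneMeasure; infer_instance
    rw [← Measure.prod_apply hPm, Measure.prod_apply_symm hPm]
  have hlevel : ∀ s ∈ Ioi (0 : ℝ), ENNReal.ofReal ε * (ENNReal.ofReal κ * ENNReal.ofReal
      ((coneMeasure S w {x | s < g x}).toReal ^ ((D - 1) / D))) ≤
      coneMeasure S w ((fun x => (x, s)) ⁻¹' P) := by
    intro s hs
    rw [← ENNReal.ofReal_mul hκ0, ← ENNReal.ofReal_mul hε.le, ← mul_assoc]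
    refine (h.le_coneMeasure_dilate_sdiff hK (isOpen_lt continuous_const hg) (hgfin s hs) hε hD
      hD1).trans (measure_mono ?_)
    rintro x ⟨⟨y, hy, hyS, hyg⟩, hxg⟩
    exact ⟨hs, ⟨y, hy, hyS, hyg⟩, not_lt.1 hxg⟩
  simp only [ENNReal.div_eq_inv_mul]
  rw [lintegral_const_mul' _ _ (ENNReal.inv_ne_top.2 hε'), ← ENNReal.div_eq_inv_mul,
    ENNReal.le_div_iff_mul_le (Or.inl hε') (Or.inl ENNReal.ofReal_ne_top)]
  change _ ≤ ∫⁻ x, volume (Prod.mk x ⁻¹' P) ∂coneMeasure S w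
  rw [hprod, mul_comm, ← lintegral_const_mul' _ _ ENNReal.ofReal_ne_top,
    ← lintegral_const_mul' _ _ ENNReal.ofReal_ne_top]
  exact (setLIntegral_mono' measurableSet_Ioi hlevel).trans (setLIntegral_le_lintegral _ _)

/-- The weighted anisotropic Pólya–Szegő type inequality: the isoperimetric profile integrated over
the superlevel sets is controlled by the weighted anisotropic total variation. -/
lemma lintegral_rpow_le_lintegral_gradient (h : IsConeWeight S lam w)
    {H : EuclideanSpace ℝ (Fin N) → ℝ} (hH : IsAnisoNorm H) (hN : 0 < N) {D : ℝ}
    (hD : D = (N : ℝ) + lam) (hD1 : 1 < D) {g : EuclideanSpace ℝ (Fin N) → ℝ} {L : ℝ≥0}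
    (hg : LipschitzWith L g) (hg0 : ∀ x, 0 ≤ g x) {A : Set (EuclideanSpace ℝ (Fin N))}
    (hA : Bornology.IsBounded A) (hgA : ∀ x ∈ S, x ∉ A → g x = 0) :
    ENNReal.ofReal (D * (coneMeasure S w {y | dualNorm H y < 1}).toReal ^ (1 / D)) *
        ∫⁻ s in Ioi (0 : ℝ), ENNReal.ofReal
          ((coneMeasure S w {x | s < g x}).toReal ^ ((D - 1) / D)) ≤
      ∫⁻ x, ENNReal.ofReal (H (gradient g x)) ∂coneMeasure S w := by
  have hK := hH.dual hN
  set K := dualNorm H with hKdef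
  set q : ℕ → EuclideanSpace ℝ (Fin N) → ℝ≥0∞ := fun n x => volume {s : ℝ | 0 < s ∧
    (∃ y ∈ S ∩ {y | K y < 1}, x - (1 / ((n : ℝ) + 1)) • y ∈ S ∧
        s < g (x - (1 / ((n : ℝ) + 1)) • y)) ∧ g x ≤ s} / ENNReal.ofReal (1 / ((n : ℝ) + 1))
    with hq
  have hn0 : ∀ n : ℕ, (0 : ℝ) < 1 / ((n : ℝ) + 1) := fun n => by positivity
  have hgfin : ∀ s, 0 < s → coneMeasure S w {x | s < g x} < ⊤ := by
    intro s hs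
    rw [← h.coneMeasure_inter (isOpen_lt continuous_const hg.continuous).measurableSet]
    refine (measure_mono ?_).trans_lt (h.coneMeasure_lt_top hA)
    rintro x ⟨hxS, hx⟩
    by_contra hxA
    exact (hs.trans hx).ne' (hgA x hxS hxA)
  have hqle : ∀ (n : ℕ) x m, (∀ y ∈ S ∩ {y | K y < 1}, x - (1 / ((n : ℝ) + 1)) • y ∈ S →
      g (x - (1 / ((n : ℝ) + 1)) • y) ≤ g x + m * (1 / ((n : ℝ) + 1))) →
      q n x ≤ ENNReal.ofReal m := by
    intro n x m hm
    refine ENNReal.div_le_of_le_mul' ?_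
    rw [← ENNReal.ofReal_mul (hn0 n).le]
    refine (measure_mono (t := Ico (g x) (g x + m * (1 / ((n : ℝ) + 1)))) ?_).trans ?_
    · rintro s ⟨-, ⟨y, hy, hyS, hys⟩, hxs⟩
      exact ⟨hxs, hys.trans_le (hm y hy hyS)⟩
    · rw [Real.volume_Ico, add_sub_cancel_left, mul_comm]
  have hqm : ∀ n, Measurable (q n) := fun n =>
    (measurable_measure_prodMk_left (h.measurableSet_sweep _ hg.continuous _)).div_const _
  obtain ⟨C, hC0, hC⟩ : ∃ C : ℝ, 0 ≤ C ∧ ∀ y, K y < 1 → ‖y‖ ≤ C := by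
    obtain ⟨C, hC⟩ := isBounded_iff_forall_norm_le.1 (hK.isBounded_ball 1)
    exact ⟨max C 0, le_max_right _ _, fun y hy => (hC y hy).trans (le_max_left _ _)⟩
  have hbd : ∀ n, q n ≤ᵐ[coneMeasure S w] (cthickening C A).indicator
    fun _ => ENNReal.ofReal (L * C) := by
    intro n
    filter_upwards [h.ae_mem_cone] with x hxS
    by_cases hx : x ∈ cthickening C A
    · rw [indicator_of_mem hx]
      refine hqle n x _ fun y hy hyS => ?_
      have h1 := hg.dist_le_mul (x - (1 / ((n : ℝ) + 1)) • y) x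
      rw [Real.dist_eq, dist_eq_norm, sub_sub_cancel_left, norm_neg, norm_smul,
        Real.norm_of_nonneg (hn0 n).le] at h1
      have h2 : (L : ℝ) * (1 / ((n : ℝ) + 1) * ‖y‖) ≤ L * (1 / ((n : ℝ) + 1) * C) := by
        gcongr
        exact hC y hy.2
      linarith [le_abs_self (g (x - (1 / ((n : ℝ) + 1)) • y) - g x)]
    · rw [indicator_of_notMem hx]
      have hzero : ∀ y ∈ S ∩ {y | K y < 1}, x - (1 / ((n : ℝ) + 1)) • y ∈ S →
          g (x - (1 / ((n : ℝ) + 1)) • y) ≤ g x + 0 * (1 / ((n : ℝ) + 1)) := by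
        intro y hy hyS
        rw [hgA _ hyS, zero_mul, add_zero]
        · exact hg0 x
        · intro hyA
          refine hx (mem_cthickening_of_dist_le _ _ _ _ hyA ?_)
          rw [dist_eq_norm, sub_sub_cancel, norm_smul, Real.norm_of_nonneg (hn0 n).le]
          have : 1 / ((n : ℝ) + 1) ≤ 1 := by
            rw [div_le_one (by positivity)]
            linarith [n.cast_nonneg (α := ℝ)]
          exact (mul_le_of_le_one_left (norm_nonneg _) this).trans (hC y hy.2)
      simpa using hqle n x 0 hzero
  have hlim : ∀ᵐ x ∂coneMeasure S w, Filter.limsup (fun n => q n x) Filter.atTop ≤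
      ENNReal.ofReal (H (gradient g x)) := by
    have hac : coneMeasure S w ≪ volume := withDensity_absolutelyContinuous _ _
    filter_upwards [hac.ae_le hg.ae_differentiableAt] with x hx
    refine ENNReal.le_of_forall_pos_le_add fun δ hδ _ => ?_
    rw [← ENNReal.ofReal_coe_nnreal, ← ENNReal.ofReal_add (hH.nonneg _) δ.coe_nonneg]
    refine Filter.limsup_le_of_le (by isBoundedDefault) ?_
    have hδ' : 0 < (δ : ℝ) / (C + 1) := by positivity
    have hlo := (hasFDerivAt_iff_isLittleO_nhds_zero.1 hx.hasFDerivAt).def hδ'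
    obtain ⟨r, hr, hlo⟩ := Metric.eventually_nhds_iff_ball.1 hlo
    have htend : Filter.Tendsto (fun n : ℕ => 1 / ((n : ℝ) + 1) * (C + 1)) Filter.atTop (𝓝 0) := by
      simpa using tendsto_one_div_add_atTop_nhds_zero_nat.mul_const (C + 1)
    filter_upwards [htend.eventually_lt_const hr] with n hn
    refine hqle n x _ fun y hy _ => ?_
    have hyC := hC y hy.2
    have hε := hn0 n
    set ε := 1 / ((n : ℝ) + 1) with hεdef
    have hnorm : ‖-(ε • y)‖ = ε * ‖y‖ := by rw [norm_neg, norm_smul, Real.norm_of_nonneg hε.le]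
    have h1 := hlo (-(ε • y)) (by
      rw [mem_ball_zero_iff, hnorm]
      exact (mul_le_mul_of_nonneg_left (by linarith) hε.le).trans_lt hn)
    rw [hnorm, ← sub_eq_add_neg, Real.norm_eq_abs, ← inner_gradient_left, inner_neg_right,
      inner_smul_right] at h1
    have h2 : (δ : ℝ) / (C + 1) * (ε * ‖y‖) ≤ δ * ε := by
      rw [div_mul_eq_mul_div, div_le_iff₀ (by positivity), mul_assoc]
      gcongr
      linarith
    have h3 : -⟪gradient g x, y⟫ ≤ H (gradient g x) := by
      have := hH.inner_le y (-gradient g x)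
      rw [inner_neg_right, hH.map_neg, real_inner_comm] at this
      refine this.trans (mul_le_of_le_one_left (hH.nonneg _) (le_of_lt hy.2))
    have h4 := mul_le_mul_of_nonneg_left h3 hε.le
    have h5 := (abs_le.1 h1).2
    nlinarith
  calc _ ≤ Filter.limsup (fun n => ∫⁻ x, q n x ∂coneMeasure S w) Filter.atTop := by
        refine Filter.le_limsup_of_frequently_le' (Filter.Eventually.frequently ?_)
        exact Filter.Eventually.of_forall fun n =>
          h.lintegral_rpow_le_lintegral_volume hK hD hD1 hg.continuous hgfin (hn0 n)
    _ ≤ ∫⁻ x, Filter.limsup (fun n => q n x) Filter.atTop ∂coneMeasure S w := by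
        refine limsup_lintegral_le _ hqm hbd ?_
        rw [lintegral_indicator isClosed_cthickening.measurableSet, setLIntegral_const]
        exact (ENNReal.mul_lt_top ENNReal.ofReal_lt_top
          (h.coneMeasure_lt_top hA.cthickening)).ne
    _ ≤ _ := lintegral_mono_ae hlim

end IsConeWeight

open scoped Convolution in
lemma hasFDerivAt_normed_convolution {N : ℕ} (ψ : ContDiffBump (0 : EuclideanSpace ℝ (Fin N)))
    {g : EuclideanSpace ℝ (Fin N) → ℝ} {L : ℝ≥0} (hg : LipschitzWith L g)
    (x : EuclideanSpace ℝ (Fin N)) :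
    HasFDerivAt (ψ.normed volume ⋆[ContinuousLinearMap.lsmul ℝ ℝ, volume] g)
      ((ψ.normed volume ⋆[ContinuousLinearMap.lsmul ℝ ℝ, volume] fderiv ℝ g) x) x := by
  have hInt : Integrable (fun t => ψ.normed volume t * (L : ℝ)) :=
    (ψ.integrable_normed (μ := volume)).mul_const _
  have hψ : Continuous (ψ.normed volume) := ψ.continuous_normed
  refine (hasFDerivAt_integral_of_dominated_loc_of_lip (𝕜 := ℝ) (μ := volume)
    (F := fun y t => ψ.normed volume t • g (y - t))
    (F' := fun t => ψ.normed volume t • fderiv ℝ g (x - t))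
    (bound := fun t => ψ.normed volume t * L) Filter.univ_mem
    (Filter.Eventually.of_forall fun y => ?_) ?_ ?_ ?_ hInt ?_).2
  · exact (hψ.smul (hg.continuous.comp (by fun_prop))).aestronglyMeasurable
  · refine Continuous.integrable_of_hasCompactSupport
      (hψ.smul (hg.continuous.comp (by fun_prop))) ?_
    exact ψ.hasCompactSupport_normed.smul_right
  · refine (hψ.aestronglyMeasurable).smul ?_
    exact ((measurable_fderiv ℝ g).comp (measurable_const.sub measurable_id)).aestronglyMeasurable
  · refine Filter.Eventually.of_forall fun t => LipschitzOnWith.of_dist_le_mul fun y _ z _ => ?_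
    have h1 := hg.dist_le_mul (y - t) (z - t)
    rw [dist_sub_right] at h1
    rw [dist_smul₀, Real.norm_of_nonneg (ψ.nonneg_normed t), Real.coe_nnabs,
      abs_of_nonneg (mul_nonneg (ψ.nonneg_normed t) L.coe_nonneg), mul_assoc]
    exact mul_le_mul_of_nonneg_left h1 (ψ.nonneg_normed t)
  · have hae := (Measure.measurePreserving_sub_left volume x).quasiMeasurePreserving.ae
      hg.ae_differentiableAt
    filter_upwards [hae] with t ht
    have h1 : HasFDerivAt (fun y => g (y - t)) (fderiv ℝ g (x - t)) x :=
      (ht.hasFDerivAt.comp x ((hasFDerivAt_id x).sub_const t)).congr_fderiv (by ext; simp)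
    exact h1.const_smul (ψ.normed volume t)

open scoped Convolution in
/-- Smooth approximation of compactly supported Lipschitz functions, with a.e. convergence of the
derivatives. -/
lemma exists_smooth_approx {N : ℕ} {g : EuclideanSpace ℝ (Fin N) → ℝ} {L : ℝ≥0}
    (hg : LipschitzWith L g) (hgc : HasCompactSupport g) {T : Set (EuclideanSpace ℝ (Fin N))}
    {δ : ℝ} (hδ : 0 < δ) (hT : ∀ x ∈ thickening δ T, g x = 0) :
    ∃ φ : ℕ → EuclideanSpace ℝ (Fin N) → ℝ, (∀ n, ContDiff ℝ (⊤ : ℕ∞) (φ n)) ∧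
      (∀ n, HasCompactSupport (φ n)) ∧ (∀ n, ∀ x ∈ thickening (δ / 2) T, φ n x = 0) ∧
      (∀ n x, ‖fderiv ℝ (φ n) x‖ ≤ L) ∧ (∀ n x, |φ n x - g x| ≤ L) ∧
      (∀ x, Filter.Tendsto (fun n => φ n x) Filter.atTop (𝓝 (g x))) ∧
      ∀ᵐ x, Filter.Tendsto (fun n => fderiv ℝ (φ n) x) Filter.atTop (𝓝 (fderiv ℝ g x)) := by
  set r : ℕ → ℝ := fun n => min (δ / 2) 1 * (1 / ((n : ℝ) + 1)) with hr
  have hr0 : ∀ n, 0 < r n := fun n => by positivity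
  have hrle : ∀ n, r n ≤ min (δ / 2) 1 := fun n => by
    refine mul_le_of_le_one_right (by positivity) ?_
    rw [div_le_one (by positivity)]
    linarith [n.cast_nonneg (α := ℝ)]
  set ψ : ℕ → ContDiffBump (0 : EuclideanSpace ℝ (Fin N)) := fun n =>
    ⟨r n / 2, r n, half_pos (hr0 n), half_lt_self (hr0 n)⟩ with hψ
  have hψr : Filter.Tendsto (fun n => (ψ n).rOut) Filter.atTop (𝓝 0) := by
    simpa only [mul_zero] using
      (tendsto_one_div_add_atTop_nhds_zero_nat (𝕜 := ℝ)).const_mul (min (δ / 2) 1)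
  have hfd : ∀ n x, fderiv ℝ ((ψ n).normed volume ⋆[ContinuousLinearMap.lsmul ℝ ℝ, volume] g) x =
      ((ψ n).normed volume ⋆[ContinuousLinearMap.lsmul ℝ ℝ, volume] fderiv ℝ g) x := fun n x =>
    (hasFDerivAt_normed_convolution (ψ n) hg x).fderiv
  have hloc : LocallyIntegrable (fderiv ℝ g) :=
    (memLp_top_of_bound (measurable_fderiv ℝ g).aestronglyMeasurable (L : ℝ)
      (Filter.Eventually.of_forall fun x =>
        norm_fderiv_le_of_lipschitz ℝ hg)).locallyIntegrable le_top
  refine ⟨fun n => (ψ n).normed volume ⋆[ContinuousLinearMap.lsmul ℝ ℝ, volume] g,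
    fun n => ?_, fun n => ?_, fun n x hx => ?_, fun n x => ?_, fun n x => ?_, fun x => ?_, ?_⟩
  · exact (ψ n).hasCompactSupport_normed.contDiff_convolution_left _ (ψ n).contDiff_normed
      hg.continuous.locallyIntegrable
  · exact (ψ n).hasCompactSupport_normed.convolution _ hgc
  · have hball : ∀ y ∈ ball x (ψ n).rOut, g y = 0 := by
      intro y hy
      refine hT y ?_
      obtain ⟨z, hz, hxz⟩ := mem_thickening_iff.1 hx
      refine mem_thickening_iff.2 ⟨z, hz, ?_⟩
      have h1 : dist y x < δ / 2 := hy.out.trans_le ((hrle n).trans (min_le_left _ _))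
      linarith [dist_triangle y x z]
    have hx0 := hball x (mem_ball_self (ψ n).rOut_pos)
    exact (ContDiffBump.normed_convolution_eq_right (φ := ψ n) (μ := volume)
      fun y hy => (hball y hy).trans hx0.symm).trans hx0
  · rw [hfd, convolution_def]
    refine (norm_integral_le_of_norm_le ((ψ n).integrable_normed.mul_const (L : ℝ))
      (Filter.Eventually.of_forall fun t => ?_)).trans_eq ?_
    · rw [ContinuousLinearMap.lsmul_apply, norm_smul, Real.norm_of_nonneg ((ψ n).nonneg_normed t)]
      exact mul_le_mul_of_nonneg_left (norm_fderiv_le_of_lipschitz ℝ hg) ((ψ n).nonneg_normed t)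
    · rw [integral_mul_const, (ψ n).integral_normed, one_mul]
  · refine ContDiffBump.dist_normed_convolution_le hg.continuous.aestronglyMeasurable
      fun y hy => ?_
    refine (hg.dist_le_mul y x).trans ?_
    have h1 : dist y x ≤ 1 := hy.out.le.trans ((hrle n).trans (min_le_right _ _))
    exact mul_le_of_le_one_right L.coe_nonneg h1
  · exact ContDiffBump.convolution_tendsto_right_of_continuous hψr hg.continuous x
  · have := ContDiffBump.ae_convolution_tendsto_right_of_locallyIntegrable (K := 2) hψr
      (Filter.Eventually.of_forall fun n => ?_) hloc
    · simpa only [hfd] using this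
    · change r n ≤ 2 * (r n / 2)
      linarith

/-- A function on the cone sector which is Lipschitz inside and vanishes on the outer boundary is
large only away from the complement of the sector. -/
lemma le_mul_dist_of_lt {N : ℕ} {S : Set (EuclideanSpace ℝ (Fin N))} (hSc : Convex ℝ S)
    {K : EuclideanSpace ℝ (Fin N) → ℝ} (hK : IsAnisoNorm K) {R : ℝ}
    {u : EuclideanSpace ℝ (Fin N) → ℝ} {L : ℝ≥0} (hu : LipschitzOnWith L u (S ∩ {x | K x < R}))
    (huc : ContinuousOn u ((S ∩ {x | K x < R}) ∪ (S ∩ frontier {x | K x < R})))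
    (hu0 : ∀ x ∈ S ∩ frontier {x | K x < R}, u x = 0) {t : ℝ}
    {x y : EuclideanSpace ℝ (Fin N)} (hx : x ∈ S ∩ {x | K x < R}) (htx : t < u x)
    (hyS : y ∈ S) (hy : R ≤ K y) : t ≤ L * dist x y := by
  set c : ℝ → EuclideanSpace ℝ (Fin N) := fun s => x + s • (y - x) with hc
  have hcc : Continuous c := by fun_prop
  obtain ⟨s, hs, hsR⟩ : R ∈ (fun s => K (c s)) '' Icc 0 1 := by
    refine intermediate_value_Icc zero_le_one (hK.continuous.comp hcc).continuousOn ⟨?_, ?_⟩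
    · simpa [hc] using le_of_lt hx.2
    · simpa [hc] using hy
  simp only at hsR
  have hs0 : 0 < s := by
    rcases hs.1.eq_or_lt with h | h
    · rw [← h] at hsR
      simp only [hc, zero_smul, add_zero] at hsR
      exact absurd hsR hx.2.ne
    · exact h
  have hcS : ∀ r ∈ Icc (0 : ℝ) 1, c r ∈ S := fun r hr => hSc.add_smul_sub_mem hx.1 hyS hr
  have hin : ∀ r ∈ Ico (0 : ℝ) s, c r ∈ S ∩ {x | K x < R} := by
    intro r hr
    refine ⟨hcS r ⟨hr.1, hr.2.le.trans hs.2⟩, ?_⟩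
    have h1 : c r = (1 - r / s) • x + (r / s) • c s := by
      simp only [hc, smul_add, smul_smul, div_mul_cancel₀ _ hs0.ne', sub_smul, one_smul]
      abel
    have h2 : r / s < 1 := (div_lt_one hs0).2 hr.2
    have h3 : 0 ≤ r / s := div_nonneg hr.1 hs0.le
    change K (c r) < R
    rw [h1]
    refine (hK.add_le _ _).trans_lt ?_
    rw [hK.hom, hK.hom, hsR, abs_of_nonneg h3, abs_of_pos (sub_pos.2 h2)]
    nlinarith [mul_pos (sub_pos.2 h2) (sub_pos.2 (show K x < R from hx.2))]
  have : (𝓝[Ico 0 s] s).NeBot := by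
    rw [← mem_closure_iff_nhdsWithin_neBot, closure_Ico hs0.ne]
    exact right_mem_Icc.2 hs0.le
  have hz : c s ∈ S ∩ frontier {x | K x < R} := by
    refine ⟨hcS s hs, ?_, ?_⟩
    · exact mem_closure_of_tendsto (f := c) (b := 𝓝[Ico 0 s] s) (hcc.continuousWithinAt)
        (by filter_upwards [self_mem_nhdsWithin] with r hr using (hin r hr).2)
    · rw [(hK.isOpen_ball R).interior_eq]
      exact hsR.not_lt
  have hut : Filter.Tendsto (fun r => u (c r)) (𝓝[Ico 0 s] s) (𝓝 0) := by
    have h1 := ((huc (c s) (Or.inr hz)).tendsto).comp (tendsto_nhdsWithin_iff.2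
      ⟨hcc.continuousWithinAt (s := Ico 0 s) (x := s), by
        filter_upwards [self_mem_nhdsWithin] with r hr using Or.inl (hin r hr)⟩)
    rwa [hu0 _ hz] at h1
  have hle : ∀ r ∈ Ico 0 s, u x - L * dist x y ≤ u (c r) := by
    intro r hr
    have h1 := hu.dist_le_mul x hx (c r) (hin r hr)
    have h2 : dist x (c r) ≤ dist x y := by
      rw [dist_comm, dist_eq_norm, dist_comm x y, dist_eq_norm]
      simp only [hc, add_sub_cancel_left, norm_smul, Real.norm_of_nonneg hr.1]
      exact mul_le_of_le_one_left (norm_nonneg _) (hr.2.le.trans hs.2)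
    have h3 := mul_le_mul_of_nonneg_left h2 L.coe_nonneg
    rw [Real.dist_eq] at h1
    linarith [le_abs_self (u x - u (c r))]
  have := ge_of_tendsto hut (by filter_upwards [self_mem_nhdsWithin] with r hr using hle r hr)
  linarith

/-- The truncation `min (u - t)⁺ h` extends to a compactly supported Lipschitz function which
vanishes near the outer boundary of the sector. -/
lemma exists_truncation {N : ℕ} {S : Set (EuclideanSpace ℝ (Fin N))} (hSc : Convex ℝ S)
    {K : EuclideanSpace ℝ (Fin N) → ℝ} (hK : IsAnisoNorm K) {R : ℝ}
    {Ω : Set (EuclideanSpace ℝ (Fin N))} (hΩ : Ω = {x | K x < R})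
    {u : EuclideanSpace ℝ (Fin N) → ℝ} {L : ℝ≥0} (hu : LipschitzOnWith L u (S ∩ Ω))
    (huc : ContinuousOn u ((S ∩ Ω) ∪ (S ∩ frontier Ω)))
    (hu0 : ∀ x ∈ S ∩ frontier Ω, u x = 0) {t h : ℝ} (ht : 0 < t) (hh : 0 < h) :
    ∃ (g : EuclideanSpace ℝ (Fin N) → ℝ) (C : ℝ≥0), LipschitzWith C g ∧ HasCompactSupport g ∧
      (∀ x, 0 ≤ g x) ∧ (∀ x, g x ≤ h) ∧ (∀ x ∈ S ∩ Ω, g x = max 0 (min (u x - t) h)) ∧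
      (∀ x ∈ S, x ∉ Ω → g x = 0) ∧
      ∃ δ > 0, ∀ x ∈ thickening δ (closure (S ∩ frontier Ω)), g x = 0 := by
  have hΩo : IsOpen Ω := hΩ ▸ hK.isOpen_ball R
  have hΩb : Bornology.IsBounded Ω := hΩ ▸ hK.isBounded_ball R
  set L' : ℝ := L + 1 with hL'
  have hL'0 : 0 < L' := by positivity
  set A : Set (EuclideanSpace ℝ (Fin N)) := {x | x ∈ S ∩ Ω ∧ t < u x} with hA
  set δ : ℝ := t / (2 * L') with hδ
  have hδ0 : 0 < δ := by positivity
  have hfar : ∀ x ∈ A, ∀ y ∈ S, y ∉ Ω → 2 * δ ≤ dist x y := by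
    intro x hx y hyS hy
    subst hΩ
    have h1 := le_mul_dist_of_lt hSc hK hu huc hu0 hx.1 hx.2 hyS (not_lt.1 hy)
    have h2 : 2 * δ = t / L' := by rw [hδ]; field_simp
    rw [h2, div_le_iff₀ hL'0, hL']
    nlinarith [dist_nonneg (x := x) (y := y)]
  set v : EuclideanSpace ℝ (Fin N) → ℝ := fun x => if x ∈ S ∩ Ω then max 0 (min (u x - t) h) else 0
    with hv
  have hv0 : ∀ x, x ∉ A → v x = 0 := by
    intro x hx
    by_cases hxG : x ∈ S ∩ Ω
    · have : u x ≤ t := not_lt.1 fun hlt => hx ⟨hxG, hlt⟩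
      rw [hv]
      simp only [if_pos hxG]
      exact max_eq_left ((min_le_left _ _).trans (by linarith))
    · exact if_neg hxG
  have hvnn : ∀ x, 0 ≤ v x := fun x => by
    by_cases hxG : x ∈ S ∩ Ω
    · simp only [hv, if_pos hxG, le_max_left]
    · simp only [hv, if_neg hxG, le_refl]
  have hvh : ∀ x, v x ≤ h := fun x => by
    by_cases hxG : x ∈ S ∩ Ω
    · simp only [hv, if_pos hxG]
      exact max_le hh.le (min_le_right _ _)
    · simp only [hv, if_neg hxG, hh.le]
  set T : Set (EuclideanSpace ℝ (Fin N)) := (S ∩ Ω) ∪ {y | ∀ x ∈ A, δ ≤ dist x y} with hT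
  set C : ℝ≥0 := L + (h / δ).toNNReal with hC
  have hCc : (C : ℝ) = L + h / δ := by
    rw [hC, NNReal.coe_add, Real.coe_toNNReal _ (by positivity)]
  have hlip : LipschitzOnWith C v T := by
    refine LipschitzOnWith.of_le_add_mul _ fun x hx y hy => ?_
    by_cases hxA : x ∈ A
    · by_cases hyG : y ∈ S ∩ Ω
      · have h1 := hu.dist_le_mul x hxA.1 y hyG
        rw [Real.dist_eq] at h1
        have h2 : u x - t ≤ u y - t + L * dist x y := by linarith [le_abs_self (u x - u y)]
        have h3 : (L : ℝ) * dist x y ≤ C * dist x y := by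
          rw [hCc]
          have : 0 ≤ h / δ := by positivity
          nlinarith [dist_nonneg (x := x) (y := y)]
        have h4 : 0 ≤ (L : ℝ) * dist x y := by positivity
        simp only [hv, if_pos hxA.1, if_pos hyG]
        refine max_le (by positivity) ?_
        rcases le_total (u y - t) h with h5 | h5
        · rw [min_eq_left h5]
          linarith [min_le_left (u x - t) h, le_max_right 0 (u y - t)]
        · rw [min_eq_right h5]
          linarith [min_le_right (u x - t) h, le_max_right 0 h]
      · have h1 : δ ≤ dist x y := (hy.resolve_left hyG) x hxA
        have h2 : h ≤ C * dist x y := by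
          rw [hCc, add_mul]
          have h3 : h ≤ h / δ * dist x y := by
            rw [div_mul_eq_mul_div, le_div_iff₀ hδ0]
            gcongr
          linarith [show 0 ≤ (L : ℝ) * dist x y by positivity]
        linarith [hvh x, hvnn y]
    · rw [hv0 x hxA]
      have := hvnn y
      positivity
  obtain ⟨g₀, hg₀, hg₀v⟩ := hlip.extend_real
  have hgv : ∀ x ∈ T, max 0 (min (g₀ x) h) = v x := fun x hx => by
    rw [← hg₀v hx, min_eq_left (hvh x), max_eq_right (hvnn x)]
  have hgz : ∀ y, y ∉ S ∩ Ω → (∀ x ∈ A, δ ≤ dist x y) → max 0 (min (g₀ y) h) = 0 :=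
    fun y hy hd => by rw [hgv y (Or.inr hd)]; exact if_neg hy
  refine ⟨fun x => max 0 (min (g₀ x) h), C, (hg₀.min_const h).const_max 0, ?_,
    fun x => le_max_left _ _, fun x => max_le hh.le (min_le_right _ _), fun x hx => ?_,
    fun x hxS hx => ?_, δ, hδ0, fun y hy => ?_⟩
  · refine HasCompactSupport.intro (K := cthickening δ Ω)
      (hΩb.cthickening.isCompact_closure.of_isClosed_subset isClosed_cthickening subset_closure)
      fun y hy => ?_
    refine hgz y (fun hyG => hy (self_subset_cthickening _ hyG.2)) fun x hx => ?_
    by_contra hlt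
    exact hy (mem_cthickening_of_dist_le _ x _ _ hx.1.2 (by rw [dist_comm]; exact (not_le.1 hlt).le))
  · exact (hgv x (Or.inl hx)).trans (if_pos hx)
  · exact hgz x (fun hxG => hx hxG.2) fun y hy => by linarith [hfar y hy x hxS hx]
  · obtain ⟨z, hz, hyz⟩ := mem_thickening_iff.1 hy
    have hzfar : ∀ x ∈ A, 2 * δ ≤ dist x z := by
      intro x hx
      refine closure_minimal (s := S ∩ frontier Ω) (t := {z | 2 * δ ≤ dist x z}) (fun z hz => ?_)
        (isClosed_le (by fun_prop) (by fun_prop)) hz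
      refine hfar x hx z hz.1 fun hzΩ => ?_
      exact (hΩo.inter_frontier_eq.subset ⟨hzΩ, hz.2⟩)
    have hyd : ∀ x ∈ A, δ ≤ dist x y := fun x hx => by
      linarith [hzfar x hx, dist_triangle x y z]
    refine (hgv y (Or.inr hyd)).trans (hv0 y fun hyA => ?_)
    have := hyd y hyA
    rw [dist_self] at this
    linarith

lemma inner_gradient_eq_fderiv {N : ℕ} (f : EuclideanSpace ℝ (Fin N) → ℝ)
    (x v : EuclideanSpace ℝ (Fin N)) : ⟪v, gradient f x⟫ = fderiv ℝ f x v := by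
  rw [real_inner_comm, gradient, InnerProductSpace.toDual_symm_apply]

lemma norm_gradient_eq {N : ℕ} (f : EuclideanSpace ℝ (Fin N) → ℝ)
    (x : EuclideanSpace ℝ (Fin N)) : ‖gradient f x‖ = ‖fderiv ℝ f x‖ := by
  rw [gradient, LinearIsometryEquiv.norm_map]

lemma measurable_gradient {N : ℕ} (f : EuclideanSpace ℝ (Fin N) → ℝ) :
    Measurable (gradient f) :=
  (LinearIsometryEquiv.continuous _).measurable.comp (measurable_fderiv ℝ f)

namespace IsAnisoNorm

variable {N : ℕ} {H : EuclideanSpace ℝ (Fin N) → ℝ}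

/-- Euler's identity for a norm. -/
lemma inner_gradient_self (hH : IsAnisoNorm H) {ξ : EuclideanSpace ℝ (Fin N)}
    (hd : DifferentiableAt ℝ H ξ) : ⟪gradient H ξ, ξ⟫ = H ξ := by
  rw [real_inner_comm, inner_gradient_eq_fderiv]
  have h1 : HasDerivAt (fun s : ℝ => H (ξ + s • ξ)) (fderiv ℝ H ξ ξ) 0 :=
    hd.hasFDerivAt.hasLineDerivAt ξ
  have h2 : HasDerivAt (fun s : ℝ => H (ξ + s • ξ)) (H ξ) 0 := by
    have h3 : HasDerivAt (fun s : ℝ => (1 + s) * H ξ) (1 * H ξ) 0 :=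
      ((hasDerivAt_id (0 : ℝ)).const_add 1).mul_const _
    rw [one_mul] at h3
    refine h3.congr_of_eventuallyEq ?_
    filter_upwards [lt_mem_nhds (show (-1 : ℝ) < 0 by norm_num)] with s hs
    rw [show ξ + s • ξ = (1 + s) • ξ by rw [add_smul, one_smul], hH.hom, abs_of_pos (by linarith)]
  exact h1.unique h2

lemma inner_aField_gradient (hH : IsAnisoNorm H) (hHell : UniformlyElliptic H) {p : ℝ}
    (hp : 1 < p) (u : EuclideanSpace ℝ (Fin N) → ℝ) (x : EuclideanSpace ℝ (Fin N)) :
    ⟪aField H p u x, gradient u x⟫ = H (gradient u x) ^ p := by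
  by_cases h0 : gradient u x = 0
  · rw [h0, inner_zero_right, hH.map_zero, Real.zero_rpow (by linarith)]
  · have hd : DifferentiableAt ℝ H (gradient u x) :=
      (hHell.1.differentiableOn (by norm_num)).differentiableAt
        (isOpen_compl_singleton.mem_nhds h0)
    rw [aField, if_neg h0, real_inner_smul_left, hH.inner_gradient_self hd]
    nth_rewrite 2 [← Real.rpow_one (H (gradient u x))]
    rw [← Real.rpow_add (hH.pos _ h0), sub_add_cancel]

lemma measurable_aField (hH : IsAnisoNorm H) (p : ℝ) (u : EuclideanSpace ℝ (Fin N) → ℝ) :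
    Measurable (aField H p u) := by
  have h1 := measurable_gradient u
  refine Measurable.ite (h1 (measurableSet_singleton 0)) measurable_const ?_
  exact ((hH.continuous.measurable.comp h1).pow_const _).smul ((measurable_gradient H).comp h1)

lemma exists_norm_aField_le (hH : IsAnisoNorm H) {p : ℝ} (hp : 1 < p)
    (u : EuclideanSpace ℝ (Fin N) → ℝ) (L : ℝ≥0) :
    ∃ C : ℝ, 0 ≤ C ∧ ∀ x, ‖gradient u x‖ ≤ L → ‖aField H p u x‖ ≤ C := by
  obtain ⟨C, hC⟩ := hH.exists_le_norm
  obtain ⟨C', hC'⟩ := hH.exists_lipschitz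
  refine ⟨(C * L : ℝ) ^ (p - 1) * C', by positivity, fun x hx => ?_⟩
  rw [aField]
  split_ifs with h0
  · rw [norm_zero]; positivity
  · rw [norm_smul, Real.norm_of_nonneg (Real.rpow_nonneg (hH.nonneg _) _), norm_gradient_eq]
    refine mul_le_mul ?_ (norm_fderiv_le_of_lipschitz ℝ hC') (norm_nonneg _) (by positivity)
    refine Real.rpow_le_rpow (hH.nonneg _) ((hC _).trans ?_) (by linarith)
    gcongr

end IsAnisoNorm

/-- A weak identity against smooth functions extends to compactly supported Lipschitz functions. -/
lemma integral_inner_gradient_eq_of_forall_smooth {N : ℕ} {G T : Set (EuclideanSpace ℝ (Fin N))}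
    {b : EuclideanSpace ℝ (Fin N) → EuclideanSpace ℝ (Fin N)}
    {F : EuclideanSpace ℝ (Fin N) → ℝ} (hb : IntegrableOn b G) (hF : IntegrableOn F G)
    (hweak : ∀ φ : EuclideanSpace ℝ (Fin N) → ℝ, ContDiff ℝ (⊤ : ℕ∞) φ → HasCompactSupport φ →
      (∃ U, IsOpen U ∧ T ⊆ U ∧ ∀ x ∈ U, φ x = 0) →
      ∫ x in G, ⟪b x, gradient φ x⟫ = ∫ x in G, F x * φ x)
    {g : EuclideanSpace ℝ (Fin N) → ℝ} {L : ℝ≥0} (hg : LipschitzWith L g)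
    (hgc : HasCompactSupport g) {δ : ℝ} (hδ : 0 < δ) (hT : ∀ x ∈ thickening δ T, g x = 0) :
    ∫ x in G, ⟪b x, gradient g x⟫ = ∫ x in G, F x * g x := by
  obtain ⟨φ, hφ1, hφ2, hφ3, hφ4, hφ5, hφ6, hφ7⟩ := exists_smooth_approx hg hgc hδ hT
  obtain ⟨B, hB⟩ := hgc.exists_bound_of_continuous hg.continuous
  have h1 : Filter.Tendsto (fun n => ∫ x in G, ⟪b x, gradient (φ n) x⟫) Filter.atTop
      (𝓝 (∫ x in G, ⟪b x, gradient g x⟫)) := by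
    refine tendsto_integral_of_dominated_convergence (fun x => ‖b x‖ * L) (fun n => ?_)
      (hb.norm.mul_const _) (fun n => ae_of_all _ fun x => ?_) ?_
    · exact hb.aestronglyMeasurable.inner (measurable_gradient _).aestronglyMeasurable
    · refine (norm_inner_le_norm _ _).trans ?_
      rw [norm_gradient_eq]
      exact mul_le_mul_of_nonneg_left (hφ4 n x) (norm_nonneg _)
    · filter_upwards [ae_restrict_of_ae hφ7] with x hx
      refine Filter.Tendsto.inner tendsto_const_nhds ?_
      exact ((LinearIsometryEquiv.continuous _).tendsto _).comp hx
  have h2 : Filter.Tendsto (fun n => ∫ x in G, F x * φ n x) Filter.atTop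
      (𝓝 (∫ x in G, F x * g x)) := by
    refine tendsto_integral_of_dominated_convergence (fun x => ‖F x‖ * (L + B)) (fun n => ?_)
      (hF.norm.mul_const _) (fun n => ae_of_all _ fun x => ?_) (ae_of_all _ fun x => ?_)
    · exact hF.aestronglyMeasurable.mul (hφ1 n).continuous.aestronglyMeasurable
    · rw [norm_mul]
      refine mul_le_mul_of_nonneg_left ?_ (norm_nonneg _)
      have h3 := hB x
      have h4 := hφ5 n x
      rw [Real.norm_eq_abs] at h3 ⊢
      linarith [abs_sub_abs_le_abs_sub (φ n x) (g x)]
    · exact (hφ6 x).const_mul _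
  refine tendsto_nhds_unique h1 (h2.congr fun n => (hweak (φ n) (hφ1 n) (hφ2 n) ?_).symm)
  exact ⟨thickening (δ / 2) T, isOpen_thickening, self_subset_thickening (half_pos hδ) T,
    hφ3 n⟩

lemma exists_abs_le_of_lipschitzOnWith {N : ℕ} {G : Set (EuclideanSpace ℝ (Fin N))}
    (hG : Bornology.IsBounded G) {u : EuclideanSpace ℝ (Fin N) → ℝ} {L : ℝ≥0}
    (hu : LipschitzOnWith L u G) : ∃ C : ℝ, 0 ≤ C ∧ ∀ x ∈ G, |u x| ≤ C := by
  rcases G.eq_empty_or_nonempty with rfl | ⟨x₀, hx₀⟩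
  · exact ⟨0, le_rfl, fun x hx => hx.elim⟩
  · refine ⟨|u x₀| + L * diam G, add_nonneg (abs_nonneg _) (mul_nonneg L.coe_nonneg diam_nonneg),
      fun x hx => ?_⟩
    have h1 := hu.dist_le_mul x hx x₀ hx₀
    have h2 := mul_le_mul_of_nonneg_left (dist_le_diam_of_mem hG hx hx₀) L.coe_nonneg
    rw [Real.dist_eq] at h1
    linarith [abs_sub_abs_le_abs_sub (u x) (u x₀)]

lemma gradient_eq_zero_of_forall_le {N : ℕ} {g : EuclideanSpace ℝ (Fin N) → ℝ}
    {x : EuclideanSpace ℝ (Fin N)} (hx : ∀ y, g x ≤ g y) : gradient g x = 0 := by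
  rw [gradient, IsLocalMin.fderiv_eq_zero (Filter.Eventually.of_forall hx), _root_.map_zero]

lemma gradient_eq_zero_of_forall_ge {N : ℕ} {g : EuclideanSpace ℝ (Fin N) → ℝ}
    {x : EuclideanSpace ℝ (Fin N)} (hx : ∀ y, g y ≤ g x) : gradient g x = 0 := by
  rw [gradient, IsLocalMax.fderiv_eq_zero (Filter.Eventually.of_forall hx), _root_.map_zero]

namespace IsConeWeight

variable {N : ℕ} {S : Set (EuclideanSpace ℝ (Fin N))} {lam : ℝ}
  {w : EuclideanSpace ℝ (Fin N) → ℝ}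

/-- Testing the weak equation with a truncation of the solution, combined with the functional
isoperimetric inequality, on a slab between two levels. -/
lemma holder_isoperimetric_slab (hw : IsConeWeight S lam w) (hN : 0 < N)
    {D : ℝ} (hD : D = (N : ℝ) + lam) (hD1 : 1 < D) {p : ℝ} (hp : 1 < p)
    {H : EuclideanSpace ℝ (Fin N) → ℝ} (hH : IsAnisoNorm H) (hHell : UniformlyElliptic H)
    {R : ℝ} {Ω : Set (EuclideanSpace ℝ (Fin N))} (hΩ : Ω = {x | dualNorm H x < R})
    {f : ℝ → ℝ} (hfm : Measurable f) (hf0 : ∀ s, 0 ≤ s → 0 ≤ f s)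
    (hfb : ∀ b : ℝ, 0 ≤ b → ∃ C, ∀ s ∈ Icc (0 : ℝ) b, f s ≤ C)
    {u : EuclideanSpace ℝ (Fin N) → ℝ} (hunn : ∀ x ∈ S ∩ Ω, 0 ≤ u x)
    {L : ℝ≥0} (hu : LipschitzOnWith L u (S ∩ Ω))
    (huc : ContinuousOn u ((S ∩ Ω) ∪ (S ∩ frontier Ω)))
    (hu0 : ∀ x ∈ S ∩ frontier Ω, u x = 0)
    (hweak : ∀ φ : EuclideanSpace ℝ (Fin N) → ℝ,
      ContDiff ℝ (⊤ : ℕ∞) φ → HasCompactSupport φ →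
      (∃ U, IsOpen U ∧ closure (S ∩ frontier Ω) ⊆ U ∧ ∀ x ∈ U, φ x = 0) →
      ∫ x in S ∩ Ω, w x * ⟪aField H p u x, gradient φ x⟫ =
        ∫ x in S ∩ Ω, f (u x) * φ x * w x)
    {t h : ℝ} (ht : 0 < t) (hh : 0 < h) :
    ENNReal.ofReal (D * (coneMeasure S w {y | dualNorm H y < 1}).toReal ^ (1 / D)) *
        (ENNReal.ofReal h * ENNReal.ofReal
          ((coneMeasure S w {x | x ∈ S ∩ Ω ∧ t + h < u x}).toReal ^ ((D - 1) / D))) ≤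
      ENNReal.ofReal (h * ∫ x in {x | x ∈ S ∩ Ω ∧ t < u x}, f (u x) * w x) ^ (1 / p) *
        coneMeasure S w {x | x ∈ S ∩ Ω ∧ (t < u x ∧ u x < t + h) ∧ gradient u x ≠ 0} ^
          ((p - 1) / p) := by
  have hK := hH.dual hN
  have hΩo : IsOpen Ω := hΩ ▸ hK.isOpen_ball R
  have hΩb : Bornology.IsBounded Ω := hΩ ▸ hK.isBounded_ball R
  have hSo : IsOpen S := hw.cone.1
  have hG : IsOpen (S ∩ Ω) := hSo.inter hΩo
  have hGb : Bornology.IsBounded (S ∩ Ω) := hΩb.subset inter_subset_right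
  set ν := coneMeasure S w with hν
  set U : Set (EuclideanSpace ℝ (Fin N)) := {x | x ∈ S ∩ Ω ∧ t < u x ∧ u x < t + h} with hU
  have hUo : IsOpen U := hu.continuousOn.isOpen_inter_preimage hG (isOpen_Ioo (a := t) (b := t + h))
  have hto : IsOpen {x | x ∈ S ∩ Ω ∧ t < u x} :=
    hu.continuousOn.isOpen_inter_preimage hG (isOpen_Ioi (a := t))
  obtain ⟨g, C, hg, hgc, hg0, hgh, hgG, hgS, δ, hδ, hgT⟩ :=
    exists_truncation hw.cone.2.1 hK hΩ hu huc hu0 ht hh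
  have hgU : ∀ x ∈ U, gradient g x = gradient u x := by
    intro x hx
    have : g =ᶠ[𝓝 x] fun y => u y - t := by
      filter_upwards [hUo.mem_nhds hx] with y hy
      rw [hgG y hy.1, min_eq_left (by linarith [hy.2.2]), max_eq_right (by linarith [hy.2.1])]
    rw [gradient, gradient, this.fderiv_eq, fderiv_sub_const]
  have hgU' : ∀ x ∈ S, x ∉ U → gradient g x = 0 := by
    intro x hxS hx
    by_cases hxΩ : x ∈ Ω
    · have h1 := hgG x ⟨hxS, hxΩ⟩
      rcases le_or_gt (u x) t with h2 | h2
      · rw [max_eq_left ((min_le_left _ _).trans (by linarith))] at h1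
        exact gradient_eq_zero_of_forall_le fun y => h1 ▸ hg0 y
      · have h3 : t + h ≤ u x := not_lt.1 fun h3 => hx ⟨⟨hxS, hxΩ⟩, h2, h3⟩
        rw [min_eq_right (by linarith), max_eq_right hh.le] at h1
        exact gradient_eq_zero_of_forall_ge fun y => h1 ▸ hgh y
    · have h1 := hgS x hxS hxΩ
      exact gradient_eq_zero_of_forall_le fun y => h1 ▸ hg0 y
  obtain ⟨Cw, hCw0, hCw⟩ := hw.exists_bound hΩb
  have hwi : IntegrableOn w (S ∩ Ω) := hw.integrableOn hΩb hΩo.measurableSet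
  have hwm := hwi.aestronglyMeasurable
  have hwG : ∀ x ∈ S ∩ Ω, 0 ≤ w x := fun x hx => hw.nonneg x (subset_closure hx.1)
  have hfin : IsFiniteMeasure (volume.restrict (S ∩ Ω)) :=
    ⟨by simpa using hGb.measure_lt_top⟩
  have hgradu : ∀ x ∈ S ∩ Ω, ‖gradient u x‖ ≤ L := fun x hx => by
    rw [norm_gradient_eq]
    exact norm_fderiv_le_of_lipschitzOn ℝ (hG.mem_nhds hx) hu
  -- integrability of the two sides of the weak equation
  have hb : IntegrableOn (fun x => w x • aField H p u x) (S ∩ Ω) := by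
    obtain ⟨Ca, hCa0, hCa⟩ := hH.exists_norm_aField_le hp u L
    refine (integrable_const (Cw * Ca)).mono'
      (hwm.smul (hH.measurable_aField p u).aestronglyMeasurable) ?_
    filter_upwards [ae_restrict_mem hG.measurableSet] with x hx
    rw [norm_smul, Real.norm_of_nonneg (hwG x hx)]
    exact mul_le_mul (hCw x hx) (hCa x (hgradu x hx)) (norm_nonneg _) hCw0
  obtain ⟨Cu, hCu0, hCu⟩ := exists_abs_le_of_lipschitzOnWith hGb hu
  obtain ⟨Cf, hCf⟩ := hfb Cu hCu0
  have hfG : ∀ x ∈ S ∩ Ω, 0 ≤ f (u x) ∧ f (u x) ≤ Cf := fun x hx =>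
    ⟨hf0 _ (hunn x hx), hCf _ ⟨hunn x hx, (le_abs_self _).trans (hCu x hx)⟩⟩
  have hF : IntegrableOn (fun x => f (u x) * w x) (S ∩ Ω) := by
    refine (integrable_const (Cf * Cw)).mono' (AEStronglyMeasurable.mul
      (hfm.comp_aemeasurable (hu.continuousOn.aemeasurable hG.measurableSet)).aestronglyMeasurable
      hwm) ?_
    filter_upwards [ae_restrict_mem hG.measurableSet] with x hx
    rw [Real.norm_of_nonneg (mul_nonneg (hfG x hx).1 (hwG x hx))]
    exact mul_le_mul (hfG x hx).2 (hCw x hx) (hwG x hx) ((hfG x hx).1.trans (hfG x hx).2)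
  have hid := integral_inner_gradient_eq_of_forall_smooth hb hF (T := closure (S ∩ frontier Ω))
    (fun φ h1 h2 h3 => by
      have := hweak φ h1 h2 h3
      simp only [real_inner_smul_left]
      rw [this]
      exact integral_congr_ae (ae_of_all _ fun x => by ring)) hg hgc hδ hgT
  have hHm : Measurable fun x => H (gradient u x) :=
    hH.continuous.measurable.comp (measurable_gradient u)
  -- the energy estimate
  have henergy : ∫⁻ x in U, ENNReal.ofReal (H (gradient u x)) ^ p ∂ν ≤
      ENNReal.ofReal (h * ∫ x in {x | x ∈ S ∩ Ω ∧ t < u x}, f (u x) * w x) := by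
    have h1 : ∫ x in S ∩ Ω, f (u x) * w x * g x ≤
        h * ∫ x in {x | x ∈ S ∩ Ω ∧ t < u x}, f (u x) * w x := by
      rw [← integral_const_mul, ← integral_indicator hG.measurableSet,
        ← integral_indicator hto.measurableSet]
      refine integral_mono_of_nonneg (ae_of_all _ fun x => ?_) ?_ (ae_of_all _ fun x => ?_)
      · refine indicator_nonneg (fun x hx => ?_) x
        exact mul_nonneg (mul_nonneg (hfG x hx).1 (hwG x hx)) (hg0 x)
      · exact (integrable_indicator_iff hto.measurableSet).2
          ((hF.mono_set fun x hx => hx.1).const_mul h)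
      · by_cases hx : x ∈ S ∩ Ω
        · by_cases hxt : t < u x
          · rw [indicator_of_mem hx, indicator_of_mem (show x ∈ {x | x ∈ S ∩ Ω ∧ t < u x} from
              ⟨hx, hxt⟩), mul_comm h]
            exact mul_le_mul_of_nonneg_left (hgh x) (mul_nonneg (hfG x hx).1 (hwG x hx))
          · rw [indicator_of_mem hx, indicator_of_notMem (fun h => hxt h.2), hgG x hx,
              max_eq_left ((min_le_left _ _).trans (by linarith)), mul_zero]
        · rw [indicator_of_notMem hx, indicator_of_notMem fun h => hx h.1]
    refine le_trans ?_ (ENNReal.ofReal_le_ofReal (hid.trans_le h1))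
    have hnn : ∀ x ∈ S ∩ Ω, 0 ≤ ⟪w x • aField H p u x, gradient g x⟫ := fun x hx => by
      by_cases hxU : x ∈ U
      · rw [hgU x hxU, real_inner_smul_left, hH.inner_aField_gradient hHell hp]
        exact mul_nonneg (hwG x hx) (Real.rpow_nonneg (hH.nonneg _) _)
      · rw [hgU' x hx.1 hxU, inner_zero_right]
    rw [ofReal_integral_eq_lintegral_ofReal, hw.lintegral_coneMeasure hUo.measurableSet]
    · refine le_trans ?_ (lintegral_mono_set (show S ∩ U ⊆ S ∩ Ω from fun x hx => hx.2.1))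
      refine setLIntegral_mono' (hSo.inter hUo).measurableSet fun x hx => ?_
      rw [hgU x hx.2, real_inner_smul_left, hH.inner_aField_gradient hHell hp,
        ENNReal.ofReal_mul (hwG x hx.2.1), ENNReal.ofReal_rpow_of_nonneg (hH.nonneg _) (by linarith)]
    · refine (hb.norm.mul_const (C : ℝ)).mono'
        (hb.aestronglyMeasurable.inner (measurable_gradient g).aestronglyMeasurable) ?_
      refine ae_of_all _ fun x => (norm_inner_le_norm _ _).trans ?_
      refine mul_le_mul_of_nonneg_left ?_ (norm_nonneg _)
      rw [norm_gradient_eq]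
      exact norm_fderiv_le_of_lipschitz ℝ hg
    · filter_upwards [ae_restrict_mem hG.measurableSet] with x hx using hnn x hx
  -- the isoperimetric estimate
  have hiso : ENNReal.ofReal (D * (ν {y | dualNorm H y < 1}).toReal ^ (1 / D)) *
        (ENNReal.ofReal h * ENNReal.ofReal
          ((ν {x | x ∈ S ∩ Ω ∧ t + h < u x}).toReal ^ ((D - 1) / D))) ≤
      ∫⁻ x in U, ENNReal.ofReal (H (gradient u x)) ∂ν := by
    have h1 := hw.lintegral_rpow_le_lintegral_gradient hH hN hD hD1 hg hg0 hΩb hgS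
    have h2 : ∫⁻ x, ENNReal.ofReal (H (gradient g x)) ∂ν =
        ∫⁻ x in U, ENNReal.ofReal (H (gradient u x)) ∂ν := by
      rw [← lintegral_indicator hUo.measurableSet]
      refine lintegral_congr_ae ?_
      filter_upwards [hw.ae_mem_cone] with x hx
      by_cases hxU : x ∈ U
      · rw [indicator_of_mem hxU, hgU x hxU]
      · rw [indicator_of_notMem hxU, hgU' x hx hxU, hH.map_zero, ENNReal.ofReal_zero]
    rw [h2] at h1
    refine le_trans (mul_le_mul_right ?_ _) h1
    calc ENNReal.ofReal h * ENNReal.ofReal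
          ((ν {x | x ∈ S ∩ Ω ∧ t + h < u x}).toReal ^ ((D - 1) / D))
        = ∫⁻ s in Ioo 0 h, ENNReal.ofReal
          ((ν {x | x ∈ S ∩ Ω ∧ t + h < u x}).toReal ^ ((D - 1) / D)) := by
          rw [setLIntegral_const, Real.volume_Ioo, sub_zero, mul_comm]
      _ ≤ ∫⁻ s in Ioo 0 h, ENNReal.ofReal ((ν {x | s < g x}).toReal ^ ((D - 1) / D)) := by
          refine setLIntegral_mono' measurableSet_Ioo fun s hs => ENNReal.ofReal_le_ofReal ?_
          refine Real.rpow_le_rpow ENNReal.toReal_nonneg ?_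
            (div_nonneg (by linarith) (by linarith))
          refine ENNReal.toReal_mono ?_ (measure_mono fun x hx => ?_)
          · rw [hν, ← hw.coneMeasure_inter (measurableSet_lt measurable_const
              hg.continuous.measurable)]
            refine (hw.coneMeasure_lt_top (hΩb.subset fun x hx => ?_)).ne
            by_contra hxΩ
            have := hgS x hx.1 hxΩ
            linarith [hs.1, show s < g x from hx.2]
          · change s < g x
            rw [hgG x hx.1, min_eq_right (by linarith [hx.2]), max_eq_right hh.le]
            exact hs.2
      _ ≤ ∫⁻ s in Ioi 0, ENNReal.ofReal ((ν {x | s < g x}).toReal ^ ((D - 1) / D)) :=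
          lintegral_mono_set Ioo_subset_Ioi_self
  -- the Hölder inequality on the slab
  refine hiso.trans ?_
  have hpq : p.HolderConjugate (p / (p - 1)) := Real.HolderConjugate.conjExponent hp
  have hV : MeasurableSet {x | gradient u x ≠ 0} :=
    (measurable_gradient u (measurableSet_singleton 0)).compl
  set χ : EuclideanSpace ℝ (Fin N) → ℝ≥0∞ := {x | gradient u x ≠ 0}.indicator 1 with hχ
  have hχ1 : ∀ x, gradient u x ≠ 0 → χ x = 1 := fun x hx => indicator_of_mem hx 1
  have hχ0 : ∀ x, gradient u x = 0 → χ x = 0 := fun x hx => indicator_of_notMem (by simpa using hx) 1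
  calc ∫⁻ x in U, ENNReal.ofReal (H (gradient u x)) ∂ν
      = ∫⁻ x in U, ((fun x => ENNReal.ofReal (H (gradient u x))) * χ) x ∂ν := by
        refine lintegral_congr fun x => ?_
        by_cases hx : gradient u x = 0
        · simp [hx, hH.map_zero]
        · simp [hχ1 x hx]
    _ ≤ (∫⁻ x in U, ENNReal.ofReal (H (gradient u x)) ^ p ∂ν) ^ (1 / p) *
          (∫⁻ x in U, χ x ^ (p / (p - 1)) ∂ν) ^ (1 / (p / (p - 1))) :=
        ENNReal.lintegral_mul_le_Lp_mul_Lq _ hpq hHm.ennreal_ofReal.aemeasurable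
          (measurable_one.indicator hV).aemeasurable
    _ ≤ _ := by
        rw [one_div_div]
        have h1 : ∫⁻ x in U, χ x ^ (p / (p - 1)) ∂ν =
            ν {x | x ∈ S ∩ Ω ∧ (t < u x ∧ u x < t + h) ∧ gradient u x ≠ 0} := by
          have h2 : ∀ x, χ x ^ (p / (p - 1)) = χ x := fun x => by
            by_cases hx : gradient u x = 0
            · rw [hχ0 x hx, ENNReal.zero_rpow_of_pos hpq.symm.pos]
            · rw [hχ1 x hx, ENNReal.one_rpow]
          simp_rw [h2]
          rw [hχ, lintegral_indicator_one hV, Measure.restrict_apply hV]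
          congr 1
          ext x
          simp only [hU, mem_inter_iff, mem_ofPred_eq]
          tauto
        rw [h1]
        gcongr

end IsConeWeight

section HausdorffSlices

variable {X Y : Type*} [MetricSpace X] [MeasurableSpace X] [BorelSpace X]
  [MetricSpace Y] [MeasurableSpace Y] [BorelSpace Y]

lemma lintegral_image_hausdorff_le {π : X → Y} {K : ℝ≥0} (hπ : LipschitzWith K π) {d : ℝ}
    (hd : 0 ≤ d) (A : Set X) {Γ : Y → ℝ≥0∞} (hΓ : Measurable Γ) :
    ∫⁻ y in π '' A, Γ y ∂μH[d] ≤ (K : ℝ≥0∞) ^ d * ∫⁻ x in A, Γ (π x) ∂μH[d] := by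
  have hm := hπ.continuous.measurable
  have h1 : (μH[d] : Measure Y).restrict (π '' A) ≤
      (K : ℝ≥0∞) ^ d • Measure.map π ((μH[d] : Measure X).restrict A) := by
    refine Measure.le_iff.2 fun B hB => ?_
    rw [Measure.smul_apply, Measure.map_apply hm hB, Measure.restrict_apply hB,
      Measure.restrict_apply (hm hB), smul_eq_mul, ← image_preimage_inter]
    exact hπ.lipschitzOnWith.hausdorffMeasure_image_le hd
  refine (lintegral_mono' h1 le_rfl).trans ?_
  rw [lintegral_smul_measure, lintegral_map hΓ hm, smul_eq_mul]

lemma lintegral_hausdorff_le_lintegral_image {π : X → Y} (hm : Measurable π) {A : Set X} {K : ℝ≥0}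
    (hπ : ∀ x ∈ A, ∀ x' ∈ A, dist x x' ≤ K * dist (π x) (π x')) {d : ℝ}
    (hd : 0 ≤ d) {Γ : Y → ℝ≥0∞} (hΓ : Measurable Γ) :
    ∫⁻ x in A, Γ (π x) ∂μH[d] ≤ (K : ℝ≥0∞) ^ d * ∫⁻ y in π '' A, Γ y ∂μH[d] := by
  have h1 : Measure.map π ((μH[d] : Measure X).restrict A) ≤
      (K : ℝ≥0∞) ^ d • (μH[d] : Measure Y).restrict (π '' A) := by
    refine Measure.le_iff.2 fun B hB => ?_
    rw [Measure.smul_apply, Measure.map_apply hm hB, Measure.restrict_apply hB,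
      Measure.restrict_apply (hm hB), smul_eq_mul]
    rcases A.eq_empty_or_nonempty with rfl | ⟨x₀, -⟩
    · simp
    have : Nonempty X := ⟨x₀⟩
    set σ := Function.invFunOn π A with hσ
    have hσA : ∀ x ∈ A, σ (π x) ∈ A ∧ π (σ (π x)) = π x := fun x hx =>
      ⟨Function.invFunOn_mem ⟨x, hx, rfl⟩, Function.invFunOn_eq ⟨x, hx, rfl⟩⟩
    have hσπ : ∀ x ∈ A, σ (π x) = x := fun x hx => by
      have := hπ _ (hσA x hx).1 x hx
      rw [(hσA x hx).2, dist_self, mul_zero] at this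
      exact dist_le_zero.1 this
    have hlip : LipschitzOnWith K σ (B ∩ π '' A) := by
      refine LipschitzOnWith.of_dist_le_mul ?_
      rintro _ ⟨-, x, hx, rfl⟩ _ ⟨-, x', hx', rfl⟩
      rw [hσπ x hx, hσπ x' hx']
      exact hπ x hx x' hx'
    refine (measure_mono ?_).trans (hlip.hausdorffMeasure_image_le hd)
    rintro x ⟨hxB, hxA⟩
    exact ⟨π x, ⟨hxB, x, hxA, rfl⟩, hσπ x hxA⟩
  rw [← lintegral_map hΓ hm]
  refine (lintegral_mono' h1 le_rfl).trans ?_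
  rw [lintegral_smul_measure, smul_eq_mul]

end HausdorffSlices

lemma exists_orthonormalBasis_zero_eq {m : ℕ} {e : EuclideanSpace ℝ (Fin (m + 1))}
    (he : ‖e‖ = 1) : ∃ b : OrthonormalBasis (Fin (m + 1)) ℝ (EuclideanSpace ℝ (Fin (m + 1))),
      b 0 = e := by
  obtain ⟨b, hb⟩ := Orthonormal.exists_orthonormalBasis_extension_of_card_eq (𝕜 := ℝ)
    (E := EuclideanSpace ℝ (Fin (m + 1))) (ι := Fin (m + 1)) (by simp) (v := fun _ => e) (s := {0})
    ⟨fun _ => he, fun i j hij => (hij (Subsingleton.elim i j)).elim⟩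
  exact ⟨b, hb 0 rfl⟩

/-- Splitting off the first coordinate with respect to an orthonormal basis. -/
def splitCoord {m : ℕ}
    (b : OrthonormalBasis (Fin (m + 1)) ℝ (EuclideanSpace ℝ (Fin (m + 1)))) :
    EuclideanSpace ℝ (Fin (m + 1)) ≃ᵐ ℝ × (Fin m → ℝ) :=
  (b.repr.toHomeomorph.toMeasurableEquiv.trans (MeasurableEquiv.toLp 2 (Fin (m + 1) → ℝ)).symm).trans
    (MeasurableEquiv.piFinSuccAbove (fun _ => ℝ) 0)

lemma splitCoord_apply {m : ℕ}
    (b : OrthonormalBasis (Fin (m + 1)) ℝ (EuclideanSpace ℝ (Fin (m + 1))))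
    (x : EuclideanSpace ℝ (Fin (m + 1))) :
    splitCoord b x = (b.repr x 0, fun i => b.repr x i.succ) := by
  rfl

lemma measurePreserving_splitCoord {m : ℕ}
    (b : OrthonormalBasis (Fin (m + 1)) ℝ (EuclideanSpace ℝ (Fin (m + 1)))) :
    MeasurePreserving (splitCoord b) volume volume :=
  (volume_preserving_piFinSuccAbove (fun _ => ℝ) 0).comp
    ((EuclideanSpace.volume_preserving_symm_measurableEquiv_toLp (Fin (m + 1))).comp
      b.measurePreserving_repr)

section Chart

variable {m : ℕ} {b : OrthonormalBasis (Fin (m + 1)) ℝ (EuclideanSpace ℝ (Fin (m + 1)))}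
  {u : EuclideanSpace ℝ (Fin (m + 1)) → ℝ} {O : Set (EuclideanSpace ℝ (Fin (m + 1)))} {κ : ℝ}

/-- On a convex set where `u` increases in direction `b 0`, level sets of `u` are Lipschitz graphs
over the hyperplane orthogonal to `b 0`. -/
lemma dist_le_mul_dist_of_level (hO : Convex ℝ O) (hu : ∀ x ∈ O, DifferentiableAt ℝ u x)
    (hκ : 0 < κ) (hb : ∀ x ∈ O, 0 < ‖fderiv ℝ u x‖ ∧ κ * ‖fderiv ℝ u x‖ ≤ fderiv ℝ u x (b 0))
    {x x' : EuclideanSpace ℝ (Fin (m + 1))} (hx : x ∈ O) (hx' : x' ∈ O) (h : u x = u x') :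
    dist x x' ≤ m * (1 + 1 / κ) * dist (splitCoord b x).2 (splitCoord b x').2 := by
  obtain ⟨z, hz, hzd⟩ := domain_mvt (fun y hy => (hu y hy).hasFDerivAt.hasFDerivWithinAt) hO hx' hx
  have hzO : z ∈ O := hO.segment_subset hx' hx hz
  set v := x - x' with hv
  set q : EuclideanSpace ℝ (Fin (m + 1)) := ∑ i : Fin m, b.repr v i.succ • b i.succ with hq
  set Δ := dist (splitCoord b x).2 (splitCoord b x').2 with hΔ
  have hdec : v = b.repr v 0 • b 0 + q := by
    conv_lhs => rw [← b.sum_repr v, Fin.sum_univ_succ]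
  have hcoord : ∀ i : Fin m, |b.repr v i.succ| ≤ Δ := fun i => by
    have h1 := dist_le_pi_dist (splitCoord b x).2 (splitCoord b x').2 i
    rw [Real.dist_eq] at h1
    rw [hv, map_sub]
    exact h1
  have hqn : ‖q‖ ≤ m * Δ := by
    refine (norm_sum_le _ _).trans ((Finset.sum_le_card_nsmul _ _ Δ fun i _ => ?_).trans ?_)
    · rw [norm_smul, b.norm_eq_one, mul_one]
      exact hcoord i
    · simp
  obtain ⟨hpos, hlow⟩ := hb z hzO
  have ha : |b.repr v 0| ≤ ‖q‖ / κ := by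
    have h1 : b.repr v 0 * fderiv ℝ u z (b 0) = -fderiv ℝ u z q := by
      have h2 : fderiv ℝ u z v = 0 := by rw [hv, ← hzd, h, sub_self]
      rw [hdec, map_add, map_smul, smul_eq_mul] at h2
      linarith
    have h3 : |b.repr v 0| * (κ * ‖fderiv ℝ u z‖) ≤ ‖fderiv ℝ u z‖ * ‖q‖ := by
      calc |b.repr v 0| * (κ * ‖fderiv ℝ u z‖) ≤ |b.repr v 0| * |fderiv ℝ u z (b 0)| :=
            mul_le_mul_of_nonneg_left (hlow.trans (le_abs_self _)) (abs_nonneg _)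
        _ = |fderiv ℝ u z q| := by rw [← abs_mul, h1, abs_neg]
        _ ≤ _ := (fderiv ℝ u z).le_opNorm q
    rw [le_div_iff₀ hκ]
    refine le_of_mul_le_mul_right ?_ hpos
    linarith
  rw [dist_eq_norm]
  calc ‖v‖ ≤ ‖b.repr v 0 • b 0‖ + ‖q‖ := by
        conv_lhs => rw [hdec]
        exact norm_add_le _ _
    _ ≤ ‖q‖ / κ + ‖q‖ := by
        rw [norm_smul, b.norm_eq_one, mul_one]
        exact add_le_add_left ha _
    _ = ‖q‖ * (1 + 1 / κ) := by ring
    _ ≤ m * Δ * (1 + 1 / κ) := by gcongr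
    _ = _ := by ring

/-- Replacing the first coordinate by `u` is a change of variables with Jacobian `∂u/∂b₀`. -/
lemma lintegral_image_level_chart (hO : Convex ℝ O)
    (hud : ∀ x ∈ O, DifferentiableAt ℝ u x)
    (hκ : 0 < κ) (hb : ∀ x ∈ O, 0 < ‖fderiv ℝ u x‖ ∧ κ * ‖fderiv ℝ u x‖ ≤ fderiv ℝ u x (b 0))
    {Q : Set (EuclideanSpace ℝ (Fin (m + 1)))} (hQ : MeasurableSet Q) (hQO : Q ⊆ O)
    (Γ : ℝ × (Fin m → ℝ) → ℝ≥0∞) :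
    ∫⁻ z in (fun x => (u x, (splitCoord b x).2)) '' Q, Γ z =
      ∫⁻ x in Q, ENNReal.ofReal (fderiv ℝ u x (b 0)) * Γ (u x, (splitCoord b x).2) := by
  set F : EuclideanSpace ℝ (Fin (m + 1)) → EuclideanSpace ℝ (Fin (m + 1)) :=
    fun x => x + (u x - ⟪b 0, x⟫) • b 0 with hF
  have hFs : ∀ x, splitCoord b (F x) = (u x, (splitCoord b x).2) := by
    intro x
    rw [splitCoord_apply, splitCoord_apply]
    refine Prod.ext ?_ (funext fun i => ?_)
    · simp [hF, OrthonormalBasis.repr_apply_apply]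
    · simp [hF, OrthonormalBasis.repr_apply_apply]
  have himg : (fun x => (u x, (splitCoord b x).2)) '' Q = splitCoord b '' (F '' Q) := by
    rw [image_image]
    exact image_congr fun x _ => (hFs x).symm
  have hinj : InjOn F Q := by
    intro x hx x' hx' hxx
    have h1 := congrArg (splitCoord b) hxx
    rw [hFs, hFs, Prod.mk.injEq] at h1
    have h2 := dist_le_mul_dist_of_level (b := b) hO hud hκ hb (hQO hx) (hQO hx') h1.1
    rw [h1.2, dist_self, mul_zero] at h2
    exact dist_le_zero.1 h2
  rw [himg, ← (measurePreserving_splitCoord b).setLIntegral_comp_emb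
    (splitCoord b).measurableEmbedding,
    lintegral_image_eq_lintegral_abs_det_fderiv_mul volume hQ
      (f' := fun x => ContinuousLinearMap.id ℝ _ +
        (fderiv ℝ u x - innerSL ℝ (b 0)).smulRight (b 0)) (fun x hx => ?_) hinj]
  · refine setLIntegral_congr_fun hQ fun x hx => ?_
    have hdet : (ContinuousLinearMap.id ℝ (EuclideanSpace ℝ (Fin (m + 1))) +
        (fderiv ℝ u x - innerSL ℝ (b 0)).smulRight (b 0)).det = fderiv ℝ u x (b 0) := by
      have h1 := LinearMap.transvection.det
        ((fderiv ℝ u x - innerSL ℝ (b 0)).toLinearMap) (b 0)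
      have h2 : (1 : ℝ) + (fderiv ℝ u x - innerSL ℝ (b 0)) (b 0) = fderiv ℝ u x (b 0) := by
        simp
      refine Eq.trans ?_ (h1.trans h2)
      rw [ContinuousLinearMap.det]
      congr 1
    simp only [hdet, hFs]
    rw [abs_of_nonneg]
    exact (mul_nonneg hκ.le (norm_nonneg _)).trans (hb x (hQO hx)).2
  · have h1 := ((hud x (hQO hx)).hasFDerivAt.sub (innerSL ℝ (b 0)).hasFDerivAt).smul_const (b 0)
    exact ((hasFDerivAt_id x).add h1).hasFDerivWithinAt

end Chart

/-- The distribution of a weight under `u`, on a piece of a chart, has a density which is comparable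
to the integral of `w / ‖∇u‖` over the level sets. -/
lemma exists_density_of_chart {m : ℕ}
    {b : OrthonormalBasis (Fin (m + 1)) ℝ (EuclideanSpace ℝ (Fin (m + 1)))}
    {u : EuclideanSpace ℝ (Fin (m + 1)) → ℝ} {O : Set (EuclideanSpace ℝ (Fin (m + 1)))} {κ : ℝ}
    (hu : Continuous u) (hO : Convex ℝ O)
    (hud : ∀ x ∈ O, DifferentiableAt ℝ u x) (hκ : 0 < κ)
    (hb : ∀ x ∈ O, 0 < ‖fderiv ℝ u x‖ ∧ κ * ‖fderiv ℝ u x‖ ≤ fderiv ℝ u x (b 0))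
    {w : EuclideanSpace ℝ (Fin (m + 1)) → ℝ} (hw : Measurable w) (hw0 : ∀ x, 0 ≤ w x)
    {P : Set (EuclideanSpace ℝ (Fin (m + 1)))} (hP : MeasurableSet P) (hPO : P ⊆ O) :
    ∃ J : ℝ → ℝ≥0∞, Measurable J ∧
      (∀ T, MeasurableSet T →
        ∫⁻ t in T, J t = ∫⁻ x in P ∩ u ⁻¹' T, ENNReal.ofReal (w x)) ∧
      (∀ t, J t ≤ ENNReal.ofReal (1 / κ) *
        ∫⁻ x in P ∩ u ⁻¹' {t}, ENNReal.ofReal (w x / ‖fderiv ℝ u x‖) ∂μH[m]) ∧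
      ∀ t, ∫⁻ x in P ∩ u ⁻¹' {t}, ENNReal.ofReal (w x / ‖fderiv ℝ u x‖) ∂μH[m] ≤
        ENNReal.ofReal (m * (1 + 1 / κ)) ^ (m : ℝ) * J t := by
  set π : EuclideanSpace ℝ (Fin (m + 1)) → (Fin m → ℝ) := fun x => (splitCoord b x).2 with hπ
  have hπlip : LipschitzWith 1 π := by
    refine LipschitzWith.of_dist_le_mul fun x y => ?_
    rw [NNReal.coe_one, one_mul, dist_pi_le_iff dist_nonneg]
    intro i
    change dist (b.repr x i.succ) (b.repr y i.succ) ≤ dist x y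
    rw [Real.dist_eq, ← PiLp.sub_apply, ← map_sub,
      dist_eq_norm, ← Real.norm_eq_abs, ← b.repr.norm_map]
    exact PiLp.norm_apply_le _ _
  set F : EuclideanSpace ℝ (Fin (m + 1)) → ℝ × (Fin m → ℝ) := fun x => (u x, π x) with hF
  have hFc : Continuous F := hu.prodMk hπlip.continuous
  have hinj : InjOn F P := by
    intro x hx x' hx' hxx
    rw [hF, Prod.mk.injEq] at hxx
    have h2 := dist_le_mul_dist_of_level (b := b) hO hud hκ hb (hPO hx) (hPO hx') hxx.1
    rw [show (splitCoord b x).2 = (splitCoord b x').2 from hxx.2, dist_self, mul_zero] at h2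
    exact dist_le_zero.1 h2
  set r : EuclideanSpace ℝ (Fin (m + 1)) → ℝ≥0∞ :=
    fun x => ENNReal.ofReal (w x / fderiv ℝ u x (b 0)) with hr
  have hrm : Measurable r :=
    (hw.div (measurable_fderiv_apply_const ℝ u (b 0))).ennreal_ofReal
  obtain ⟨Γ, hΓm, hΓ⟩ := (hFc.continuousOn.measurableEmbedding hP hinj).exists_measurable_extend
    (hrm.comp measurable_subtype_coe) (fun _ => ⟨0⟩)
  have hΓP : ∀ x ∈ P, Γ (u x, π x) = r x := fun x hx => congrFun hΓ ⟨x, hx⟩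
  have hFP : MeasurableSet (F '' P) := hP.image_of_continuousOn_injOn hFc.continuousOn hinj
  have hslice : ∀ t, Prod.mk t ⁻¹' (F '' P) = π '' (P ∩ u ⁻¹' {t}) := by
    intro t
    ext y
    constructor
    · rintro ⟨x, hx, hxy⟩
      rw [hF, Prod.mk.injEq] at hxy
      exact ⟨x, ⟨hx, hxy.1⟩, hxy.2⟩
    · rintro ⟨x, ⟨hx, hxt⟩, rfl⟩
      exact ⟨x, hx, Prod.ext hxt rfl⟩
  have hJ : ∀ t, ∫⁻ y, (F '' P).indicator Γ (t, y) =
      ∫⁻ y in π '' (P ∩ u ⁻¹' {t}), Γ (t, y) ∂μH[m] := by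
    intro t
    have h1 : (μH[m] : Measure (Fin m → ℝ)) = volume := by
      rw [← hausdorffMeasure_pi_real, Fintype.card_fin]
    rw [h1, ← hslice t, ← lintegral_indicator (measurable_prodMk_left hFP)]
    rfl
  have hslr : ∀ t, ∫⁻ x in P ∩ u ⁻¹' {t}, Γ (t, π x) ∂μH[m] =
      ∫⁻ x in P ∩ u ⁻¹' {t}, r x ∂μH[m] := fun t =>
    setLIntegral_congr_fun (hP.inter (hu.measurable (measurableSet_singleton t))) fun x hx => by
      rw [← hΓP x hx.1, show u x = t from hx.2]
  have hpos : ∀ x ∈ P, 0 < fderiv ℝ u x (b 0) := fun x hx =>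
    (mul_pos hκ (hb x (hPO hx)).1).trans_le (hb x (hPO hx)).2
  refine ⟨fun t => ∫⁻ y, (F '' P).indicator Γ (t, y),
    (hΓm.indicator hFP).lintegral_prod_right', fun T hT => ?_, fun t => ?_, fun t => ?_⟩
  · have hQ : MeasurableSet (P ∩ u ⁻¹' T) := hP.inter (hu.measurable hT)
    have h1 := lintegral_image_level_chart (b := b) hO hud hκ hb hQ (inter_subset_left.trans hPO) Γ
    have h2 : (fun x => (u x, (splitCoord b x).2)) '' (P ∩ u ⁻¹' T) =
        F '' P ∩ Prod.fst ⁻¹' T := by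
      ext z
      constructor
      · rintro ⟨x, ⟨hx, hxT⟩, rfl⟩
        exact ⟨⟨x, hx, rfl⟩, hxT⟩
      · rintro ⟨⟨x, hx, rfl⟩, hxT⟩
        exact ⟨x, ⟨hx, hxT⟩, rfl⟩
    have h3 : ∫⁻ t in T, ∫⁻ y, (F '' P).indicator Γ (t, y) =
        ∫⁻ z in F '' P ∩ Prod.fst ⁻¹' T, Γ z := by
      rw [← setLIntegral_indicator hFP, ← Set.prod_univ,
        Measure.volume_eq_prod, ← Measure.prod_restrict, Measure.restrict_univ,
        lintegral_prod _ (hΓm.indicator hFP).aemeasurable]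
    rw [h3, ← h2, h1]
    refine setLIntegral_congr_fun hQ fun x hx => ?_
    rw [show Γ (u x, (splitCoord b x).2) = r x from hΓP x hx.1, hr,
      ← ENNReal.ofReal_mul (hpos x hx.1).le, mul_div_cancel₀ _ (hpos x hx.1).ne']
  · beta_reduce
    rw [hJ]
    refine (lintegral_image_hausdorff_le hπlip m.cast_nonneg _
      (hΓm.comp measurable_prodMk_left)).trans ?_
    rw [ENNReal.coe_one, ENNReal.one_rpow, one_mul]
    simp only [Function.comp_apply]
    rw [hslr, ← lintegral_const_mul' _ _ ENNReal.ofReal_ne_top]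
    refine setLIntegral_mono' (hP.inter (hu.measurable (measurableSet_singleton t))) fun x hx => ?_
    rw [hr, ← ENNReal.ofReal_mul (by positivity)]
    refine ENNReal.ofReal_le_ofReal ?_
    rw [div_mul_div_comm, one_mul]
    exact div_le_div_of_nonneg_left (hw0 x) (mul_pos hκ (hb x (hPO hx.1)).1) (hb x (hPO hx.1)).2
  · have hC0 : 0 ≤ m * (1 + 1 / κ) := by positivity
    have h1 := lintegral_hausdorff_le_lintegral_image (A := P ∩ u ⁻¹' {t})
      hπlip.continuous.measurable (K := (m * (1 + 1 / κ)).toNNReal) (fun x hx x' hx' => by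
        rw [Real.coe_toNNReal _ hC0]
        exact dist_le_mul_dist_of_level hO hud hκ hb (hPO hx.1) (hPO hx'.1)
          ((show u x = t from hx.2).trans (show u x' = t from hx'.2).symm))
      m.cast_nonneg (hΓm.comp (measurable_prodMk_left (x := t)))
    beta_reduce
    rw [hJ]
    refine le_trans ?_ h1
    simp only [Function.comp_apply]
    rw [hslr]
    refine setLIntegral_mono' (hP.inter (hu.measurable (measurableSet_singleton t))) fun x hx => ?_
    refine ENNReal.ofReal_le_ofReal (div_le_div_of_nonneg_left (hw0 x) (hpos x hx.1) ?_)
    refine (le_abs_self _).trans (((fderiv ℝ u x).le_opNorm (b 0)).trans ?_)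
    rw [b.norm_eq_one, mul_one]

section Coarea

variable {m : ℕ} {u w : EuclideanSpace ℝ (Fin (m + 1)) → ℝ}
  {G : Set (EuclideanSpace ℝ (Fin (m + 1)))}

/-- Around a point where the gradient does not vanish, the direction of the gradient is, up to a
factor `κ < 1`, almost the direction of steepest ascent at all neighbouring points. -/
lemma exists_chart_ball (hG : IsOpen G) (hc : ContinuousOn (fderiv ℝ u) G) {κ : ℝ} (hκ1 : κ < 1)
    {x : EuclideanSpace ℝ (Fin (m + 1))} (hx : x ∈ G) (hx0 : fderiv ℝ u x ≠ 0) :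
    ∃ b : OrthonormalBasis (Fin (m + 1)) ℝ (EuclideanSpace ℝ (Fin (m + 1))), ∃ r > 0,
      ball x r ⊆ G ∧
      ∀ y ∈ ball x r, 0 < ‖fderiv ℝ u y‖ ∧ κ * ‖fderiv ℝ u y‖ ≤ fderiv ℝ u y (b 0) := by
  have hn : 0 < ‖gradient u x‖ := by
    rw [norm_gradient_eq]
    exact norm_pos_iff.2 hx0
  obtain ⟨b, hb⟩ := exists_orthonormalBasis_zero_eq (m := m) (e := ‖gradient u x‖⁻¹ • gradient u x)
    (by rw [norm_smul, norm_inv, norm_norm, inv_mul_cancel₀ hn.ne'])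
  have hbx : fderiv ℝ u x (b 0) = ‖fderiv ℝ u x‖ := by
    rw [hb, map_smul, ← inner_gradient_eq_fderiv, real_inner_self_eq_norm_sq, smul_eq_mul,
      ← norm_gradient_eq]
    field_simp
  have hcx : ContinuousAt (fderiv ℝ u) x := hc.continuousAt (hG.mem_nhds hx)
  have h1 : ∀ᶠ y in 𝓝 x, 0 < ‖fderiv ℝ u y‖ :=
    hcx.norm.eventually_const_lt (norm_pos_iff.2 hx0)
  have h2 : ∀ᶠ y in 𝓝 x, κ * ‖fderiv ℝ u y‖ < fderiv ℝ u y (b 0) := by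
    refine (hcx.norm.const_mul κ).eventually_lt (hcx.clm_apply continuousAt_const) ?_
    rw [hbx]
    exact mul_lt_of_lt_one_left (norm_pos_iff.2 hx0) hκ1
  obtain ⟨r, hr, hball⟩ := Metric.eventually_nhds_iff_ball.1 ((h1.and h2).and (hG.mem_nhds hx))
  exact ⟨b, r, hr, fun y hy => (hball y hy).2, fun y hy => ⟨(hball y hy).1.1, (hball y hy).1.2.le⟩⟩

/-- The distribution of a weight under `u`, away from the critical points, has a density which is
comparable to the integral of `w / ‖∇u‖` over the level sets. -/
lemma exists_density_of_lt_one (hu : Continuous u) (hG : IsOpen G)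
    (hud : ∀ x ∈ G, DifferentiableAt ℝ u x) (hc : ContinuousOn (fderiv ℝ u) G)
    (hw : Measurable w) (hw0 : ∀ x, 0 ≤ w x) {κ : ℝ} (hκ : 0 < κ) (hκ1 : κ < 1) :
    ∃ J : ℝ → ℝ≥0∞, Measurable J ∧
      (∀ T, MeasurableSet T → ∫⁻ t in T, J t =
        ∫⁻ x in {x ∈ G | fderiv ℝ u x ≠ 0} ∩ u ⁻¹' T, ENNReal.ofReal (w x)) ∧
      (∀ t, J t ≤ ENNReal.ofReal (1 / κ) * ∫⁻ x in {x ∈ G | fderiv ℝ u x ≠ 0} ∩ u ⁻¹' {t},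
        ENNReal.ofReal (w x / ‖fderiv ℝ u x‖) ∂μH[m]) ∧
      ∀ t, ∫⁻ x in {x ∈ G | fderiv ℝ u x ≠ 0} ∩ u ⁻¹' {t},
          ENNReal.ofReal (w x / ‖fderiv ℝ u x‖) ∂μH[m] ≤
        ENNReal.ofReal (m * (1 + 1 / κ)) ^ (m : ℝ) * J t := by
  set V : Set (EuclideanSpace ℝ (Fin (m + 1))) := {x ∈ G | fderiv ℝ u x ≠ 0} with hV
  have hVm : MeasurableSet V :=
    hG.measurableSet.inter (measurable_fderiv ℝ u (measurableSet_singleton 0).compl)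
  choose! b r hr hrG hb using fun (x : EuclideanSpace ℝ (Fin (m + 1))) (hx : x ∈ V) =>
    exists_chart_ball hG hc hκ1 hx.1 hx.2
  obtain ⟨s, hsV, hs, hcov⟩ := TopologicalSpace.countable_cover_nhdsWithin
    (f := fun x => ball x (r x)) fun x hx => mem_nhdsWithin_of_mem_nhds (ball_mem_nhds x (hr x hx))
  rcases s.eq_empty_or_nonempty with rfl | hne
  · have hVe : V = ∅ := by simpa using hcov
    exact ⟨0, measurable_zero, by simp [hVe], by simp, by simp [hVe]⟩
  obtain ⟨a, rfl⟩ := hs.exists_eq_range hne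
  have haV : ∀ n, a n ∈ V := fun n => hsV (mem_range_self n)
  rw [biUnion_range] at hcov
  set P : ℕ → Set (EuclideanSpace ℝ (Fin (m + 1))) :=
    fun n => V ∩ disjointed (fun k => ball (a k) (r (a k))) n with hP
  have hPm : ∀ n, MeasurableSet (P n) := fun n =>
    hVm.inter (MeasurableSet.disjointed (fun _ => measurableSet_ball) n)
  have hPd : Pairwise (Function.onFun Disjoint P) := fun i j hij =>
    (disjoint_disjointed _ hij).mono inter_subset_right inter_subset_right
  have hPU : ⋃ n, P n = V := by
    rw [hP, ← inter_iUnion, iUnion_disjointed]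
    exact inter_eq_left.2 hcov
  have hsum : ∀ (ν : Measure (EuclideanSpace ℝ (Fin (m + 1))))
      (g : EuclideanSpace ℝ (Fin (m + 1)) → ℝ≥0∞) (T : Set ℝ), MeasurableSet T →
      ∫⁻ x in V ∩ u ⁻¹' T, g x ∂ν = ∑' n, ∫⁻ x in P n ∩ u ⁻¹' T, g x ∂ν := by
    intro ν g T hT
    rw [← hPU, iUnion_inter]
    exact lintegral_iUnion (fun n => (hPm n).inter (hu.measurable hT))
      (fun i j hij => (hPd hij).mono inter_subset_left inter_subset_left) g
  choose J hJm hJT hJle hJge using fun n => exists_density_of_chart (b := b (a n))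
    (O := ball (a n) (r (a n))) hu (convex_ball _ _)
    (fun x hx => hud x (hrG _ (haV n) hx)) hκ (hb _ (haV n)) hw hw0 (hPm n)
    (inter_subset_right.trans (disjointed_subset _ n))
  refine ⟨fun t => ∑' n, J n t, Measurable.tsum hJm, fun T hT => ?_, fun t => ?_,
    fun t => ?_⟩
  · rw [lintegral_tsum fun n => (hJm n).aemeasurable, hsum _ _ _ hT]
    exact tsum_congr fun n => hJT n T hT
  · rw [hsum _ _ _ (measurableSet_singleton t), ← ENNReal.tsum_mul_left]
    exact ENNReal.tsum_le_tsum fun n => hJle n t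
  · rw [hsum _ _ _ (measurableSet_singleton t), ← ENNReal.tsum_mul_left]
    exact ENNReal.tsum_le_tsum fun n => hJge n t

/-- A form of the coarea formula: the distribution of an integrable weight under `u`, away from the
critical points, has a density bounded by the integral of `w / ‖∇u‖` over the level sets, and the
latter is finite for almost every level. -/
lemma exists_density_le_lintegral_level (hu : Continuous u) (hG : IsOpen G)
    (hud : ∀ x ∈ G, DifferentiableAt ℝ u x) (hc : ContinuousOn (fderiv ℝ u) G)
    (hw : Measurable w) (hw0 : ∀ x, 0 ≤ w x)
    (hwfin : ∫⁻ x in {x ∈ G | fderiv ℝ u x ≠ 0}, ENNReal.ofReal (w x) ≠ ∞) :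
    ∃ J : ℝ → ℝ≥0∞, Measurable J ∧ ∫⁻ t, J t ≠ ∞ ∧
      (∀ T, MeasurableSet T → ∫⁻ t in T, J t =
        ∫⁻ x in {x ∈ G | fderiv ℝ u x ≠ 0} ∩ u ⁻¹' T, ENNReal.ofReal (w x)) ∧
      ∀ᵐ t, J t ≤ ∫⁻ x in {x ∈ G | fderiv ℝ u x ≠ 0} ∩ u ⁻¹' {t},
          ENNReal.ofReal (w x / ‖fderiv ℝ u x‖) ∂μH[m] ∧
        ∫⁻ x in {x ∈ G | fderiv ℝ u x ≠ 0} ∩ u ⁻¹' {t},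
          ENNReal.ofReal (w x / ‖fderiv ℝ u x‖) ∂μH[m] ≠ ∞ := by
  have hκ : ∀ n : ℕ, 0 < 1 - 1 / ((n : ℝ) + 2) ∧ 1 - 1 / ((n : ℝ) + 2) < 1 := by
    intro n
    have h1 : (1 : ℝ) < n + 2 := by linarith [n.cast_nonneg (α := ℝ)]
    exact ⟨sub_pos.2 ((div_lt_one (by linarith)).2 h1), sub_lt_self _ (by positivity)⟩
  choose J hJm hJT hJle hJge using fun n =>
    exists_density_of_lt_one hu hG hud hc hw hw0 (hκ n).1 (hκ n).2
  have hfin : ∫⁻ t, J 0 t ≠ ∞ := by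
    have h1 := hJT 0 univ MeasurableSet.univ
    rw [Measure.restrict_univ, preimage_univ, inter_univ] at h1
    rwa [h1]
  have heq : ∀ᵐ t, ∀ n, J n t = J 0 t := by
    refine ae_all_iff.2 fun n => ?_
    refine ae_eq_of_forall_setLIntegral_eq_of_sigmaFinite (hJm n) (hJm 0) fun T hT _ => ?_
    rw [hJT n T hT, hJT 0 T hT]
  refine ⟨J 0, hJm 0, hfin, hJT 0, ?_⟩
  filter_upwards [heq, ae_lt_top (hJm 0) hfin] with t ht ht0
  refine ⟨?_, ((hJge 0 t).trans_lt (ENNReal.mul_lt_top (ENNReal.rpow_lt_top_of_nonneg m.cast_nonneg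
    ENNReal.ofReal_ne_top) ht0)).ne⟩
  have h1 : Filter.Tendsto (fun n : ℕ => 1 / (1 - 1 / ((n : ℝ) + 2))) Filter.atTop (𝓝 1) := by
    have h2 : Filter.Tendsto (fun n : ℕ => 1 / ((n : ℝ) + 2)) Filter.atTop (𝓝 0) := by
      refine ((tendsto_one_div_add_atTop_nhds_zero_nat (𝕜 := ℝ)).comp
        (Filter.tendsto_add_atTop_nat 1)).congr fun n => ?_
      simp only [Function.comp_apply, Nat.cast_add, Nat.cast_one]
      ring
    have h3 := (tendsto_const_nhds (x := (1 : ℝ))).div (tendsto_const_nhds.sub h2)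
      (by norm_num : (1 : ℝ) - 0 ≠ 0)
    rwa [sub_zero, div_one] at h3
  have h3 := (ENNReal.tendsto_ofReal h1)
  rw [ENNReal.ofReal_one] at h3
  have h4 := ENNReal.Tendsto.mul_const h3 (b := ∫⁻ x in {x ∈ G | fderiv ℝ u x ≠ 0} ∩ u ⁻¹' {t},
          ENNReal.ofReal (w x / ‖fderiv ℝ u x‖) ∂μH[m]) (Or.inl one_ne_zero)
  rw [one_mul] at h4
  exact ge_of_tendsto' h4 fun n => (ht n).symm.trans_le (hJle n t)

end Coarea

/-- The coarea bound for the restriction of a `C¹` function to an open set, the integral over the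
level sets being a Bochner integral. -/
lemma exists_density_le_integral_level {m : ℕ} {u w : EuclideanSpace ℝ (Fin (m + 1)) → ℝ}
    {G : Set (EuclideanSpace ℝ (Fin (m + 1)))} (hG : IsOpen G) {L : ℝ≥0}
    (hu : LipschitzOnWith L u G) (hu1 : ContDiffOn ℝ 1 u G) (hwc : ContinuousOn w G)
    (hw0 : ∀ x ∈ G, 0 ≤ w x) (hwfin : ∫⁻ x in G, ENNReal.ofReal (w x) ≠ ∞) :
    ∃ J : ℝ → ℝ≥0∞, Measurable J ∧ ∫⁻ t, J t ≠ ∞ ∧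
      (∀ T, MeasurableSet T → ∫⁻ t in T, J t =
        ∫⁻ x in {x | x ∈ G ∧ u x ∈ T ∧ gradient u x ≠ 0}, ENNReal.ofReal (w x)) ∧
      ∀ᵐ t, J t ≤ ENNReal.ofReal (∫ x in {x | x ∈ G ∧ u x = t ∧ gradient u x ≠ 0},
        w x / ‖gradient u x‖ ∂μH[m]) := by
  obtain ⟨v, hv, huv⟩ := hu.extend_real
  have hnear : ∀ x ∈ G, v =ᶠ[𝓝 x] u := fun x hx => by
    filter_upwards [hG.mem_nhds hx] with y hy using (huv hy).symm
  have hfd : ∀ x ∈ G, fderiv ℝ v x = fderiv ℝ u x := fun x hx => (hnear x hx).fderiv_eq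
  have hgr : ∀ x ∈ G, (fderiv ℝ v x ≠ 0 ↔ gradient u x ≠ 0) := fun x hx => by
    rw [hfd x hx, ← norm_ne_zero_iff, ← norm_gradient_eq, norm_ne_zero_iff]
  have hwm : Measurable (G.indicator w) := by
    rw [← Set.piecewise_eq_indicator]
    exact hwc.measurable_piecewise continuousOn_const hG.measurableSet
  have hset : ∀ T : Set ℝ, {x ∈ G | fderiv ℝ v x ≠ 0} ∩ v ⁻¹' T =
      {x | x ∈ G ∧ u x ∈ T ∧ gradient u x ≠ 0} := by
    intro T
    ext x
    constructor
    · rintro ⟨⟨hx, hx0⟩, hxT⟩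
      exact ⟨hx, by rw [huv hx]; exact hxT, (hgr x hx).1 hx0⟩
    · rintro ⟨hx, hxT, hx0⟩
      exact ⟨⟨hx, (hgr x hx).2 hx0⟩, by rw [huv hx] at hxT; exact hxT⟩
  have hVm : MeasurableSet {x ∈ G | fderiv ℝ v x ≠ 0} :=
    hG.measurableSet.inter (measurable_fderiv ℝ v (measurableSet_singleton 0).compl)
  have hm : ∀ T : Set ℝ, MeasurableSet T →
      MeasurableSet {x | x ∈ G ∧ u x ∈ T ∧ gradient u x ≠ 0} := fun T hT => by
    rw [← hset T]
    exact hVm.inter (hv.continuous.measurable hT)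
  obtain ⟨J, hJm, hJfin, hJT, hJle⟩ := exists_density_le_lintegral_level (u := v)
    (w := G.indicator w) hv.continuous hG
    (fun x hx => ((hu1.contDiffAt (hG.mem_nhds hx)).differentiableAt one_ne_zero).congr_of_eventuallyEq
      (hnear x hx))
    ((hu1.continuousOn_fderiv_of_isOpen hG le_rfl).congr hfd) hwm
    (fun x => indicator_nonneg hw0 x)
    (((setLIntegral_congr_fun hVm fun x hx => by rw [indicator_of_mem hx.1]).trans_le
      (lintegral_mono_set (sep_subset _ _))).trans_lt hwfin.lt_top).ne
  refine ⟨J, hJm, hJfin, fun T hT => ?_, ?_⟩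
  · rw [hJT T hT, hset T]
    exact setLIntegral_congr_fun (hm T hT) fun x hx => by rw [indicator_of_mem hx.1]
  · filter_upwards [hJle] with t ht
    have hmt := hm {t} (measurableSet_singleton t)
    have hmeas : AEStronglyMeasurable (fun x => w x / ‖gradient u x‖)
        ((μH[m] : Measure (EuclideanSpace ℝ (Fin (m + 1)))).restrict
          {x | x ∈ G ∧ u x ∈ ({t} : Set ℝ) ∧ gradient u x ≠ 0}) := by
      refine (hwm.div (measurable_gradient u).norm).aestronglyMeasurable.congr ?_
      filter_upwards [ae_restrict_mem hmt] with x hx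
      rw [Pi.div_apply, indicator_of_mem hx.1]
    have hnn : 0 ≤ᵐ[(μH[m] : Measure (EuclideanSpace ℝ (Fin (m + 1)))).restrict
        {x | x ∈ G ∧ u x ∈ ({t} : Set ℝ) ∧ gradient u x ≠ 0}] fun x => w x / ‖gradient u x‖ := by
      filter_upwards [ae_restrict_mem hmt] with x hx
      exact div_nonneg (hw0 x hx.1) (norm_nonneg _)
    have heq : ∫⁻ x in {x ∈ G | fderiv ℝ v x ≠ 0} ∩ v ⁻¹' {t},
          ENNReal.ofReal (G.indicator w x / ‖fderiv ℝ v x‖) ∂μH[m] =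
        ∫⁻ x in {x | x ∈ G ∧ u x ∈ ({t} : Set ℝ) ∧ gradient u x ≠ 0},
          ENNReal.ofReal (w x / ‖gradient u x‖) ∂μH[m] := by
      rw [hset {t}]
      exact setLIntegral_congr_fun hmt fun x hx => by
        rw [indicator_of_mem hx.1, hfd x hx.1, norm_gradient_eq]
    rw [heq] at ht
    refine ht.1.trans_eq ?_
    rw [← ENNReal.ofReal_toReal ht.2, ← integral_eq_lintegral_of_nonneg_ae hnn hmeas]
    rfl

/-- One-sided Lebesgue differentiation for nonnegative functions on the line. -/
lemma ae_tendsto_setLIntegral_Ioo_div {J : ℝ → ℝ≥0∞} (hJ : Measurable J) (hfin : ∫⁻ t, J t ≠ ∞) :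
    ∀ᵐ t, Filter.Tendsto (fun n : ℕ => (∫⁻ s in Ioo t (t + 1 / ((n : ℝ) + 1)), J s) /
      ENNReal.ofReal (1 / ((n : ℝ) + 1))) Filter.atTop (𝓝 (J t)) := by
  filter_upwards [(IsUnifLocDoublingMeasure.vitaliFamily (volume : Measure ℝ) 1).ae_tendsto_lintegral_div
    hJ.aemeasurable hfin] with t ht
  have h1 : Filter.Tendsto (fun n : ℕ => t + 1 / ((n : ℝ) + 1)) Filter.atTop (𝓝[>] t) := by
    refine tendsto_nhdsWithin_iff.2 ⟨?_, Filter.Eventually.of_forall fun n =>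
      lt_add_of_pos_right t (by positivity)⟩
    simpa using (tendsto_const_nhds (x := t)).add (tendsto_one_div_add_atTop_nhds_zero_nat (𝕜 := ℝ))
  refine (ht.comp ((Real.tendsto_Icc_vitaliFamily_right t).comp h1)).congr fun n => ?_
  simp only [Function.comp_apply]
  rw [Real.volume_Icc, add_sub_cancel_left, restrict_Ioo_eq_restrict_Icc]

/-- Dividing a slab estimate by the height of the slab. -/
lemma mul_le_rpow_mul_rpow_div {h I A m q : ℝ≥0∞} {a b : ℝ} (h0 : h ≠ 0) (ht : h ≠ ∞)
    (ha : 0 ≤ a) (hb : 0 ≤ b) (hab : a + b = 1) (hle : A * (h * m) ≤ (h * I) ^ a * q ^ b) :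
    A * m ≤ I ^ a * (q / h) ^ b := by
  have h1 : (h * I) ^ a * q ^ b = h * (I ^ a * (q / h) ^ b) := by
    conv_lhs => rw [← ENNReal.mul_div_cancel h0 ht (b := q)]
    rw [ENNReal.mul_rpow_of_nonneg _ _ ha, ENNReal.mul_rpow_of_nonneg _ _ hb]
    calc h ^ a * I ^ a * (h ^ b * (q / h) ^ b) = (h ^ a * h ^ b) * (I ^ a * (q / h) ^ b) := by ring
      _ = h * (I ^ a * (q / h) ^ b) := by
        rw [← ENNReal.rpow_add _ _ h0 ht, hab, ENNReal.rpow_one]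
  rw [h1, mul_left_comm] at hle
  exact (ENNReal.mul_le_mul_iff_right h0 ht).1 hle

lemma tendsto_measure_superlevel {α : Type*} [MeasurableSpace α] (ν : Measure α) (G : Set α)
    (u : α → ℝ) (t : ℝ) :
    Filter.Tendsto (fun n : ℕ => ν {x | x ∈ G ∧ t + 1 / ((n : ℝ) + 1) < u x}) Filter.atTop
      (𝓝 (ν {x | x ∈ G ∧ t < u x})) := by
  have h1 : {x | x ∈ G ∧ t < u x} = ⋃ n : ℕ, {x | x ∈ G ∧ t + 1 / ((n : ℝ) + 1) < u x} := by
    ext x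
    rw [mem_iUnion]
    constructor
    · rintro ⟨hx, hxt⟩
      obtain ⟨n, hn⟩ := exists_nat_one_div_lt (sub_pos.2 hxt)
      exact ⟨n, hx, by linarith⟩
    · rintro ⟨n, hx, hn⟩
      exact ⟨hx, (lt_add_of_pos_right t (by positivity)).trans hn⟩
  rw [h1]
  refine tendsto_measure_iUnion_atTop fun i j hij x hx => ⟨hx.1, lt_of_le_of_lt ?_ hx.2⟩
  gcongr

/-- Hölder-isoperimetric-type inequality on almost every level set
(item (ii) of Lemma 5.1 of the paper). -/
theorem holder_isoperimetric_inequality_on_level_sets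
    {N : ℕ} (hN : 2 ≤ N) (p : ℝ) (hp : 1 < p)
    (H : EuclideanSpace ℝ (Fin N) → ℝ)
    (hH : IsAnisoNorm H) (hHell : UniformlyElliptic H)
    (S : Set (EuclideanSpace ℝ (Fin N))) (hS : IsOpenConvexCone S)
    (R : ℝ) (hR : 0 < R)
    (Ω : Set (EuclideanSpace ℝ (Fin N))) (hΩ : Ω = {x | dualNorm H x < R})
    (lam : ℝ) (hlam : 0 ≤ lam) (w : EuclideanSpace ℝ (Fin N) → ℝ)
    (hwc : ContinuousOn w (closure S))
    (hwnn : ∀ x ∈ closure S, 0 ≤ w x)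
    (hwhom : ∀ x ∈ closure S, ∀ t : ℝ, 0 < t → w (t • x) = t ^ lam * w x)
    (hwconc : 0 < lam → ConcaveOn ℝ S (fun x => w x ^ (1 / lam)))
    (hwlip : ∀ x ∈ S, ∃ K : ℝ≥0, ∃ ε > 0, LipschitzOnWith K w (Metric.ball x ε ∩ S))
    (f : ℝ → ℝ) (hfm : Measurable f) (hf0 : ∀ s, 0 ≤ s → 0 ≤ f s)
    (hfb : ∀ b : ℝ, 0 ≤ b → ∃ C, ∀ s ∈ Icc (0:ℝ) b, f s ≤ C)
    (u : EuclideanSpace ℝ (Fin N) → ℝ)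
    (hunn : ∀ x ∈ S ∩ Ω, 0 ≤ u x)
    (hulip : ∃ L : ℝ≥0, LipschitzOnWith L u (S ∩ Ω))
    (hu1 : ContDiffOn ℝ 1 u ((S ∩ Ω) ∪ (S ∩ frontier Ω) ∪ ((frontier S ∩ Ω) \ {0})))
    (hu0 : ∀ x ∈ S ∩ frontier Ω, u x = 0)
    (hweak : ∀ φ : EuclideanSpace ℝ (Fin N) → ℝ,
      ContDiff ℝ (⊤ : ℕ∞) φ → HasCompactSupport φ →
      (∃ U, IsOpen U ∧ closure (S ∩ frontier Ω) ⊆ U ∧ ∀ x ∈ U, φ x = 0) →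
      ∫ x in S ∩ Ω, w x * ⟪aField H p u x, gradient φ x⟫ =
        ∫ x in S ∩ Ω, f (u x) * φ x * w x)
    (D : ℝ) (hD : D = (N : ℝ) + lam)
    (M : ℝ) (hM : M = sSup (u '' (S ∩ Ω)))
    (I μf : ℝ → ℝ)
    (hI : I = fun t => ∫ x in {x | x ∈ S ∩ Ω ∧ t < u x}, f (u x) * w x)
    (hμ : μf = fun t => ∫ x in {x | x ∈ S ∩ Ω ∧ t < u x}, w x)
    (c : ℝ)
    (hc : c = (periW (dualNorm H) w {y | dualNorm H y < 1} S).toReal /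
      (∫ x in S ∩ {y | dualNorm H y < 1}, w x) ^ ((D - 1) / D)) :
    ∀ᵐ t ∂(volume.restrict (Ioo (0:ℝ) M)),
      I t ^ (1 / p) *
          (∫ x in {x | x ∈ S ∩ Ω ∧ u x = t ∧ gradient u x ≠ 0},
            w x / ‖gradient u x‖ ∂μH[(N : ℝ) - 1]) ^ ((p - 1) / p) ≥
        c * μf t ^ ((D - 1) / D) := by
  obtain ⟨m, rfl⟩ : ∃ m, N = m + 1 := ⟨N - 1, by omega⟩
  obtain ⟨L, hu⟩ := hulip
  have hN0 : 0 < m + 1 := m.succ_pos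
  have hcw := IsConeWeight.of_concave hS hlam hwc hwnn hwhom hwconc
  have hK := hH.dual hN0
  have hΩo : IsOpen Ω := hΩ ▸ hK.isOpen_ball R
  have hΩb : Bornology.IsBounded Ω := hΩ ▸ hK.isBounded_ball R
  have hG : IsOpen (S ∩ Ω) := hS.1.inter hΩo
  have hGS : S ∩ Ω ⊆ closure S := inter_subset_left.trans subset_closure
  have hu1G : ContDiffOn ℝ 1 u (S ∩ Ω) :=
    hu1.mono (subset_union_left.trans subset_union_left)
  have hD1 : 1 < D := by
    have : (2 : ℝ) ≤ ((m + 1 : ℕ) : ℝ) := by exact_mod_cast hN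
    linarith
  have hp0 : 0 < p := by linarith
  have hwfin : ∫⁻ x in S ∩ Ω, ENNReal.ofReal (w x) ≠ ∞ := by
    rw [← hcw.coneMeasure_apply hΩo.measurableSet]
    exact (hcw.coneMeasure_lt_top hΩb).ne
  obtain ⟨J, hJm, hJfin, hJT, hJle⟩ := exists_density_le_integral_level hG hu hu1G
    (hwc.mono hGS) (fun x hx => hwnn x (hGS hx)) hwfin
  set b := (coneMeasure S w {y | dualNorm H y < 1}).toReal with hb
  have hb0 : 0 ≤ b := ENNReal.toReal_nonneg
  have hA0 : 0 ≤ D * b ^ (1 / D) := mul_nonneg (by linarith) (Real.rpow_nonneg hb0 _)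
  have hcA : c ≤ D * b ^ (1 / D) := by
    have hB : MeasurableSet {y : EuclideanSpace ℝ (Fin (m + 1)) | dualNorm H y < 1} :=
      (hK.isOpen_ball 1).measurableSet
    rw [hc, hcw.integral_eq hB, ← hb]
    rcases hb0.eq_or_lt with h0 | h0
    · rw [← h0, Real.zero_rpow (div_pos (by linarith) (by linarith)).ne', div_zero]
      rwa [← h0] at hA0
    · rw [div_le_iff₀ (Real.rpow_pos_of_pos h0 _), mul_assoc, ← Real.rpow_add h0,
        show 1 / D + (D - 1) / D = 1 by field_simp; ring, Real.rpow_one, hD]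
      exact periW_toReal_le hN0 hcw hK
  have hmeas : ∀ t, MeasurableSet {x | x ∈ S ∩ Ω ∧ t < u x} := fun t =>
    (hu.continuousOn.isOpen_inter_preimage hG isOpen_Ioi).measurableSet
  have hμt : ∀ t, μf t = (coneMeasure S w {x | x ∈ S ∩ Ω ∧ t < u x}).toReal := by
    intro t
    have hsub : {x | x ∈ S ∩ Ω ∧ t < u x} ⊆ S := fun x hx => hx.1.1
    rw [hμ, ← hcw.integral_eq (hmeas t), inter_eq_right.2 hsub]
  have hI0 : ∀ t, 0 ≤ I t := by
    intro t
    rw [hI]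
    exact setIntegral_nonneg (hmeas t) fun x hx =>
      mul_nonneg (hf0 _ (hunn x hx.1)) (hwnn x (hGS hx.1))
  have hexp : 0 ≤ (p - 1) / p := div_nonneg (by linarith) hp0.le
  have hexpD : 0 ≤ (D - 1) / D := div_nonneg (by linarith) (by linarith)
  rw [show ((m + 1 : ℕ) : ℝ) - 1 = m by push_cast; ring]
  filter_upwards [ae_restrict_mem measurableSet_Ioo, ae_restrict_of_ae hJle,
    ae_restrict_of_ae (ae_tendsto_setLIntegral_Ioo_div hJm hJfin)] with t htM hJt hlim
  have hslab : ∀ n : ℕ, ENNReal.ofReal (D * b ^ (1 / D)) * ENNReal.ofReal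
      ((coneMeasure S w {x | x ∈ S ∩ Ω ∧ t + 1 / ((n : ℝ) + 1) < u x}).toReal ^ ((D - 1) / D)) ≤
      ENNReal.ofReal (I t) ^ (1 / p) * ((∫⁻ s in Ioo t (t + 1 / ((n : ℝ) + 1)), J s) /
        ENNReal.ofReal (1 / ((n : ℝ) + 1))) ^ ((p - 1) / p) := by
    intro n
    have hh : 0 < 1 / ((n : ℝ) + 1) := by positivity
    refine mul_le_rpow_mul_rpow_div (ENNReal.ofReal_pos.2 hh).ne' ENNReal.ofReal_ne_top
      (by positivity) hexp (by field_simp; ring) ?_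
    have h1 := hcw.holder_isoperimetric_slab hN0 hD hD1 hp hH hHell hΩ hfm hf0 hfb hunn hu
      (hu1.continuousOn.mono subset_union_left) hu0 hweak htM.1 hh
    have hset : MeasurableSet {x | x ∈ S ∩ Ω ∧ (t < u x ∧ u x < t + 1 / ((n : ℝ) + 1)) ∧
        gradient u x ≠ 0} := by
      have h2 := (hu.continuousOn.isOpen_inter_preimage hG
        (isOpen_Ioo (a := t) (b := t + 1 / ((n : ℝ) + 1)))).measurableSet.inter
        (measurable_gradient u (measurableSet_singleton 0).compl)
      convert h2 using 1
      ext x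
      exact and_assoc.symm
    have hsub : {x | x ∈ S ∩ Ω ∧ (t < u x ∧ u x < t + 1 / ((n : ℝ) + 1)) ∧ gradient u x ≠ 0} ⊆ S :=
      fun x hx => hx.1.1
    rw [hcw.coneMeasure_apply hset, inter_eq_right.2 hsub, ENNReal.ofReal_mul hh.le] at h1
    rw [hJT _ measurableSet_Ioo, hI]
    exact h1
  have hfinG : ∀ s, coneMeasure S w {x | x ∈ S ∩ Ω ∧ s < u x} ≠ ∞ := fun s =>
    (hcw.coneMeasure_lt_top (hΩb.subset fun x hx => hx.1.2)).ne
  have hlimL : Filter.Tendsto (fun n : ℕ => ENNReal.ofReal (D * b ^ (1 / D)) * ENNReal.ofReal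
      ((coneMeasure S w {x | x ∈ S ∩ Ω ∧ t + 1 / ((n : ℝ) + 1) < u x}).toReal ^ ((D - 1) / D)))
      Filter.atTop (𝓝 (ENNReal.ofReal (D * b ^ (1 / D)) *
        ENNReal.ofReal (μf t ^ ((D - 1) / D)))) := by
    refine ENNReal.Tendsto.const_mul (ENNReal.tendsto_ofReal ?_) (Or.inr ENNReal.ofReal_ne_top)
    rw [hμt]
    exact ((ENNReal.tendsto_toReal (hfinG t)).comp
      (tendsto_measure_superlevel _ _ u t)).rpow_const (Or.inr hexpD)
  have hlimR := ENNReal.Tendsto.const_mul (a := ENNReal.ofReal (I t) ^ (1 / p))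
    (hlim.ennrpow_const ((p - 1) / p))
    (Or.inr (ENNReal.rpow_ne_top_of_nonneg (by positivity) ENNReal.ofReal_ne_top))
  have hfinal := (le_of_tendsto_of_tendsto' hlimL hlimR hslab).trans
    (mul_le_mul_right (ENNReal.rpow_le_rpow hJt hexp) _)
  have hμ0 : 0 ≤ μf t ^ ((D - 1) / D) := by
    rw [hμt]
    exact Real.rpow_nonneg ENNReal.toReal_nonneg _
  have hΦ0 : 0 ≤ ∫ x in {x | x ∈ S ∩ Ω ∧ u x = t ∧ gradient u x ≠ 0},
      w x / ‖gradient u x‖ ∂μH[m] := by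
    have hset : MeasurableSet {x | x ∈ S ∩ Ω ∧ u x = t ∧ gradient u x ≠ 0} := by
      have h1 := (hG.measurableSet.diff (hu.continuousOn.isOpen_inter_preimage hG
        (isOpen_compl_singleton (x := t))).measurableSet).inter
        (measurable_gradient u (measurableSet_singleton 0).compl)
      convert h1 using 1
      ext x
      simp only [mem_inter_iff, mem_sdiff, mem_preimage, mem_compl_iff, mem_singleton_iff,
        mem_ofPred_eq]
      tauto
    exact setIntegral_nonneg hset fun x hx => div_nonneg (hwnn x (hGS hx.1)) (norm_nonneg _)
  rw [ENNReal.ofReal_rpow_of_nonneg (hI0 t) (by positivity), ENNReal.ofReal_rpow_of_nonneg hΦ0 hexp,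
    ← ENNReal.ofReal_mul hA0, ← ENNReal.ofReal_mul (Real.rpow_nonneg (hI0 t) _),
    ENNReal.ofReal_le_ofReal_iff (mul_nonneg (Real.rpow_nonneg (hI0 t) _)
      (Real.rpow_nonneg hΦ0 _))] at hfinal
  exact (mul_le_mul_of_nonneg_right hcA hμ0).trans hfinal
end
end

section
/- Let A ⊆ ℝ^N be an open bounded set and let u : A → ℝ be Lipschitz and continuously differentiable on A. Then for almost every t ∈ ℝ (with respect to Lebesgue measure on ℝ), the set {x ∈ A : u(x) = t and ∇u(x) = 0} has zero (N−1)-dimensional Hausdorff measure. -/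
open MeasureTheory Set Metric
open scoped ENNReal NNReal RealInnerProductSpace Topology Classical

noncomputable section

/-- The part of `K` whose points `x` satisfy `⌊x i * n⌋ = k i` for all `i`. -/
def gridCell {N : ℕ} (K : Set (EuclideanSpace ℝ (Fin N))) (n : ℕ) (k : Fin N → ℤ) :
    Set (EuclideanSpace ℝ (Fin N)) :=
  {x | x ∈ K ∧ ∀ i, ⌊x i * n⌋ = k i}

lemma dist_le_of_mem_gridCell {N : ℕ} {K : Set (EuclideanSpace ℝ (Fin N))} {n : ℕ} (hn : 0 < n)
    {k : Fin N → ℤ} {x y : EuclideanSpace ℝ (Fin N)}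
    (hx : x ∈ gridCell K n k) (hy : y ∈ gridCell K n k) :
    dist x y ≤ √N / n := by
  have hn' : (0 : ℝ) < n := by exact_mod_cast hn
  have hcoord (i : Fin N) : dist (x i) (y i) ^ 2 ≤ (1 / (n : ℝ)) ^ 2 := by
    have h := Int.abs_sub_lt_one_of_floor_eq_floor ((hx.2 i).trans (hy.2 i).symm)
    rw [← sub_mul, abs_mul, abs_of_pos hn'] at h
    gcongr
    rw [Real.dist_eq, le_div_iff₀ hn']
    exact h.le
  rw [EuclideanSpace.dist_eq]
  calc √(∑ i, dist (x i) (y i) ^ 2) ≤ √(N * (1 / (n : ℝ)) ^ 2) := by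
        gcongr
        simpa using Finset.sum_le_sum fun i (_ : i ∈ Finset.univ) => hcoord i
    _ = √N / n := by
        rw [Real.sqrt_mul (by positivity), Real.sqrt_sq (by positivity), mul_one_div]

lemma subset_iUnion_gridCell {N : ℕ} {K : Set (EuclideanSpace ℝ (Fin N))} {R : ℕ}
    (hR : ∀ x ∈ K, ‖x‖ ≤ R) (n : ℕ) :
    K ⊆ ⋃ k : Fin N → Finset.Icc (-(R * n : ℤ)) (R * n), gridCell K n fun i => k i := by
  intro x hx
  have hcoord (i : Fin N) : |x i| ≤ R :=
    (Real.norm_eq_abs _ ▸ PiLp.norm_apply_le x i).trans (hR x hx)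
  refine mem_iUnion.2 ⟨fun i => ⟨⌊x i * n⌋, Finset.mem_Icc.2 ⟨?_, ?_⟩⟩, hx, fun i => rfl⟩
  · rw [Int.le_floor]
    push_cast
    rw [← neg_mul]
    exact mul_le_mul_of_nonneg_right (abs_le.1 (hcoord i)).1 (by positivity)
  · have h : x i * n ≤ ((R * n : ℤ) : ℝ) := by
      push_cast
      exact mul_le_mul_of_nonneg_right (abs_le.1 (hcoord i)).2 (by positivity)
    exact Int.cast_le.1 ((Int.floor_le _).trans h)

lemma card_gridCell_index_le (N R : ℕ) {n : ℕ} (hn : 0 < n) :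
    Fintype.card (Fin N → Finset.Icc (-(R * n : ℤ)) (R * n)) ≤ ((2 * R + 1) * n) ^ N := by
  rw [Fintype.card_fun, Fintype.card_fin, Fintype.card_coe, Int.card_Icc]
  gcongr
  have : ((R * n : ℤ) + 1 - -(R * n)).toNat = 2 * (R * n) + 1 := by
    have : (R * n : ℤ) = ((R * n : ℕ) : ℤ) := by push_cast; rfl
    omega
  rw [this]
  nlinarith

/-- If the local Lipschitz constant of `u` on a bounded set `K` tends to zero uniformly at small
scales, then almost every level set of `u` in `K` is `H^{N-1}`-negligible. -/
theorem ae_hausdorffMeasure_levelSet_eq_zero {N : ℕ} (hN : 1 ≤ N)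
    {K : Set (EuclideanSpace ℝ (Fin N))} (hK : Bornology.IsBounded K)
    {u : EuclideanSpace ℝ (Fin N) → ℝ}
    (hu : ∀ ε > 0, ∃ δ > 0, ∀ x ∈ K, ∀ y ∈ K, dist x y < δ → dist (u x) (u y) ≤ ε * dist x y) :
    ∀ᵐ t : ℝ, μH[(N : ℝ) - 1] {x | x ∈ K ∧ u x = t} = 0 := by
  obtain ⟨R, hR⟩ : ∃ R : ℕ, ∀ x ∈ K, ‖x‖ ≤ R := by
    obtain ⟨C, hC⟩ := hK.exists_norm_le
    exact ⟨⌈C⌉₊, fun x hx => (hC x hx).trans (Nat.le_ceil C)⟩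
  have hscale (m : ℕ) : ∃ n : ℕ, m < n ∧ ∀ x ∈ K, ∀ y ∈ K, dist x y ≤ √N / n →
      dist (u x) (u y) ≤ 1 / ((m : ℝ) + 1) * (√N / n) := by
    obtain ⟨δ, hδ, h⟩ := hu (1 / ((m : ℝ) + 1)) (by positivity)
    obtain ⟨n, hmn, hn⟩ := ((Filter.eventually_gt_atTop m).and
      ((tendsto_const_div_atTop_nhds_zero_nat √N).eventually_lt_const hδ)).exists
    refine ⟨n, hmn, fun x hx y hy hxy => (h x hx y hy (hxy.trans_lt hn)).trans ?_⟩
    gcongr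
  choose n hmn hn using hscale
  have hn0 (m : ℕ) : 0 < n m := (Nat.zero_le m).trans_lt (hmn m)
  have hd : (0 : ℝ) ≤ (N : ℝ) - 1 := sub_nonneg.2 (by exact_mod_cast hN)
  let r (m : ℕ) : ℝ := √N / n m
  have hr0 (m : ℕ) : 0 ≤ r m := by positivity
  have hr : Filter.Tendsto r Filter.atTop (𝓝 0) :=
    (tendsto_const_div_atTop_nhds_zero_nat √N).comp
      (Filter.tendsto_atTop_mono (fun m => (hmn m).le) Filter.tendsto_id)
  let ι (m : ℕ) : Type := Fin N → Finset.Icc (-(R * n m : ℤ)) (R * n m)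
  let Q (m : ℕ) (k : ι m) : Set (EuclideanSpace ℝ (Fin N)) := gridCell K (n m) fun i => k i
  have hQ (m : ℕ) (k : ι m) : ediam (Q m k) ≤ ENNReal.ofReal (r m) :=
    ediam_le fun x hx y hy => by
      rw [edist_dist]
      exact ENNReal.ofReal_le_ofReal (dist_le_of_mem_gridCell (hn0 m) hx hy)
  let I (m : ℕ) (k : ι m) : Set ℝ := toMeasurable volume (u '' Q m k)
  have hI (m : ℕ) (k : ι m) : volume (I m k) ≤ ENNReal.ofReal (1 / ((m : ℝ) + 1) * r m) := by
    rw [measure_toMeasurable]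
    refine (Real.volume_le_diam _).trans (ediam_le ?_)
    rintro _ ⟨x, hx, rfl⟩ _ ⟨y, hy, rfl⟩
    rw [edist_dist]
    exact ENNReal.ofReal_le_ofReal
      (hn m x hx.1 y hy.1 (dist_le_of_mem_gridCell (hn0 m) hx hy))
  let g (m : ℕ) (t : ℝ) : ℝ≥0∞ :=
    ∑ k : ι m, (I m k).indicator (fun _ => ENNReal.ofReal (r m) ^ ((N : ℝ) - 1)) t
  have hg (m : ℕ) : Measurable (g m) := Finset.measurable_sum _ fun k _ =>
    measurable_const.indicator (measurableSet_toMeasurable _ _)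
  have hg_int (m : ℕ) :
      ∫⁻ t, g m t ≤ ENNReal.ofReal (((2 * R + 1) * √N) ^ N * (1 / ((m : ℝ) + 1))) := by
    have hnm : (0 : ℝ) < n m := by exact_mod_cast hn0 m
    have hcard : (Fintype.card (ι m) : ℝ) ≤ ((2 * R + 1) * n m) ^ N := by
      exact_mod_cast card_gridCell_index_le N R (hn0 m)
    rw [lintegral_finsetSum _ fun k _ =>
      measurable_const.indicator (measurableSet_toMeasurable _ _)]
    calc ∑ k : ι m, ∫⁻ t, (I m k).indicator (fun _ => ENNReal.ofReal (r m) ^ ((N : ℝ) - 1)) t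
        ≤ ∑ _k : ι m, ENNReal.ofReal (r m) ^ ((N : ℝ) - 1) *
            ENNReal.ofReal (1 / ((m : ℝ) + 1) * r m) := by
          gcongr with k
          rw [lintegral_indicator_const (measurableSet_toMeasurable _ _)]
          gcongr
          exact hI m k
      _ = ENNReal.ofReal (Fintype.card (ι m) * (r m ^ (N - 1) * (1 / ((m : ℝ) + 1) * r m))) := by
          rw [Finset.sum_const, Finset.card_univ, nsmul_eq_mul,
            ENNReal.ofReal_mul (Nat.cast_nonneg _), ENNReal.ofReal_natCast,
            ENNReal.ofReal_mul (p := r m ^ (N - 1)) (pow_nonneg (hr0 m) _),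
            ENNReal.ofReal_pow (hr0 m), ← ENNReal.rpow_natCast, Nat.cast_sub hN, Nat.cast_one]
      _ ≤ ENNReal.ofReal (((2 * R + 1) * √N) ^ N * (1 / ((m : ℝ) + 1))) := by
          apply ENNReal.ofReal_le_ofReal
          calc Fintype.card (ι m) * (r m ^ (N - 1) * (1 / ((m : ℝ) + 1) * r m))
              = Fintype.card (ι m) * r m ^ N * (1 / ((m : ℝ) + 1)) := by
                rw [← pow_sub_one_mul (by omega : N ≠ 0) (r m)]; ring
            _ ≤ ((2 * R + 1) * n m) ^ N * r m ^ N * (1 / ((m : ℝ) + 1)) := by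
                have := pow_nonneg (hr0 m) N
                gcongr
            _ = ((2 * R + 1) * √N) ^ N * (1 / ((m : ℝ) + 1)) := by
                rw [← mul_pow, mul_assoc _ _ (r m), mul_div_cancel₀ _ hnm.ne']
  have hlim : Filter.Tendsto (fun m => ∫⁻ t, g m t) Filter.atTop (𝓝 0) := by
    refine tendsto_of_tendsto_of_tendsto_of_le_of_le tendsto_const_nhds ?_
      (fun _ => zero_le) hg_int
    simpa using ENNReal.tendsto_ofReal
      (tendsto_one_div_add_atTop_nhds_zero_nat.const_mul (((2 * R + 1) * √N) ^ N))
  have hfatou : ∫⁻ t, Filter.liminf (fun m => g m t) Filter.atTop = 0 :=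
    nonpos_iff_eq_zero.1 ((lintegral_liminf_le hg).trans hlim.liminf_eq.le)
  rw [lintegral_eq_zero_iff (Measurable.liminf hg)] at hfatou
  filter_upwards [hfatou] with t ht
  refine nonpos_iff_eq_zero.1 (le_trans ?_ ht.le)
  have hr' : Filter.Tendsto (fun m => ENNReal.ofReal (r m)) Filter.atTop (𝓝 0) := by
    simpa using ENNReal.tendsto_ofReal hr
  refine (Measure.hausdorffMeasure_le_liminf_sum (ι := fun m => {k : ι m // t ∈ I m k})
    ((N : ℝ) - 1) _ _ hr' (fun m k => Q m k.1) (.of_forall fun m k => hQ m k.1)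
    (.of_forall fun m x hx => ?_)).trans (Filter.liminf_le_liminf (.of_forall fun m => ?_))
  · obtain ⟨k, hk⟩ := mem_iUnion.1 (subset_iUnion_gridCell hR (n m) hx.1)
    exact mem_iUnion.2 ⟨⟨k, subset_toMeasurable _ _ ⟨x, hk, hx.2⟩⟩, hk⟩
  · calc ∑ k : {k : ι m // t ∈ I m k}, ediam (Q m k.1) ^ ((N : ℝ) - 1)
        ≤ ∑ k : {k : ι m // t ∈ I m k}, ENNReal.ofReal (r m) ^ ((N : ℝ) - 1) :=
          Finset.sum_le_sum fun k _ => ENNReal.rpow_le_rpow (hQ m k.1) hd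
      _ = g m t := by
          rw [← Finset.sum_subtype (Finset.univ.filter fun k => t ∈ I m k) (by simp)
            fun _ => ENNReal.ofReal (r m) ^ ((N : ℝ) - 1), Finset.sum_filter]
          rfl

/-- On a compact set of points where `u` has zero strict derivative, the local Lipschitz constant
of `u` tends to zero uniformly at small scales. -/
lemma exists_dist_le_mul_of_hasStrictFDerivAt_zero {E : Type*} [NormedAddCommGroup E]
    [NormedSpace ℝ E] {K : Set E} (hK : IsCompact K) {u : E → ℝ}
    (hu : ∀ x ∈ K, HasStrictFDerivAt u (0 : E →L[ℝ] ℝ) x) {ε : ℝ} (hε : 0 < ε) :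
    ∃ δ > 0, ∀ x ∈ K, ∀ y ∈ K, dist x y < δ → dist (u x) (u y) ≤ ε * dist x y := by
  have hloc (x : K) : ∃ U : Set E, IsOpen U ∧ x.1 ∈ U ∧ LipschitzOnWith ⟨ε, hε.le⟩ u U := by
    obtain ⟨s, hs, hlip⟩ := (hu x x.2).exists_lipschitzOnWith_of_nnnorm_lt ⟨ε, hε.le⟩
      (by rw [nnnorm_zero]; exact hε)
    obtain ⟨U, hUs, hU, hxU⟩ := _root_.mem_nhds_iff.1 hs
    exact ⟨U, hU, hxU, hlip.mono hUs⟩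
  choose U hU hxU hlip using hloc
  obtain ⟨δ, hδ, h⟩ := lebesgue_number_lemma_of_metric hK hU
    fun x hx => mem_iUnion.2 ⟨⟨x, hx⟩, hxU _⟩
  refine ⟨δ, hδ, fun x hx y hy hxy => ?_⟩
  obtain ⟨i, hi⟩ := h x hx
  exact (hlip i).dist_le_mul x (hi (mem_ball_self hδ)) y (hi (mem_ball'.2 hxy))

/-- for a.e. level `t`, the critical part of the level set
`{u = t} ∩ {∇u = 0}` is `H^{N-1}`-negligible (formula (3.6) of the paper). -/
theorem critical_level_sets_hausdorff_null
    {N : ℕ}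
    (A : Set (EuclideanSpace ℝ (Fin N))) (hAo : IsOpen A)
    (hAb : Bornology.IsBounded A)
    (u : EuclideanSpace ℝ (Fin N) → ℝ)
    (hulip : ∃ L : ℝ≥0, LipschitzOnWith L u A)
    (hu1 : ContDiffOn ℝ 1 u A) :
    ∀ᵐ t : ℝ, μH[(N : ℝ) - 1] {x | x ∈ A ∧ u x = t ∧ gradient u x = 0} = 0 := by
  rcases Nat.eq_zero_or_pos N with rfl | hN
  · filter_upwards [Measure.ae_ne volume (u 0)] with t ht
    convert measure_empty (μ := μH[((0 : ℕ) : ℝ) - 1])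
    refine eq_empty_of_forall_notMem fun x hx => ht ?_
    rw [← hx.2.1, Subsingleton.elim x 0]
  obtain ⟨F, hF, hFA, hFU, -⟩ := hAo.exists_iUnion_isClosed
  have hfderiv (x : EuclideanSpace ℝ (Fin N)) : gradient u x = 0 ↔ fderiv ℝ u x = 0 := by
    simp [gradient]
  have hcompact (j : ℕ) : IsCompact (F j ∩ fderiv ℝ u ⁻¹' {0}) :=
    isCompact_of_isClosed_isBounded
      (((hu1.continuousOn_fderiv_of_isOpen hAo le_rfl).mono (hFA j)).preimage_isClosed_of_isClosed
        (hF j) isClosed_singleton)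
      (hAb.subset (inter_subset_left.trans (hFA j)))
  have hstrict (j : ℕ) : ∀ x ∈ F j ∩ fderiv ℝ u ⁻¹' {0},
      HasStrictFDerivAt u (0 : EuclideanSpace ℝ (Fin N) →L[ℝ] ℝ) x := by
    intro x hx
    have hx0 : fderiv ℝ u x = 0 := hx.2
    exact hx0 ▸ (hu1.contDiffAt (hAo.mem_nhds (hFA j hx.1))).hasStrictFDerivAt one_ne_zero
  have hnull (j : ℕ) := ae_hausdorffMeasure_levelSet_eq_zero hN (hcompact j).isBounded
    fun ε hε => exists_dist_le_mul_of_hasStrictFDerivAt_zero (hcompact j) (hstrict j) hε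
  filter_upwards [ae_all_iff.2 hnull] with t ht
  refine measure_mono_null ?_ (measure_iUnion_null ht)
  rintro x ⟨hxA, hxt, hx0⟩
  obtain ⟨j, hj⟩ := mem_iUnion.1 (hFU.symm ▸ hxA)
  exact mem_iUnion.2 ⟨j, ⟨hj, (hfderiv x).1 hx0⟩, hxt⟩
end
end
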